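/- Let 𝔽 be a fixed quadratic number field and let λ : ℝ → ℝ be an increasing function with λ(t) → ∞ and λ(t) = o(log t) as t → ∞. If X, Y → ∞ with Y ≥ X^2·(log X)^{14}·λ(X), then C_{𝔽,1}(X,Y) ~ ρ_𝔽·Y. -/

import Mathlib

/-!
Ramanujan sums over a quadratic number field: `C_{𝔽,1}(X,Y) = ρ_𝔽·Y + O(X·Y^{1/2}·(log Y)^7 + X^2)`.
-/

open NumberField Classical

/-- The Möbius function of a nonzero integral ideal: `0` if the ideal is not squarefree,
and `(-1)^r` if it is a product of `r` distinct prime ideals. -/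
noncomputable def idealMu {F : Type} [Field F] [NumberField F] (I : Ideal (𝓞 F)) : ℤ :=
  if Squarefree I then (-1) ^ Multiset.card (UniqueFactorizationMonoid.factors I) else 0

/-- The Ramanujan sum `c_m(n) = Σ_{d ∣ m, d ∣ n} N(d)·μ(m/d)`, written as a sum over
factorizations `m = d·e` with `d ∣ n` of `N(d)·μ(e)`. -/
noncomputable def ramanujanSum {F : Type} [Field F] [NumberField F]
    (m n : Ideal (𝓞 F)) : ℤ :=
  ∑ᶠ p ∈ {p : Ideal (𝓞 F) × Ideal (𝓞 F) | p.1 * p.2 = m ∧ p.1 ∣ n},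
    (Ideal.absNorm p.1 : ℤ) * idealMu p.2

/-- `C_{𝔽,1}(X,Y) = Σ_{0 ≠ n, N(n) ≤ Y} Σ_{0 ≠ m, N(m) ≤ X} c_m(n)`. -/
noncomputable def C1 (F : Type) [Field F] [NumberField F] (X Y : ℝ) : ℤ :=
  ∑ᶠ n ∈ {n : Ideal (𝓞 F) | n ≠ 0 ∧ (Ideal.absNorm n : ℝ) ≤ Y},
    ∑ᶠ m ∈ {m : Ideal (𝓞 F) | m ≠ 0 ∧ (Ideal.absNorm m : ℝ) ≤ X}, ramanujanSum m n


namespace C1proof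

/-- `e(x) = exp(2πix)`. -/
noncomputable def ee (x : ℝ) : ℂ := Complex.exp ((2 * Real.pi * x : ℝ) * Complex.I)

lemma ee_add (x y : ℝ) : ee (x + y) = ee x * ee y := by
  unfold ee; rw [← Complex.exp_add]; congr 1; push_cast; ring

lemma norm_ee (x : ℝ) : ‖ee x‖ = 1 := by
  unfold ee; exact Complex.norm_exp_ofReal_mul_I _

lemma ee_int (k : ℤ) : ee k = 1 := by
  unfold ee
  rw [Complex.exp_eq_one_iff]
  exact ⟨k, by push_cast; ring⟩

lemma ee_zero : ee 0 = 1 := by simpa using ee_int 0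

lemma ee_neg (x : ℝ) : ee (-x) = (starRingEnd ℂ) (ee x) := by
  unfold ee
  rw [← Complex.exp_conj]; congr 1
  rw [map_mul, Complex.conj_ofReal, Complex.conj_I]; push_cast; ring

lemma ee_nat_mul (x : ℝ) (n : ℕ) : ee (x * n) = ee x ^ n := by
  unfold ee
  rw [← Complex.exp_nat_mul]; congr 1; push_cast; ring

/-- Geometric sum. -/
noncomputable def DK (K : ℕ) (x : ℝ) : ℂ := ∑ a ∈ Finset.range K, ee (x * a)

lemma norm_DK_le (K : ℕ) (x : ℝ) : ‖DK K x‖ ≤ K := by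
  unfold DK
  refine (norm_sum_le _ _).trans ?_
  simp [norm_ee]

lemma norm_ee_sub_one (x : ℝ) : ‖ee x - 1‖ = 2 * |Real.sin (Real.pi * x)| := by
  have h : ee x - 1 = ee (x/2) * (2 * Complex.I * Complex.sin ((Real.pi * x : ℝ))) := by
    unfold ee
    rw [Complex.sin]
    have e1 : Complex.exp ((2 * Real.pi * x : ℝ) * Complex.I) =
      Complex.exp ((2 * Real.pi * (x/2) : ℝ) * Complex.I) * Complex.exp ((2 * Real.pi * (x/2) : ℝ) * Complex.I) := by
      rw [← Complex.exp_add]; congr 1; push_cast; ring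
    have e2 : (1:ℂ) = Complex.exp ((2 * Real.pi * (x/2) : ℝ) * Complex.I) * Complex.exp (-((2 * Real.pi * (x/2) : ℝ) * Complex.I)) := by
      rw [← Complex.exp_add]; simp
    rw [e1]
    have e3 : ((2 * Real.pi * (x/2) : ℝ) * Complex.I) = ((Real.pi * x : ℝ)) * Complex.I := by push_cast; ring
    rw [e3] at e2 ⊢
    have e4 : -((Real.pi * x : ℝ) : ℂ) * Complex.I = -(((Real.pi * x : ℝ) : ℂ) * Complex.I) := by ring
    rw [e4]
    linear_combination (Complex.exp (↑(Real.pi * x) * Complex.I)) * (Complex.exp (-(↑(Real.pi * x) * Complex.I)) - Complex.exp (↑(Real.pi * x) * Complex.I)) * (-Complex.I_sq) - e2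
  rw [h, norm_mul, norm_ee, ← Complex.ofReal_sin, norm_mul, Complex.norm_real, norm_mul, Complex.norm_I]
  simp only [Real.norm_eq_abs, Complex.norm_ofNat]; ring

lemma norm_DK_mul (K : ℕ) (x : ℝ) : ‖DK K x‖ * |Real.sin (Real.pi * x)| ≤ 1 := by
  have h : DK K x * (ee x - 1) = ee x ^ K - 1 := by
    unfold DK
    simp_rw [ee_nat_mul]
    exact geom_sum_mul _ _
  have h2 := congrArg norm h
  rw [norm_mul, norm_ee_sub_one] at h2
  have h3 : ‖ee x ^ K - 1‖ ≤ 2 := by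
    refine (norm_sub_le _ _).trans ?_
    rw [norm_pow, norm_ee]; norm_num
  nlinarith

lemma sin_pi_lower (x : ℝ) (h0 : 0 ≤ x) (h1 : x ≤ 1) : 2 * min x (1 - x) ≤ Real.sin (Real.pi * x) := by
  rcases le_total x (1/2) with h | h
  · have := Real.mul_le_sin (x := Real.pi * x) (by positivity) (by nlinarith [Real.pi_pos])
    rw [min_eq_left (by linarith)]
    have e : 2 / Real.pi * (Real.pi * x) = 2 * x := by field_simp
    linarith
  · have := Real.mul_le_sin (x := Real.pi * (1-x)) (by have := Real.pi_pos; nlinarith) (by nlinarith [Real.pi_pos])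
    rw [min_eq_right (by linarith)]
    have e : 2 / Real.pi * (Real.pi * (1-x)) = 2 * (1-x) := by field_simp
    have e2 : Real.sin (Real.pi * (1-x)) = Real.sin (Real.pi * x) := by
      rw [show Real.pi * (1-x) = Real.pi - Real.pi * x by ring, Real.sin_pi_sub]
    linarith

lemma norm_DK_sq_le (K : ℕ) (x : ℝ) (h0 : x ≠ 0) (h1 : |x| < 1) :
    ‖DK K x‖ ^ 2 ≤ (1/4) * (1 / x ^ 2 + 1 / (x + 1) ^ 2 + 1 / (x - 1) ^ 2) := by
  have hs : |Real.sin (Real.pi * x)| = Real.sin (Real.pi * |x|) := by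
    rcases abs_cases x with ⟨h, h'⟩ | ⟨h, h'⟩
    · rw [h]; rw [abs_of_nonneg]
      apply Real.sin_nonneg_of_nonneg_of_le_pi (by positivity)
      rw [h] at h1; nlinarith [Real.pi_pos]
    · rw [h]
      rw [h] at h1
      rw [mul_neg, Real.sin_neg, abs_of_nonpos]
      have : 0 ≤ Real.sin (Real.pi * (-x)) := by
        apply Real.sin_nonneg_of_nonneg_of_le_pi
        · have := Real.pi_pos; nlinarith
        · nlinarith [Real.pi_pos]
      rw [mul_neg, Real.sin_neg] at this; linarith
  have hl := sin_pi_lower |x| (abs_nonneg _) h1.le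
  have hx : 0 < |x| := abs_pos.mpr h0
  set m := min |x| (1 - |x|) with hm
  have hmp : 0 < m := lt_min hx (by linarith)
  have hk : ‖DK K x‖ * (2 * m) ≤ 1 := by
    refine le_trans ?_ (norm_DK_mul K x)
    rw [hs]; gcongr
  have hk2 : ‖DK K x‖ ^ 2 ≤ (1/4) * (1 / m ^ 2) := by
    have : ‖DK K x‖ ≤ 1 / (2 * m) := by rw [le_div_iff₀ (by positivity)]; exact hk
    calc ‖DK K x‖ ^ 2 ≤ (1 / (2*m)) ^ 2 := by gcongr
      _ = _ := by field_simp; norm_num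
  refine hk2.trans ?_
  gcongr
  have p1 : 0 ≤ 1 / x ^ 2 := by positivity
  have p2 : 0 ≤ 1 / (x+1) ^ 2 := by positivity
  have p3 : 0 ≤ 1 / (x-1) ^ 2 := by positivity
  rcases min_choice |x| (1 - |x|) with h | h
  · rw [hm, h, sq_abs]; linarith
  · rw [hm, h]
    rcases abs_cases x with ⟨h, h'⟩ | ⟨h, h'⟩
    · rw [h, show (1 - x)^2 = (x-1)^2 by ring]; linarith
    · rw [h, show (1 - -x)^2 = (x+1)^2 by ring]; linarith

lemma sum_inv_sq_le (n : ℕ) : ∑ j ∈ Finset.Icc 1 n, (1:ℝ) / (j:ℝ)^2 ≤ 2 := by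
  have : ∀ n : ℕ, ∑ j ∈ Finset.Icc 1 (n+1), (1:ℝ) / (j:ℝ)^2 ≤ 2 - 1 / (n+1) := by
    intro n
    induction n with
    | zero => simp; norm_num
    | succ k ih =>
      rw [Finset.sum_Icc_succ_top (by omega)]
      have : (1:ℝ) / ((k+1+1 : ℕ):ℝ)^2 ≤ 1 / (k+1) - 1 / (k+1+1) := by
        push_cast
        have : (1:ℝ) / (k+1) - 1 / (k+1+1) = 1/((k+1)*(k+1+1)) := by field_simp; ring
        rw [this]
        apply one_div_le_one_div_of_le (by positivity)
        nlinarith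
      push_cast at *
      linarith
  rcases n with _ | n
  · simp
  refine (this n).trans ?_
  have : (0:ℝ) ≤ 1 / (n+1) := by positivity
  linarith

lemma sum_int_inv_sq_le (S : Finset ℤ) (h : (0:ℤ) ∉ S) : ∑ j ∈ S, (1:ℝ) / (j:ℝ)^2 ≤ 4 := by
  have h1 : ∀ T : Finset ℤ, (∀ j ∈ T, 0 < j) → ∑ j ∈ T, (1:ℝ) / (j:ℝ)^2 ≤ 2 := by
    intro T hT
    have : ∑ j ∈ T, (1:ℝ) / (j:ℝ)^2 = ∑ k ∈ T.image Int.toNat, (1:ℝ) / (k:ℝ)^2 := by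
      rw [Finset.sum_image]
      · apply Finset.sum_congr rfl
        intro j hj
        have : ((j.toNat : ℤ) : ℝ) = (j:ℝ) := by rw [Int.toNat_of_nonneg (hT j hj).le]
        rw [← this, Int.cast_natCast]
      · intro a ha b hb hab
        have := hT a ha; have := hT b hb
        omega
    rw [this]
    refine le_trans (Finset.sum_le_sum_of_subset_of_nonneg ?_ ?_) (sum_inv_sq_le ((T.image Int.toNat).sup id))
    · intro k hk
      rw [Finset.mem_Icc]
      refine ⟨?_, Finset.le_sup (f := id) hk⟩
      obtain ⟨j, hj, rfl⟩ := Finset.mem_image.mp hk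
      have := hT j hj; omega
    · intros; positivity
  rw [← Finset.sum_filter_add_sum_filter_not S (fun j => 0 < j)]
  have e : ∑ j ∈ S.filter (fun j => ¬ 0 < j), (1:ℝ) / (j:ℝ)^2 = ∑ j ∈ (S.filter (fun j => ¬ 0 < j)).image (fun j => -j), (1:ℝ) / (j:ℝ)^2 := by
    rw [Finset.sum_image (by intro a _ b _ hab; simpa using hab)]
    apply Finset.sum_congr rfl
    intro j _; push_cast; rw [neg_sq]
  rw [e]
  have a1 := h1 (S.filter (fun j => 0 < j)) (by simp)
  have a2 := h1 ((S.filter (fun j => ¬ 0 < j)).image (fun j => -j)) (by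
    intro j hj
    obtain ⟨i, hi, rfl⟩ := Finset.mem_image.mp hj
    rw [Finset.mem_filter] at hi
    have : i ≠ 0 := by rintro rfl; exact h hi.1
    omega)
  linarith

lemma spaced_sum {ι : Type*} (S : Finset ι) (y : ι → ℝ) (h1 : ∀ i ∈ S, 1 ≤ |y i|)
    (h2 : ∀ i ∈ S, ∀ j ∈ S, i ≠ j → 1 ≤ |y i - y j|) : ∑ i ∈ S, 1 / (y i)^2 ≤ 16 := by
  have hinj : Set.InjOn (fun i => ⌊y i⌋) (S : Set ι) := by
    intro a ha b hb hab
    by_contra hne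
    have := h2 a ha b hb hne
    simp only at hab
    have := Int.abs_sub_lt_one_of_floor_eq_floor hab
    linarith
  have hz : (0:ℤ) ∉ S.image (fun i => ⌊y i⌋) := by
    intro h
    obtain ⟨i, hi, h⟩ := Finset.mem_image.mp h
    have h3 := Int.floor_eq_zero_iff.mp h
    have := h1 i hi
    rw [abs_of_nonneg h3.1] at this
    linarith [h3.2]
  have hs := sum_int_inv_sq_le _ hz
  rw [Finset.sum_image hinj] at hs
  calc ∑ i ∈ S, 1 / (y i)^2 ≤ ∑ i ∈ S, 4 * (1 / ((⌊y i⌋ : ℤ):ℝ)^2) := by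
        apply Finset.sum_le_sum
        intro i hi
        have hy := h1 i hi
        have hne : (⌊y i⌋ : ℤ) ≠ 0 := fun h => hz (Finset.mem_image.mpr ⟨i, hi, h⟩)
        have hne' : ((⌊y i⌋ : ℤ):ℝ) ≠ 0 := by exact_mod_cast hne
        have hle := Int.floor_le (y i)
        have hlt := Int.lt_floor_add_one (y i)
        have : |((⌊y i⌋ : ℤ):ℝ)| ≤ 2 * |y i| := by
          have : |((⌊y i⌋ : ℤ):ℝ)| ≤ |y i| + 1 := by
            rw [abs_le]; constructor
            · have := neg_abs_le (y i); linarith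
            · have := le_abs_self (y i); linarith
          linarith
        have h4 : ((⌊y i⌋ : ℤ):ℝ)^2 ≤ 4 * (y i)^2 := by
          rw [← sq_abs, ← sq_abs (y i)]
          nlinarith [abs_nonneg ((⌊y i⌋ : ℤ):ℝ)]
        have hyp : 0 < (y i)^2 := by
          have : y i ≠ 0 := by intro h; rw [h] at hy; norm_num at hy
          positivity
        rw [mul_one_div, div_le_div_iff₀ hyp (by positivity)]
        linarith
    _ ≤ 16 := by rw [← Finset.mul_sum]; linarith
end C1proof

namespace C1proof

lemma norm_DK_neg (K : ℕ) (x : ℝ) : ‖DK K (-x)‖ = ‖DK K x‖ := by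
  have : DK K (-x) = (starRingEnd ℂ) (DK K x) := by
    unfold DK
    rw [map_sum]
    apply Finset.sum_congr rfl
    intro a _
    rw [← ee_neg]; congr 1; ring
  rw [this, Complex.norm_conj]

lemma rat_lower (r r' : ℚ) (s : ℤ) (M : ℕ) (h : r.den ≤ M) (h' : r'.den ≤ M) (hne : r' - r - s ≠ 0) :
    1 ≤ |(M:ℝ)^2 * ((r':ℝ) - r - s)| := by
  have hd : (r' - r - s) * (r'.den * r.den) = ((r'.num * r.den - r.num * r'.den - s * (r'.den * r.den) : ℤ) : ℚ) := by
    have e1 := Rat.mul_den_eq_num r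
    have e2 := Rat.mul_den_eq_num r'
    push_cast
    linear_combination (r.den:ℚ) * e2 - (r'.den:ℚ) * e1
  set z : ℤ := r'.num * r.den - r.num * r'.den - s * (r'.den * r.den) with hz
  have hz0 : z ≠ 0 := by
    intro h0
    rw [h0] at hd
    have p1 : (0:ℚ) < r.den := by exact_mod_cast r.den_pos
    have p2 : (0:ℚ) < r'.den := by exact_mod_cast r'.den_pos
    rcases mul_eq_zero.mp (hd.trans (by simp)) with h | h
    · exact hne h
    · have : (0:ℚ) < r'.den * r.den := by positivity
      linarith
  have hzz : (1:ℝ) ≤ |(z:ℝ)| := by exact_mod_cast Int.one_le_abs hz0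
  have hd' : ((r':ℝ) - r - s) * (r'.den * r.den) = (z:ℝ) := by exact_mod_cast hd
  rw [abs_mul, abs_of_nonneg (by positivity)]
  rw [← hd', abs_mul, abs_of_nonneg (a := ((r'.den:ℝ) * r.den)) (by positivity)] at hzz
  have hle : ((r'.den:ℝ) * r.den) ≤ (M:ℝ)^2 := by
    rw [sq]; gcongr
  nlinarith [abs_nonneg ((r':ℝ) - r - s)]

lemma shift_sum (R : Finset ℚ) (M : ℕ) (hR : ∀ r ∈ R, 0 < r ∧ r < 1 ∧ r.den ≤ M) (r : ℚ) (hr : r ∈ R) (s : ℤ) 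
    (hs : ∀ r' ∈ R.erase r, r' - r - s ≠ 0) : 
    ∑ r' ∈ R.erase r, 1 / ((r':ℝ) - r - s)^2 ≤ 16 * (M:ℝ)^4 := by
  have h := spaced_sum (R.erase r) (fun r' => (M:ℝ)^2 * ((r':ℝ) - r - s)) (by
    intro r' hr'
    exact rat_lower r r' s M (hR r hr).2.2 (hR r' (Finset.mem_of_mem_erase hr')).2.2 (hs r' hr')) (by
    intro a ha b hb hab
    have := rat_lower b a 0 M (hR b (Finset.mem_of_mem_erase hb)).2.2 (hR a (Finset.mem_of_mem_erase ha)).2.2 (by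
      simpa using sub_ne_zero.mpr hab)
    convert this using 2
    push_cast; ring)
  have hM : (0:ℝ) < M := by
    have := (hR r hr).2.2; have := r.den_pos
    exact_mod_cast (by omega : 0 < M)
  have e : ∀ r' ∈ R.erase r, 1 / ((r':ℝ) - r - s)^2 = (M:ℝ)^4 * (1 / ((M:ℝ)^2 * ((r':ℝ) - r - s))^2) := by
    intro r' hr'
    have : ((r':ℝ) - r - s) ≠ 0 := by exact_mod_cast hs r' hr'
    field_simp
  rw [Finset.sum_congr rfl e, ← Finset.mul_sum]
  nlinarith [pow_pos hM 4]

lemma schur_row (R : Finset ℚ) (M : ℕ) (hR : ∀ r ∈ R, 0 < r ∧ r < 1 ∧ r.den ≤ M) (K : ℕ) (r : ℚ) (hr : r ∈ R) :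
    ∑ r' ∈ R, ‖DK K ((r':ℝ) - r)‖^2 ≤ (K:ℝ)^2 + 12 * (M:ℝ)^4 := by
  rw [← Finset.add_sum_erase R _ hr]
  have a0 : ‖DK K ((r:ℝ) - r)‖^2 ≤ (K:ℝ)^2 := by gcongr; exact norm_DK_le _ _
  have hb : ∀ r' ∈ R.erase r, r' ≠ r ∧ -1 < r' - r ∧ r' - r < 1 := by
    intro r' hr'
    have := Finset.ne_of_mem_erase hr'
    have h1 := hR r hr
    have h2 := hR r' (Finset.mem_of_mem_erase hr')
    refine ⟨this, ?_, ?_⟩ <;> linarith [h1.1, h1.2.1, h2.1, h2.2.1]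
  have s0 := shift_sum R M hR r hr 0 (by intro r' hr'; simpa using sub_ne_zero.mpr (hb r' hr').1)
  have s1 := shift_sum R M hR r hr 1 (by intro r' hr'; have := (hb r' hr').2.2; push_cast; intro h; linarith)
  have s2 := shift_sum R M hR r hr (-1) (by intro r' hr'; have := (hb r' hr').2.1; push_cast; intro h; linarith)
  have key : ∑ r' ∈ R.erase r, ‖DK K ((r':ℝ) - r)‖^2 ≤ ∑ r' ∈ R.erase r, (1/4) * (1 / ((r':ℝ) - r - (0:ℤ))^2 + 1 / ((r':ℝ) - r - (-1:ℤ))^2 + 1 / ((r':ℝ) - r - (1:ℤ))^2) := by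
    apply Finset.sum_le_sum
    intro r' hr'
    have := norm_DK_sq_le K ((r':ℝ) - r) (by have := (hb r' hr').1; intro h; apply this; exact_mod_cast sub_eq_zero.mp h) (by
      rw [abs_lt]; exact ⟨by exact_mod_cast (hb r' hr').2.1, by exact_mod_cast (hb r' hr').2.2⟩)
    refine this.trans (le_of_eq ?_)
    push_cast; simp
  rw [← Finset.mul_sum, Finset.sum_add_distrib, Finset.sum_add_distrib] at key
  linarith

lemma LS (R : Finset ℚ) (M : ℕ) (hR : ∀ r ∈ R, 0 < r ∧ r < 1 ∧ r.den ≤ M) (α : ℚ → ℂ) (N : ℕ) :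
    N * ∑ n ∈ Finset.range N, ‖∑ r ∈ R, α r * ee (r * n)‖^2 ≤
      (4 * (N:ℝ)^2 + 12 * (M:ℝ)^4) * ∑ r ∈ R, ‖α r‖^2 := by
  set S : ℝ → ℂ := fun k => ∑ r ∈ R, α r * ee (r * k) with hS
  have h1 : N * ∑ n ∈ Finset.range N, ‖S n‖^2 ≤ ∑ b ∈ Finset.range (2*N), ∑ a ∈ Finset.range (2*N), ‖S ((a:ℝ) - b)‖^2 := by
    calc N * ∑ n ∈ Finset.range N, ‖S n‖^2 = ∑ b ∈ Finset.range N, ∑ n ∈ Finset.range N, ‖S n‖^2 := by simp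
      _ ≤ ∑ b ∈ Finset.range N, ∑ a ∈ Finset.range (2*N), ‖S ((a:ℝ) - b)‖^2 := by
        apply Finset.sum_le_sum
        intro b hb
        have hb := Finset.mem_range.mp hb
        calc ∑ n ∈ Finset.range N, ‖S n‖^2 = ∑ a ∈ (Finset.range N).map (addRightEmbedding b), ‖S ((a:ℝ) - b)‖^2 := by
              rw [Finset.sum_map]; simp
          _ ≤ _ := by
              apply Finset.sum_le_sum_of_subset_of_nonneg
              · intro a ha
                simp only [Finset.mem_map, Finset.mem_range, addRightEmbedding_apply] at ha ⊢
                obtain ⟨c, hc, rfl⟩ := ha; omega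
              · intros; positivity
      _ ≤ _ := by
        apply Finset.sum_le_sum_of_subset_of_nonneg
        · intro a ha; simp only [Finset.mem_range] at *; omega
        · intros; positivity
  have h2 : ((∑ b ∈ Finset.range (2*N), ∑ a ∈ Finset.range (2*N), ‖S ((a:ℝ) - b)‖^2 : ℝ) : ℂ) = 
      ∑ r ∈ R, ∑ r' ∈ R, α r * (starRingEnd ℂ) (α r') * (DK (2*N) ((r:ℝ) - r') * (starRingEnd ℂ) (DK (2*N) ((r:ℝ) - r'))) := by
    push_cast
    have e : ∀ a b : ℕ, ((‖S ((a:ℝ) - b)‖ : ℂ))^2 = ∑ r ∈ R, ∑ r' ∈ R, α r * (starRingEnd ℂ) (α r') * (ee (((r:ℝ) - r') * a) * (starRingEnd ℂ) (ee (((r:ℝ) - r') * b))) := by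
      intro a b
      rw [← Complex.mul_conj']
      simp only [hS]
      rw [map_sum, Finset.sum_mul_sum]
      refine Finset.sum_congr rfl fun r _ => Finset.sum_congr rfl fun r' _ => ?_
      rw [map_mul, ← ee_neg, ← ee_neg, mul_mul_mul_comm, ← ee_add, ← ee_add]
      congr 2; ring
    simp_rw [e]
    have e3 : ∀ r r' : ℚ, DK (2*N) ((r:ℝ) - r') * (starRingEnd ℂ) (DK (2*N) ((r:ℝ) - r')) = ∑ b ∈ Finset.range (2*N), ∑ a ∈ Finset.range (2*N), ee (((r:ℝ) - r') * a) * (starRingEnd ℂ) (ee (((r:ℝ) - r') * b)) := by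
      intro r r'
      unfold DK
      rw [map_sum, Finset.sum_mul_sum, Finset.sum_comm]
    simp_rw [e3, Finset.mul_sum]
    calc _ = ∑ b ∈ Finset.range (2*N), ∑ r ∈ R, ∑ a ∈ Finset.range (2*N), ∑ r' ∈ R, α r * (starRingEnd ℂ) (α r') * (ee (((r:ℝ) - r') * a) * (starRingEnd ℂ) (ee (((r:ℝ) - r') * b))) :=
          Finset.sum_congr rfl fun b _ => Finset.sum_comm
      _ = ∑ b ∈ Finset.range (2*N), ∑ r ∈ R, ∑ r' ∈ R, ∑ a ∈ Finset.range (2*N), α r * (starRingEnd ℂ) (α r') * (ee (((r:ℝ) - r') * a) * (starRingEnd ℂ) (ee (((r:ℝ) - r') * b))) :=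
          Finset.sum_congr rfl fun b _ => Finset.sum_congr rfl fun r _ => Finset.sum_comm
      _ = _ := by
          rw [Finset.sum_comm]
          exact Finset.sum_congr rfl fun r _ => Finset.sum_comm
  have h3 : ∑ b ∈ Finset.range (2*N), ∑ a ∈ Finset.range (2*N), ‖S ((a:ℝ) - b)‖^2 ≤ ∑ r ∈ R, ∑ r' ∈ R, ‖α r‖ * ‖α r'‖ * ‖DK (2*N) ((r:ℝ) - r')‖^2 := by
    have := congrArg norm h2
    rw [Complex.norm_real, Real.norm_of_nonneg (by positivity)] at this
    rw [this]
    refine (norm_sum_le _ _).trans (Finset.sum_le_sum fun r _ => (norm_sum_le _ _).trans (Finset.sum_le_sum fun r' _ => ?_))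
    rw [norm_mul, norm_mul, norm_mul, Complex.norm_conj, Complex.norm_conj, sq]
  refine h1.trans (h3.trans ?_)
  have h4 : ∑ r ∈ R, ∑ r' ∈ R, ‖α r‖ * ‖α r'‖ * ‖DK (2*N) ((r:ℝ) - r')‖^2 ≤ ∑ r ∈ R, ∑ r' ∈ R, (1/2 * (‖α r‖^2 * ‖DK (2*N) ((r':ℝ) - r)‖^2) + 1/2 * (‖α r'‖^2 * ‖DK (2*N) ((r:ℝ) - r')‖^2)) := by
    refine Finset.sum_le_sum fun r _ => Finset.sum_le_sum fun r' _ => ?_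
    rw [show (r':ℝ) - r = -((r:ℝ) - r') by ring, norm_DK_neg]
    nlinarith [sq_nonneg (‖DK (2*N) ((r:ℝ) - r')‖ * (‖α r‖ - ‖α r'‖))]
  refine h4.trans ?_
  simp_rw [Finset.sum_add_distrib]
  rw [Finset.sum_comm (f := fun (r r' : ℚ) => 1/2 * (‖α r'‖^2 * ‖DK (2*N) ((r:ℝ) - r')‖^2)), ← Finset.sum_add_distrib, Finset.mul_sum]
  apply Finset.sum_le_sum
  intro r hr
  rw [← Finset.mul_sum, ← Finset.mul_sum]
  have := schur_row R M hR (2*N) r hr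
  push_cast at this
  nlinarith [sq_nonneg ‖α r‖, mul_le_mul_of_nonneg_left this (sq_nonneg ‖α r‖)]
end C1proof

namespace C1proof

lemma geom_orth (c : ℕ) (hc : 1 ≤ c) (k : ℤ) :
    ∑ j ∈ Finset.range c, ee ((k:ℝ) / c * j) = if (c:ℤ) ∣ k then (c:ℂ) else 0 := by
  have hc0 : (c:ℝ) ≠ 0 := by positivity
  split_ifs with h
  · obtain ⟨l, rfl⟩ := h
    have : ∀ j ∈ Finset.range c, ee ((((c:ℤ) * l : ℤ):ℝ) / c * j) = 1 := by
      intro j _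
      have : ((((c:ℤ) * l : ℤ):ℝ) / c * j) = ((l * j : ℤ) : ℝ) := by
        push_cast; field_simp
      rw [this, ee_int]
    rw [Finset.sum_congr rfl this]; simp
  · have h1 : (∑ j ∈ Finset.range c, ee ((k:ℝ) / c * j)) * (ee ((k:ℝ)/c) - 1) = 0 := by
      simp_rw [ee_nat_mul]
      rw [geom_sum_mul, ← ee_nat_mul, div_mul_cancel₀ _ hc0, ee_int, sub_self]
    rcases mul_eq_zero.mp h1 with h2 | h2
    · exact h2
    · exfalso; apply h
      have h3 := sub_eq_zero.mp h2
      unfold ee at h3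
      rw [Complex.exp_eq_one_iff] at h3
      obtain ⟨n, hn⟩ := h3
      have hpi : (2 * (Real.pi:ℂ) * Complex.I) ≠ 0 := by
        simp [Real.pi_ne_zero]
      have : (((k:ℝ)/c : ℝ) : ℂ) = (n : ℂ) := by
        apply mul_right_cancel₀ hpi
        rw [← hn]; push_cast; ring
      have h4 : ((k:ℝ)/c) = (n:ℝ) := by exact_mod_cast this
      rw [div_eq_iff hc0] at h4
      exact ⟨n, by have : k = n * c := by exact_mod_cast h4
                   rw [this]; ring⟩

lemma DK_mod (c : ℕ) (hc : 1 ≤ c) (j : ℕ) (hj : j ∈ Finset.Ico 1 c) (H : ℕ) :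
    DK H ((j:ℝ)/c) = DK (H % c) ((j:ℝ)/c) := by
  rw [Finset.mem_Ico] at hj
  have hz : DK c ((j:ℝ)/c) = 0 := by
    have := geom_orth c hc j
    rw [if_neg] at this
    · unfold DK; rw [Int.cast_natCast] at this; exact this
    · intro h
      have := Int.le_of_dvd (by omega) h
      omega
  have hp : ∀ K, DK (c + K) ((j:ℝ)/c) = DK K ((j:ℝ)/c) := by
    intro K
    have : DK (c + K) ((j:ℝ)/c) = DK c ((j:ℝ)/c) + DK K ((j:ℝ)/c) := by
      unfold DK
      rw [Finset.sum_range_add]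
      congr 1
      apply Finset.sum_congr rfl
      intro a _
      have hc0 : (c:ℝ) ≠ 0 := by positivity
      have : (j:ℝ)/c * ((c + a : ℕ) : ℝ) = ((j:ℤ):ℝ) + (j:ℝ)/c * a := by
        push_cast; field_simp
      rw [this, ee_add, ee_int, one_mul]
    rw [this, hz, zero_add]
  have : ∀ u v, DK (c * u + v) ((j:ℝ)/c) = DK v ((j:ℝ)/c) := by
    intro u v
    induction u with
    | zero => simp
    | succ u ih => rw [← ih, ← hp (c*u+v)]; congr 1; ring
  conv_lhs => rw [← Nat.div_add_mod H c]
  exact this _ _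

lemma parseval (c : ℕ) (hc : 1 ≤ c) (v : ℕ) (hv : v < c) :
    ∑ j ∈ Finset.range c, ‖DK v ((j:ℝ)/c)‖^2 = v * c := by
  have h : ((∑ j ∈ Finset.range c, ‖DK v ((j:ℝ)/c)‖^2 : ℝ) : ℂ) = (v * c : ℂ) := by
    push_cast
    have e : ∀ j ∈ Finset.range c, (‖DK v ((j:ℝ)/c)‖ : ℂ)^2 = ∑ a ∈ Finset.range v, ∑ b ∈ Finset.range v, ee (((a - b : ℤ):ℝ)/c * j) := by
      intro j _
      rw [← Complex.mul_conj']
      unfold DK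
      rw [map_sum, Finset.sum_mul_sum]
      refine Finset.sum_congr rfl fun a _ => Finset.sum_congr rfl fun b _ => ?_
      rw [← ee_neg, ← ee_add]; congr 1; push_cast; ring
    rw [Finset.sum_congr rfl e, Finset.sum_comm]
    have e2 : ∀ a ∈ Finset.range v, ∑ j ∈ Finset.range c, ∑ b ∈ Finset.range v, ee (((a - b : ℤ):ℝ)/c * j) = (c:ℂ) := by
      intro a ha
      rw [Finset.sum_comm]
      simp_rw [geom_orth c hc]
      rw [Finset.sum_eq_single a]
      · simp
      · intro b hb hne
        rw [if_neg]
        rintro ⟨l, hl⟩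
        rw [Finset.mem_range] at ha hb
        have hl1 : l < 1 := by by_contra hh; nlinarith
        have hl2 : -1 < l := by by_contra hh; nlinarith
        have : l = 0 := by omega
        subst this; omega
      · intro h; exact absurd ha h
    rw [Finset.sum_congr rfl e2]; simp
  exact_mod_cast h

lemma DK_sum_le (c : ℕ) (hc : 1 ≤ c) (H : ℕ) :
    ∑ j ∈ Finset.Ico 1 c, ‖DK H ((j:ℝ)/c)‖^2 ≤ c * H := by
  have : ∑ j ∈ Finset.Ico 1 c, ‖DK H ((j:ℝ)/c)‖^2 = ∑ j ∈ Finset.Ico 1 c, ‖DK (H % c) ((j:ℝ)/c)‖^2 :=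
    Finset.sum_congr rfl fun j hj => by rw [DK_mod c hc j hj]
  rw [this]
  calc _ ≤ ∑ j ∈ Finset.range c, ‖DK (H % c) ((j:ℝ)/c)‖^2 := by
        apply Finset.sum_le_sum_of_subset_of_nonneg
        · intro j hj; simp only [Finset.mem_Ico, Finset.mem_range] at *; omega
        · intros; positivity
    _ = _ := parseval c hc _ (Nat.mod_lt _ hc)
    _ ≤ c * H := by
        rw [mul_comm]; gcongr; exact Nat.mod_le _ _

/-- Fractions in (0,1) with denominator at most `M`. -/
noncomputable def RR (M : ℕ) : Finset ℚ :=
  (Finset.Icc 1 M).biUnion fun m => (Finset.Ico 1 m).image (fun j : ℕ => (j:ℚ)/m)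

lemma den_div_dvd (j m : ℕ) : ((j:ℚ)/m).den ∣ m := by
  have := Rat.den_dvd (j:ℤ) (m:ℤ)
  rw [Rat.divInt_eq_div, Int.cast_natCast, Int.cast_natCast] at this
  exact Int.natCast_dvd_natCast.mp this

lemma mem_RR {M : ℕ} {r : ℚ} : r ∈ RR M ↔ 0 < r ∧ r < 1 ∧ r.den ≤ M := by
  unfold RR
  simp only [Finset.mem_biUnion, Finset.mem_image, Finset.mem_Icc, Finset.mem_Ico]
  constructor
  · rintro ⟨m, ⟨hm1, hm2⟩, j, ⟨hj1, hj2⟩, rfl⟩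
    have hm : (0:ℚ) < m := by exact_mod_cast hm1
    have hj : (0:ℚ) < j := by exact_mod_cast hj1
    refine ⟨by positivity, by rw [div_lt_one hm]; exact_mod_cast hj2, ?_⟩
    have : ((j:ℚ)/m).den ∣ m := by
      exact den_div_dvd j m
    exact (Nat.le_of_dvd hm1 this).trans hm2
  · rintro ⟨h0, h1, hd⟩
    refine ⟨r.den, ⟨r.den_pos, hd⟩, r.num.toNat, ?_, ?_⟩
    · have a1 := Rat.num_pos.mpr h0
      have a2 : r.num < r.den := by exact Rat.num_lt_denom_iff.mpr h1
      omega
    · have a1 := Rat.num_pos.mpr h0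
      have : ((r.num.toNat : ℕ) : ℚ) = (r.num : ℚ) := by
        rw [← Int.cast_natCast, Int.toNat_of_nonneg a1.le]
      rw [this, Rat.num_div_den]

lemma RR_filter (M m : ℕ) (hm : m ∈ Finset.Icc 1 M) :
    (RR M).filter (fun r => r.den ∣ m) = (Finset.Ico 1 m).image (fun j : ℕ => (j:ℚ)/m) := by
  rw [Finset.mem_Icc] at hm
  have hmp : (0:ℚ) < m := by exact_mod_cast hm.1
  ext r
  rw [Finset.mem_filter, mem_RR]
  simp only [Finset.mem_image, Finset.mem_Ico]
  constructor
  · rintro ⟨⟨h0, h1, _⟩, k, hk⟩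
    have a1 := Rat.num_pos.mpr h0
    have e : r * m = ((r.num * k : ℤ) : ℚ) := by
      have := Rat.mul_den_eq_num r
      rw [hk]; push_cast; rw [← this]; ring
    have e3 : ((((r.num * k).toNat : ℕ) : ℤ)) = r.num * k := Int.toNat_of_nonneg (by positivity)
    have e2 : (((r.num * k).toNat : ℕ) : ℚ) = r * m := by
      rw [e, ← e3]; push_cast; rfl
    refine ⟨(r.num * k).toNat, ⟨?_, ?_⟩, ?_⟩
    · have : (0:ℚ) < ((r.num * k).toNat : ℕ) := by rw [e2]; positivity
      exact_mod_cast this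
    · have : (((r.num * k).toNat : ℕ):ℚ) < m := by rw [e2]; nlinarith
      exact_mod_cast this
    · rw [e2]; field_simp
  · rintro ⟨j, ⟨hj1, hj2⟩, rfl⟩
    have hd : ((j:ℚ)/m).den ∣ m := by
      exact den_div_dvd j m
    have hj : (0:ℚ) < j := by exact_mod_cast hj1
    refine ⟨⟨by positivity, by rw [div_lt_one hmp]; exact_mod_cast hj2, (Nat.le_of_dvd hm.1 hd).trans hm.2⟩, hd⟩

lemma sum_RR_filter (M m : ℕ) (hm : m ∈ Finset.Icc 1 M) {E : Type*} [AddCommMonoid E] (f : ℝ → E) :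
    ∑ r ∈ (RR M).filter (fun r => r.den ∣ m), f r = ∑ j ∈ Finset.Ico 1 m, f ((j:ℝ)/m) := by
  rw [RR_filter M m hm, Finset.sum_image]
  · simp
  · intro a _ b _ hab
    rw [Finset.mem_Icc] at hm
    have hmp : (m:ℚ) ≠ 0 := by have := hm.1; positivity
    simp only at hab
    rw [div_left_inj' hmp] at hab
    exact_mod_cast hab

lemma orth (M m : ℕ) (hm : m ∈ Finset.Icc 1 M) (k : ℤ) :
    ∑ r ∈ (RR M).filter (fun r => r.den ∣ m), ee ((r:ℝ) * k) = (if (m:ℤ) ∣ k then (m:ℂ) else 0) - 1 := by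
  rw [sum_RR_filter M m hm (fun x => ee (x * k))]
  rw [Finset.mem_Icc] at hm
  rw [← geom_orth m hm.1 k, Finset.range_eq_Ico, Finset.sum_eq_sum_Ico_succ_bot (by omega : 0 < m)]
  simp only [Nat.cast_zero, mul_zero, ee_zero, zero_add]
  rw [add_sub_cancel_left]
  apply Finset.sum_congr rfl
  intro j _; congr 1; ring

lemma harm_le (n : ℕ) (M : ℕ) (h : n ≤ M) : ∑ k ∈ Finset.Icc 1 n, (1:ℝ)/k ≤ 1 + Real.log M := by
  calc ∑ k ∈ Finset.Icc 1 n, (1:ℝ)/k ≤ ∑ k ∈ Finset.Icc 1 M, (1:ℝ)/k := by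
        apply Finset.sum_le_sum_of_subset_of_nonneg
        · intro k hk; simp only [Finset.mem_Icc] at *; omega
        · intros; positivity
    _ = (harmonic M : ℝ) := by
        rw [harmonic_eq_sum_Icc]; push_cast; simp
    _ ≤ _ := harmonic_le_one_add_log M

lemma beta_le (M d : ℕ) (hd : 1 ≤ d) :
    ∑ m ∈ (Finset.Icc 1 M).filter (fun m => d ∣ m), (1:ℝ)/m ≤ (1 + Real.log M) / d := by
  have : ∑ m ∈ (Finset.Icc 1 M).filter (fun m => d ∣ m), (1:ℝ)/m ≤ ∑ m ∈ (Finset.Icc 1 M).image (fun k => d * k), (1:ℝ)/m := by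
    apply Finset.sum_le_sum_of_subset_of_nonneg
    · intro m hm
      simp only [Finset.mem_filter, Finset.mem_Icc, Finset.mem_image] at *
      obtain ⟨⟨h1, h2⟩, k, rfl⟩ := hm
      refine ⟨k, ⟨?_, ?_⟩, rfl⟩
      · by_contra h; have : k = 0 := by omega
        subst this; omega
      · nlinarith
    · intros; positivity
  refine this.trans ?_
  rw [Finset.sum_image (by intro a _ b _ hab; exact Nat.eq_of_mul_eq_mul_left hd hab)]
  have h2 := harm_le M M le_rfl
  have hd' : (0:ℝ) < d := by exact_mod_cast hd
  rw [le_div_iff₀ hd', Finset.sum_mul]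
  refine le_trans (le_of_eq ?_) h2
  apply Finset.sum_congr rfl
  intro k _
  push_cast
  rw [one_div, mul_inv]; field_simp

/-- The discrepancy sum. -/
noncomputable def GG (w : ℕ → ℝ) (ρ : ℕ → ℤ) (M H : ℕ) (n : ℤ) : ℝ :=
  ∑ m ∈ Finset.Icc 1 M, w m * ∑ t ∈ Finset.Icc 1 H, ((if (m:ℤ) ∣ n + t - ρ m then (1:ℝ) else 0) - 1/m)

noncomputable def beta (w : ℕ → ℝ) (ρ : ℕ → ℤ) (M : ℕ) (r : ℚ) : ℂ :=
  ∑ m ∈ (Finset.Icc 1 M).filter (fun m => r.den ∣ m), ((w m / m : ℝ) : ℂ) * ee (-(r * ρ m))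

lemma norm_beta_le (w : ℕ → ℝ) (ρ : ℕ → ℤ) (M : ℕ) (r : ℚ) (hw : ∀ m, |w m| ≤ 1) :
    ‖beta w ρ M r‖ ≤ (1 + Real.log M) / r.den := by
  refine le_trans ?_ (beta_le M r.den r.den_pos)
  unfold beta
  refine (norm_sum_le _ _).trans (Finset.sum_le_sum fun m _ => ?_)
  rw [norm_mul, norm_ee, mul_one, Complex.norm_real, Real.norm_eq_abs, abs_div, Nat.abs_cast]
  gcongr; exact hw m

lemma GG_eq (w : ℕ → ℝ) (ρ : ℕ → ℤ) (M H : ℕ) (n : ℤ) :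
    (GG w ρ M H n : ℂ) = ∑ r ∈ RR M, (ee r * DK H r * beta w ρ M r) * ee (r * n) := by
  unfold GG beta
  simp only [Complex.ofReal_sum, Complex.ofReal_mul, Complex.ofReal_sub, apply_ite Complex.ofReal, Complex.ofReal_one, Complex.ofReal_zero, Complex.ofReal_div, Complex.ofReal_natCast]
  have e : ∀ m ∈ Finset.Icc 1 M, (w m : ℂ) * ∑ t ∈ Finset.Icc 1 H, ((if (m:ℤ) ∣ n + t - ρ m then (1:ℂ) else 0) - 1/m)
      = ∑ r ∈ RR M, if r.den ∣ m then (ee r * DK H r) * (((w m / m : ℝ) : ℂ) * ee (-(r * ρ m))) * ee (r * n) else 0 := by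
    intro m hm
    rw [← Finset.sum_filter]
    have hm0 : (m:ℂ) ≠ 0 := by
      rw [Finset.mem_Icc] at hm; exact_mod_cast (by omega : m ≠ 0)
    have e1 : ∀ t ∈ Finset.Icc 1 H, ((if (m:ℤ) ∣ n + t - ρ m then (1:ℂ) else 0) - 1/m) = (1/m) * ∑ r ∈ (RR M).filter (fun r => r.den ∣ m), ee ((r:ℝ) * (n + t - ρ m : ℤ)) := by
      intro t _
      rw [orth M m hm]
      split_ifs
      · field_simp
      · simp
    rw [Finset.sum_congr rfl e1, ← Finset.mul_sum, Finset.sum_comm, Finset.mul_sum, Finset.mul_sum]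
    apply Finset.sum_congr rfl
    intro r _
    have e2 : ∑ t ∈ Finset.Icc 1 H, ee ((r:ℝ) * (n + t - ρ m : ℤ)) = ee r * DK H r * ee (-(r * ρ m)) * ee (r * n) := by
      unfold DK
      rw [Finset.mul_sum, Finset.sum_mul, Finset.sum_mul]
      have : Finset.Icc 1 H = Finset.Ico (0+1) (H+1) := by ext; simp
      rw [this, ← Finset.sum_Ico_add' , ← Finset.range_eq_Ico]
      apply Finset.sum_congr rfl
      intro a _
      rw [← ee_add, ← ee_add, ← ee_add]; congr 1; push_cast; ring
    rw [e2]; push_cast; ring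
  rw [Finset.sum_congr rfl e, Finset.sum_comm]
  apply Finset.sum_congr rfl
  intro r _
  rw [← Finset.sum_filter, Finset.mul_sum, Finset.sum_mul]
  simp only [Complex.ofReal_div, Complex.ofReal_natCast]

lemma alpha_sum (w : ℕ → ℝ) (ρ : ℕ → ℤ) (M H : ℕ) (hw : ∀ m, |w m| ≤ 1) (n0 : ℤ) :
    ∑ r ∈ RR M, ‖ee r * DK H r * beta w ρ M r * ee (r * n0)‖^2 ≤ H * (1 + Real.log M)^3 := by
  have hlog : 0 ≤ Real.log M := Real.log_natCast_nonneg M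
  have h1 : ∀ r ∈ RR M, ‖ee r * DK H r * beta w ρ M r * ee (r * n0)‖^2 ≤ (1 + Real.log M)^2 * (‖DK H r‖^2 / (r.den:ℝ)^2) := by
    intro r _
    rw [norm_mul, norm_mul, norm_mul, norm_ee, norm_ee, one_mul, mul_one, mul_pow]
    have := norm_beta_le w ρ M r hw
    calc ‖DK H r‖^2 * ‖beta w ρ M r‖^2 ≤ ‖DK H r‖^2 * ((1 + Real.log M) / r.den)^2 := by gcongr
      _ = _ := by rw [div_pow]; ring
  refine (Finset.sum_le_sum h1).trans ?_
  rw [← Finset.mul_sum]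
  have h2 : ∑ r ∈ RR M, ‖DK H r‖^2 / (r.den:ℝ)^2 ≤ ∑ c ∈ Finset.Icc 1 M, (1/(c:ℝ)^2) * (c * H) := by
    rw [← Finset.sum_fiberwise_of_maps_to (s := RR M) (t := Finset.Icc 1 M) (g := fun r => r.den) (by
      intro r hr; rw [Finset.mem_Icc]; exact ⟨r.den_pos, (mem_RR.mp hr).2.2⟩)]
    apply Finset.sum_le_sum
    intro c hc
    calc ∑ r ∈ (RR M).filter (fun r => r.den = c), ‖DK H r‖^2 / (r.den:ℝ)^2 
        = ∑ r ∈ (RR M).filter (fun r => r.den = c), (1/(c:ℝ)^2) * ‖DK H r‖^2 := by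
          apply Finset.sum_congr rfl
          intro r hr
          rw [(Finset.mem_filter.mp hr).2]; ring
      _ ≤ ∑ r ∈ (RR M).filter (fun r => r.den ∣ c), (1/(c:ℝ)^2) * ‖DK H r‖^2 := by
          apply Finset.sum_le_sum_of_subset_of_nonneg
          · intro r hr
            rw [Finset.mem_filter] at *
            exact ⟨hr.1, hr.2 ▸ dvd_rfl⟩
          · intros; positivity
      _ = (1/(c:ℝ)^2) * ∑ j ∈ Finset.Ico 1 c, ‖DK H ((j:ℝ)/c)‖^2 := by
          rw [← Finset.mul_sum, sum_RR_filter M c hc (fun x => ‖DK H x‖^2)]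
      _ ≤ _ := by
          gcongr
          exact DK_sum_le c (Finset.mem_Icc.mp hc).1 H
  have h3 : ∑ c ∈ Finset.Icc 1 M, (1/(c:ℝ)^2) * (c * H) ≤ H * (1 + Real.log M) := by
    have : ∀ c ∈ Finset.Icc 1 M, (1/(c:ℝ)^2) * (c * H) = H * (1/(c:ℝ)) := by
      intro c hc
      have : (c:ℝ) ≠ 0 := by have := (Finset.mem_Icc.mp hc).1; positivity
      field_simp
    rw [Finset.sum_congr rfl this, ← Finset.mul_sum]
    gcongr; exact harm_le M M le_rfl
  calc _ ≤ (1 + Real.log M)^2 * (H * (1 + Real.log M)) := by gcongr; exact h2.trans h3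
    _ = _ := by ring

lemma ES (w : ℕ → ℝ) (ρ : ℕ → ℤ) (M H N : ℕ) (hw : ∀ m, |w m| ≤ 1) (n0 : ℤ) :
    N * ∑ n ∈ Finset.range N, (GG w ρ M H (n0 + n))^2 ≤
      (4 * (N:ℝ)^2 + 12 * (M:ℝ)^4) * (H * (1 + Real.log M)^3) := by
  have h := LS (RR M) M (fun r hr => mem_RR.mp hr) (fun r => ee r * DK H r * beta w ρ M r * ee (r * n0)) N
  have e : ∀ n ∈ Finset.range N, (GG w ρ M H (n0 + n))^2 = ‖∑ r ∈ RR M, ee r * DK H r * beta w ρ M r * ee (r * n0) * ee (r * n)‖^2 := by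
    intro n _
    have := GG_eq w ρ M H (n0 + n)
    rw [← sq_abs, ← Real.norm_eq_abs, ← Complex.norm_real, this]
    congr 2
    apply Finset.sum_congr rfl
    intro r _
    rw [mul_assoc _ (ee _) (ee _), ← ee_add]; congr 2; push_cast; ring
  rw [Finset.sum_congr rfl e]
  refine h.trans ?_
  gcongr
  exact alpha_sum w ρ M H hw n0
end C1proof

namespace C1proof

noncomputable def PP (χ : ℕ → ℝ) (n : ℕ) : ℝ := ∑ l ∈ Finset.Icc 1 n, χ l
noncomputable def aa (χ : ℕ → ℝ) (n : ℕ) : ℝ := ∑ d ∈ n.divisors, χ d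
noncomputable def AA (χ : ℕ → ℝ) (n : ℕ) : ℝ := ∑ k ∈ Finset.Icc 1 n, aa χ k

structure CHI (χ : ℕ → ℝ) (q : ℕ) (ρ c : ℝ) : Prop where
  q_pos : 1 ≤ q
  bd : ∀ n, |χ n| ≤ 1
  per : ∀ n, χ (n + q) = χ n
  zero : ∑ a ∈ Finset.range q, χ a = 0
  nonneg : ∀ n, 0 ≤ aa χ n
  c_nonneg : 0 ≤ c
  land : ∀ x : ℝ, 0 < x → |AA χ ⌊x⌋₊ - ρ * x| ≤ c * x ^ ((1:ℝ)/3)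

variable {χ : ℕ → ℝ} {q : ℕ} {ρ c : ℝ}

lemma CHI.per_mul (h : CHI χ q ρ c) (n k : ℕ) : χ (n + q * k) = χ n := by
  induction k with
  | zero => simp
  | succ k ih => rw [mul_add, mul_one, ← add_assoc, h.per, ih]

lemma CHI.per_mod (h : CHI χ q ρ c) (n : ℕ) : χ (n % q) = χ n := by
  conv_rhs => rw [← Nat.mod_add_div n q]
  rw [h.per_mul]

lemma CHI.PP_bd (h : CHI χ q ρ c) (n : ℕ) : |PP χ n| ≤ q := by
  have hq := h.q_pos
  have h1 : ∀ u v, ∑ l ∈ Finset.range (q * u + v), χ l = ∑ l ∈ Finset.range v, χ l := by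
    intro u v
    rw [Finset.sum_range_add]
    have : ∀ x ∈ Finset.range v, χ (q * u + x) = χ x := by
      intro x _; rw [add_comm, h.per_mul]
    rw [Finset.sum_congr rfl this]
    have : ∑ l ∈ Finset.range (q*u), χ l = 0 := by
      induction u with
      | zero => simp
      | succ u ih =>
        rw [mul_add, mul_one, Finset.sum_range_add, ih]
        · have : ∀ x ∈ Finset.range q, χ (q * u + x) = χ x := by
            intro x _; rw [add_comm, h.per_mul]
          rw [Finset.sum_congr rfl this, h.zero, zero_add]
        · intro x _; rw [add_comm, h.per_mul]
    rw [this, zero_add]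
  have h2 : PP χ n = ∑ l ∈ Finset.range ((n+1) % q), χ l - χ 0 := by
    rw [← h1 ((n+1)/q), Nat.div_add_mod]
    unfold PP
    rw [Finset.sum_range_succ', add_sub_cancel_right]
    rw [show Finset.Icc 1 n = Finset.Ico (0+1) (n+1) by ext; simp, ← Finset.sum_Ico_add', ← Finset.range_eq_Ico]
  rw [h2]
  have h3 : |∑ l ∈ Finset.range ((n+1) % q), χ l| ≤ ((n+1) % q : ℕ) := by
    refine (Finset.abs_sum_le_sum_abs _ _).trans ?_
    refine (Finset.sum_le_sum fun l _ => h.bd l).trans ?_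
    simp
  have h4 : (((n+1) % q : ℕ) : ℝ) + 1 ≤ q := by exact_mod_cast Nat.mod_lt (n+1) hq
  calc _ ≤ |∑ l ∈ Finset.range ((n+1) % q), χ l| + |χ 0| := abs_sub _ _
    _ ≤ _ := by linarith [h.bd 0]

lemma AA_eq (χ : ℕ → ℝ) (n : ℕ) : AA χ n = ∑ l ∈ Finset.Icc 1 n, χ l * ((n / l : ℕ) : ℝ) := by
  unfold AA aa
  rw [Finset.sum_comm' (t' := Finset.Icc 1 n) (s' := fun l => (Finset.Ioc 0 n).filter (fun k => l ∣ k))]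
  · apply Finset.sum_congr rfl
    intro l _
    rw [Finset.sum_const, Nat.Ioc_filter_dvd_card_eq_div, nsmul_eq_mul, mul_comm]
  · intro k l
    simp only [Finset.mem_Icc, Nat.mem_divisors, Finset.mem_filter, Finset.mem_Ioc]
    constructor
    · rintro ⟨⟨h1, h2⟩, h3, h4⟩
      have := Nat.le_of_dvd (by omega) h3
      have := Nat.pos_of_dvd_of_pos h3 (by omega)
      exact ⟨⟨⟨by omega, h2⟩, h3⟩, by omega, by omega⟩
    · rintro ⟨⟨⟨h1, h2⟩, h3⟩, h4, h5⟩
      exact ⟨⟨by omega, h2⟩, h3, by omega⟩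

lemma AA_eq' (χ : ℕ → ℝ) (n L : ℕ) (h : n ≤ L) : AA χ n = ∑ l ∈ Finset.Icc 1 L, χ l * ((n / l : ℕ) : ℝ) := by
  rw [AA_eq]
  apply Finset.sum_subset
  · intro k hk; simp only [Finset.mem_Icc] at *; omega
  · intro k hk hk'
    simp only [Finset.mem_Icc] at *
    rw [Nat.div_eq_of_lt (by omega)]; simp

lemma PP_sub (χ : ℕ → ℝ) {a b : ℕ} (h : a ≤ b) : ∑ l ∈ Finset.Ioc a b, χ l = PP χ b - PP χ a := by
  unfold PP
  have e : ∀ n, Finset.Icc 1 n = Finset.Ioc 0 n := by intro n; ext; simp; omega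
  rw [e, e, ← Finset.sum_Ioc_consecutive _ (Nat.zero_le a) h]; ring

lemma HY (χ : ℕ → ℝ) (n L : ℕ) (hL : 1 ≤ L) :
    AA χ n = ∑ l ∈ Finset.Icc 1 L, χ l * ((n / l : ℕ) : ℝ) + ∑ m ∈ Finset.Icc 1 (n / L), (PP χ (n / m) - PP χ L) := by
  have h1 : ∑ m ∈ Finset.Icc 1 (n / L), (PP χ (n / m) - PP χ L) = ∑ l ∈ Finset.Ioc L n, χ l * ((n / l : ℕ) : ℝ) := by
    have : ∀ m ∈ Finset.Icc 1 (n / L), (PP χ (n / m) - PP χ L) = ∑ l ∈ Finset.Ioc L (n / m), χ l := by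
      intro m hm
      rw [Finset.mem_Icc] at hm
      rw [PP_sub]
      rw [Nat.le_div_iff_mul_le (by omega), mul_comm, ← Nat.le_div_iff_mul_le (by omega)]; exact hm.2
    rw [Finset.sum_congr rfl this]
    rw [Finset.sum_comm' (t' := Finset.Ioc L n) (s' := fun l => Finset.Icc 1 (n / l))]
    · apply Finset.sum_congr rfl
      intro l _
      simp [mul_comm]
    · intro m l
      simp only [Finset.mem_Icc, Finset.mem_Ioc]
      constructor
      · rintro ⟨⟨h1, h2⟩, h3, h4⟩
        rw [Nat.le_div_iff_mul_le (by omega)] at *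
        refine ⟨⟨h1, by linarith [mul_comm l m]⟩, h3, ?_⟩
        nlinarith
      · rintro ⟨⟨h1, h2⟩, h3, h4⟩
        rw [Nat.le_div_iff_mul_le (by omega)] at h2
        refine ⟨⟨h1, ?_⟩, h3, ?_⟩
        · rw [Nat.le_div_iff_mul_le (by omega)]; nlinarith
        · rw [Nat.le_div_iff_mul_le (by omega)]; linarith [mul_comm l m]
  rw [h1]
  rcases le_total L n with h | h
  · rw [AA_eq]
    have e : ∀ n, Finset.Icc 1 n = Finset.Ioc 0 n := by intro n; ext; simp; omega
    rw [e, e, Finset.sum_Ioc_consecutive _ (Nat.zero_le L) h]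
  · rw [AA_eq' χ n L h, Finset.Ioc_eq_empty (by omega)]; simp

lemma CHI.Lval (h : CHI χ q ρ c) (L : ℕ) (hL : 1 ≤ L) :
    |∑ l ∈ Finset.Icc 1 L, χ l / l - ρ| ≤ (1 + 2 * q + c) / L := by
  have hL' : (1:ℝ) ≤ L := by exact_mod_cast hL
  have hy := HY χ (L * L) L hL
  rw [Nat.mul_div_cancel_left _ hL] at hy
  have a1 : |∑ m ∈ Finset.Icc 1 L, (PP χ (L * L / m) - PP χ L)| ≤ 2 * q * L := by
    refine (Finset.abs_sum_le_sum_abs _ _).trans ?_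
    calc _ ≤ ∑ m ∈ Finset.Icc 1 L, (2 * q : ℝ) := by
          apply Finset.sum_le_sum; intro m _
          refine (abs_sub _ _).trans ?_
          linarith [h.PP_bd (L*L/m), h.PP_bd L]
      _ = _ := by simp; ring
  have a2 : |∑ l ∈ Finset.Icc 1 L, χ l * ((L * L / l : ℕ) : ℝ) - (L:ℝ)^2 * ∑ l ∈ Finset.Icc 1 L, χ l / l| ≤ L := by
    rw [Finset.mul_sum, ← Finset.sum_sub_distrib]
    refine (Finset.abs_sum_le_sum_abs _ _).trans ?_
    calc _ ≤ ∑ m ∈ Finset.Icc 1 L, (1 : ℝ) := by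
          apply Finset.sum_le_sum; intro m hm
          rw [Finset.mem_Icc] at hm
          have hm' : (0:ℝ) < m := by exact_mod_cast hm.1
          have e : χ m * ((L * L / m : ℕ) : ℝ) - (L:ℝ)^2 * (χ m / m) = χ m * (((L * L / m : ℕ) : ℝ) - (L*L:ℕ) / m) := by push_cast; ring
          rw [e, abs_mul]
          have b1 := Nat.cast_div_le (α := ℝ) (m := L*L) (n := m)
          have b2 : ((L*L:ℕ):ℝ) / m ≤ ((L * L / m : ℕ) : ℝ) + 1 := by
            rw [div_le_iff₀ hm']
            have := Nat.lt_div_mul_add (a := L*L) hm.1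
            have h3 : L * L ≤ (L*L/m + 1) * m := by nlinarith
            exact_mod_cast h3
          have b3 : |(((L * L / m : ℕ) : ℝ) - (L*L:ℕ) / m)| ≤ 1 := by rw [abs_le]; constructor <;> linarith
          nlinarith [h.bd m, abs_nonneg (χ m), abs_nonneg (((L * L / m : ℕ) : ℝ) - (L*L:ℕ) / m)]
      _ = _ := by simp
  have a3 := h.land ((L:ℝ)^2) (by positivity)
  have fl : ⌊(L:ℝ)^2⌋₊ = L * L := by rw [← Nat.cast_pow, Nat.floor_natCast, sq]
  rw [fl] at a3
  have a4 : ((L:ℝ)^2) ^ ((1:ℝ)/3) ≤ L := by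
    rw [← Real.rpow_natCast_mul (by positivity)]
    calc (L:ℝ) ^ (((2:ℕ):ℝ) * (1/3)) ≤ (L:ℝ)^(1:ℝ) := Real.rpow_le_rpow_of_exponent_le hL' (by norm_num)
      _ = L := Real.rpow_one _
  have a5 : c * ((L:ℝ)^2) ^ ((1:ℝ)/3) ≤ c * L := mul_le_mul_of_nonneg_left a4 h.c_nonneg
  rw [le_div_iff₀ (by positivity)]
  have key : |(∑ l ∈ Finset.Icc 1 L, χ l / l - ρ) * (L:ℝ)^2| ≤ (1 + 2 * q + c) * L := by
    rw [abs_le] at a1 a2 a3 ⊢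
    constructor <;> nlinarith
  rw [abs_mul, abs_of_nonneg (a := (L:ℝ)^2) (by positivity)] at key
  nlinarith

lemma card_div (n H l : ℕ) : (((n + H) / l : ℕ):ℝ) - ((n / l : ℕ):ℝ) = ∑ t ∈ Finset.Icc 1 H, if (l:ℤ) ∣ n + t then (1:ℝ) else 0 := by
  induction H with
  | zero => simp
  | succ H ih =>
    rw [Finset.sum_Icc_succ_top (by omega), ← ih, ← add_assoc, Nat.succ_div]
    have : (l ∣ n + H + 1) ↔ ((l:ℤ) ∣ n + (H + 1 : ℕ)) := by
      rw [← Int.natCast_dvd_natCast]; push_cast; rw [add_assoc]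
    simp only [this]
    split_ifs <;> push_cast <;> ring

lemma PP_div (χ : ℕ → ℝ) (n H m : ℕ) : PP χ ((n + H) / m) - PP χ (n / m) = ∑ t ∈ Finset.Icc 1 H, if m ∣ n + t then χ ((n + t) / m) else 0 := by
  induction H with
  | zero => simp
  | succ H ih =>
    rw [Finset.sum_Icc_succ_top (by omega), ← ih, ← add_assoc]
    rw [Nat.succ_div]
    split_ifs
    · unfold PP; rw [Finset.sum_Icc_succ_top (Nat.le_add_left 1 _)]; ring
    · simp

noncomputable def E3 (χ : ℕ → ℝ) (H M n : ℕ) : ℝ := ∑ m ∈ Finset.Icc 1 M, (PP χ ((n + H)/m) - PP χ (n/m))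

lemma CHI.chi_indicator (h : CHI χ q ρ c) (k m : ℕ) (hm : 1 ≤ m) :
    (if m ∣ k then χ (k / m) else 0) = ∑ a ∈ Finset.range q, χ a * (if ((q * m : ℕ):ℤ) ∣ (k:ℤ) - a * m then (1:ℝ) else 0) := by
  have hq := h.q_pos
  have hm' : (m:ℤ) ≠ 0 := by positivity
  by_cases hk : m ∣ k
  · obtain ⟨z, rfl⟩ := hk
    rw [if_pos (dvd_mul_right _ _), Nat.mul_div_cancel_left _ hm]
    have e : ∀ a : ℕ, (((q * m : ℕ):ℤ) ∣ ((m * z : ℕ):ℤ) - a * m) ↔ ((q:ℤ) ∣ z - a) := by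
      intro a
      have : ((m * z : ℕ):ℤ) - a * m = (z - a) * m := by push_cast; ring
      rw [this]; push_cast
      exact mul_dvd_mul_iff_right hm'
    simp only [e]
    rw [Finset.sum_eq_single (z % q)]
    · rw [if_pos, mul_one, h.per_mod]
      push_cast
      exact Int.dvd_self_sub_emod
    · intro a ha hne
      rw [if_neg, mul_zero]
      intro hd
      apply hne
      have hlt := Finset.mem_range.mp ha
      have : z % q = a % q := by
        have h2 : (z:ℤ) % q = (a:ℤ) % q := Int.emod_eq_emod_iff_emod_sub_eq_zero.mpr (Int.emod_eq_zero_of_dvd hd)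
        exact_mod_cast h2
      rw [this, Nat.mod_eq_of_lt hlt]
    · intro hh; exact absurd (Finset.mem_range.mpr (Nat.mod_lt _ hq)) hh
  · rw [if_neg hk, Finset.sum_eq_zero]
    intro a _
    rw [if_neg, mul_zero]
    intro hd
    apply hk
    have h1 : (m:ℤ) ∣ (k:ℤ) - a * m := dvd_trans (by push_cast; exact dvd_mul_left _ _) hd
    have h2 : (m:ℤ) ∣ (k:ℤ) := by
      have := dvd_add h1 (dvd_mul_left (m:ℤ) a)
      simpa using this
    exact_mod_cast h2

lemma sum_Icc_mul (q M : ℕ) (hq : 1 ≤ q) (f : ℕ → ℝ) :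
    ∑ m ∈ Finset.Icc 1 (q * M), (if q ∣ m then 1 else 0) * f m = ∑ m ∈ Finset.Icc 1 M, f (q * m) := by
  simp_rw [ite_mul, one_mul, zero_mul]
  rw [← Finset.sum_filter]
  symm
  apply Finset.sum_bij (fun m _ => q * m)
  · intro m hm
    simp only [Finset.mem_filter, Finset.mem_Icc] at *
    exact ⟨⟨by nlinarith, by nlinarith⟩, dvd_mul_right _ _⟩
  · intro a _ b _ hab; exact Nat.eq_of_mul_eq_mul_left hq hab
  · intro m hm
    simp only [Finset.mem_filter, Finset.mem_Icc] at *
    obtain ⟨⟨h1, h2⟩, k, rfl⟩ := hm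
    refine ⟨k, ⟨?_, Nat.le_of_mul_le_mul_left h2 hq⟩, rfl⟩
    by_contra hh; have : k = 0 := by omega
    subst this; omega
  · intros; rfl

lemma CHI.E3_eq (h : CHI χ q ρ c) (H M n : ℕ) :
    E3 χ H M n = ∑ a ∈ Finset.range q, χ a * GG (fun m => if q ∣ m then 1 else 0) (fun m => a * (m / q : ℕ)) (q * M) H n := by
  have hq := h.q_pos
  unfold E3 GG
  simp_rw [sum_Icc_mul q M hq]
  have e : ∀ m ∈ Finset.Icc 1 M, PP χ ((n + H)/m) - PP χ (n/m) = ∑ a ∈ Finset.range q, χ a * ∑ t ∈ Finset.Icc 1 H, ((if ((q * m : ℕ):ℤ) ∣ (n:ℤ) + t - a * ((q * m / q : ℕ):ℤ) then (1:ℝ) else 0) - 1/((q*m:ℕ):ℝ)) := by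
    intro m hm
    rw [Finset.mem_Icc] at hm
    rw [PP_div]
    simp_rw [Finset.sum_sub_distrib, mul_sub, Finset.sum_sub_distrib]
    rw [← Finset.sum_mul, h.zero, zero_mul, sub_zero]
    simp_rw [h.chi_indicator _ m hm.1, Finset.mul_sum]
    rw [Finset.sum_comm]
    simp_rw [Nat.mul_div_cancel_left m hq]
    push_cast; rfl
  rw [Finset.sum_congr rfl e, Finset.sum_comm]
  simp_rw [Finset.mul_sum]
end C1proof

namespace C1proof
variable {χ : ℕ → ℝ} {q : ℕ} {ρ c : ℝ}

lemma decomp (χ : ℕ → ℝ) (ρ : ℝ) (n H L : ℕ) (hL : 1 ≤ L) :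
    AA χ (n + H) - AA χ n - ρ * H = GG χ (fun _ => 0) L H n + H * (∑ l ∈ Finset.Icc 1 L, χ l / l - ρ)
      + E3 χ H (n / L) n + ∑ m ∈ Finset.Ioc (n/L) ((n+H)/L), (PP χ ((n+H)/m) - PP χ L) := by
  rw [HY χ (n+H) L hL, HY χ n L hL]
  have e1 : ∑ l ∈ Finset.Icc 1 L, χ l * (((n + H) / l : ℕ) : ℝ) - ∑ l ∈ Finset.Icc 1 L, χ l * ((n / l : ℕ) : ℝ) = GG χ (fun _ => 0) L H n + H * ∑ l ∈ Finset.Icc 1 L, χ l / l := by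
    unfold GG
    rw [← Finset.sum_sub_distrib, Finset.mul_sum, ← Finset.sum_add_distrib]
    apply Finset.sum_congr rfl
    intro l _
    rw [← mul_sub, card_div, Finset.sum_sub_distrib]
    simp; ring
  have e : ∀ n, Finset.Icc 1 n = Finset.Ioc 0 n := by intro n; ext; simp; omega
  have e2 : ∑ m ∈ Finset.Icc 1 ((n+H)/L), (PP χ ((n+H)/m) - PP χ L) = ∑ m ∈ Finset.Icc 1 (n/L), (PP χ ((n+H)/m) - PP χ L) + ∑ m ∈ Finset.Ioc (n/L) ((n+H)/L), (PP χ ((n+H)/m) - PP χ L) := by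
    rw [e, e, Finset.sum_Ioc_consecutive _ (Nat.zero_le _) (Nat.div_le_div_right (by omega))]
  have e3 : ∑ m ∈ Finset.Icc 1 (n/L), (PP χ ((n+H)/m) - PP χ L) - ∑ m ∈ Finset.Icc 1 (n/L), (PP χ (n/m) - PP χ L) = E3 χ H (n/L) n := by
    unfold E3
    rw [← Finset.sum_sub_distrib]
    apply Finset.sum_congr rfl; intros; ring
  linear_combination e1 + e2 + e3

lemma E4_le (h : CHI χ q ρ c) (n H L : ℕ) (hL : 1 ≤ L) :
    |∑ m ∈ Finset.Ioc (n/L) ((n+H)/L), (PP χ ((n+H)/m) - PP χ L)| ≤ 2 * q * ((H:ℝ) / L + 1) := by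
  refine (Finset.abs_sum_le_sum_abs _ _).trans ?_
  have hL' : (0:ℝ) < L := by exact_mod_cast hL
  calc _ ≤ ∑ m ∈ Finset.Ioc (n/L) ((n+H)/L), (2 * q : ℝ) := by
        apply Finset.sum_le_sum; intro m _
        refine (abs_sub _ _).trans ?_
        linarith [h.PP_bd ((n+H)/m), h.PP_bd L]
    _ = 2 * q * (((n+H)/L - n/L : ℕ) : ℝ) := by simp; ring
    _ ≤ _ := by
        gcongr
        rw [Nat.cast_sub (Nat.div_le_div_right (by omega))]
        have b1 := Nat.cast_div_le (α := ℝ) (m := n+H) (n := L)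
        have b2 : (n:ℝ) / L ≤ ((n / L : ℕ) : ℝ) + 1 := by
          rw [div_le_iff₀ hL']
          have := Nat.lt_div_mul_add (a := n) hL
          have h3 : n ≤ (n/L + 1) * L := by nlinarith
          exact_mod_cast h3
        push_cast at b1
        rw [add_div] at b1
        linarith

lemma four_sq (a b d e B D : ℝ) (hb : |b| ≤ B) (he : |e| ≤ D) : (a + b + d + e)^2 ≤ 4 * a^2 + 4 * d^2 + 4 * (B^2 + D^2) := by
  have h1 : b^2 ≤ B^2 := sq_le_sq' (by linarith [neg_abs_le b]) (by linarith [le_abs_self b])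
  have h2 : e^2 ≤ D^2 := sq_le_sq' (by linarith [neg_abs_le e]) (by linarith [le_abs_self e])
  nlinarith [sq_nonneg (a-b), sq_nonneg (a-d), sq_nonneg (a-e), sq_nonneg (b-d), sq_nonneg (b-e), sq_nonneg (d-e)]

lemma V_sq (h : CHI χ q ρ c) (n H L N : ℕ) (hL : 1 ≤ L) (hN : 1 ≤ N) (hNL : N ≤ 4 * L^2) :
    (AA χ (n + H) - AA χ n - ρ * H)^2 ≤ 4 * (GG χ (fun _ => 0) L H n)^2 + 4 * (E3 χ H (n / L) n)^2 
      + 4 * (4 * ((1 + 2*q + c)^2 + 8 * q^2) * ((H:ℝ)^2 / N) + 8 * q^2) := by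
  rw [decomp χ ρ n H L hL]
  have hL' : (0:ℝ) < L := by exact_mod_cast hL
  have hN' : (0:ℝ) < N := by exact_mod_cast hN
  have b2 : |(H:ℝ) * (∑ l ∈ Finset.Icc 1 L, χ l / l - ρ)| ≤ H * ((1 + 2 * q + c) / L) := by
    rw [abs_mul, Nat.abs_cast]; gcongr; exact h.Lval L hL
  refine (four_sq _ _ _ _ _ _ b2 (E4_le h n H L hL)).trans ?_
  have hx : ((H:ℝ)/L)^2 ≤ 4 * ((H:ℝ)^2/N) := by
    rw [div_pow, div_le_iff₀ (by positivity), mul_assoc, div_mul_eq_mul_div, ← mul_div_assoc, le_div_iff₀ hN']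
    have : (N:ℝ) ≤ 4 * L^2 := by exact_mod_cast hNL
    nlinarith [sq_nonneg (H:ℝ)]
  have e1 : (H * ((1 + 2 * q + c) / L))^2 = (1 + 2*q + c)^2 * ((H:ℝ)/L)^2 := by ring
  have e2 : (2 * (q:ℝ) * ((H:ℝ) / L + 1))^2 ≤ 8 * q^2 * ((H:ℝ)/L)^2 + 8 * q^2 := by
    have : (2 * (q:ℝ) * ((H:ℝ) / L + 1))^2 = 4 * q^2 * ((H:ℝ) / L + 1)^2 := by ring
    rw [this]
    nlinarith [mul_nonneg (sq_nonneg (q:ℝ)) (sq_nonneg ((H:ℝ)/L - 1))]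
  rw [e1]
  have := mul_le_mul_of_nonneg_left hx (by positivity : 0 ≤ (1 + 2*(q:ℝ) + c)^2 + 8 * q^2)
  linarith

lemma fibre (f : ℕ → ℝ) (hf : ∀ m, 0 ≤ f m) (n L0 : ℕ) (hL0 : 1 ≤ L0) (hn1 : L0^2 ≤ n) (hn2 : n ≤ 8 * L0^2) :
    ∑ L ∈ Finset.Ico L0 (2*L0), f (n / L) ≤ 8 * ∑ M ∈ Finset.range (8*L0+1), f M := by
  rw [← Finset.sum_fiberwise_of_maps_to (s := Finset.Ico L0 (2*L0)) (t := Finset.range (8*L0+1)) (g := fun L => n / L) (by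
    intro L hL
    rw [Finset.mem_Ico] at hL
    rw [Finset.mem_range, Nat.lt_succ_iff]
    apply Nat.div_le_of_le_mul
    nlinarith), Finset.mul_sum]
  apply Finset.sum_le_sum
  intro M hM
  have : ∑ L ∈ (Finset.Ico L0 (2*L0)).filter (fun L => n / L = M), f (n / L) = ∑ L ∈ (Finset.Ico L0 (2*L0)).filter (fun L => n / L = M), f M :=
    Finset.sum_congr rfl fun L hL => by rw [(Finset.mem_filter.mp hL).2]
  rw [this, Finset.sum_const, nsmul_eq_mul]
  apply mul_le_mul_of_nonneg_right _ (hf M)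
  have hc : ((Finset.Ico L0 (2*L0)).filter (fun L => n / L = M)).card ≤ 8 := by
    rcases Finset.eq_empty_or_nonempty ((Finset.Ico L0 (2*L0)).filter (fun L => n / L = M)) with he | hne
    · rw [he]; simp
    set S := (Finset.Ico L0 (2*L0)).filter (fun L => n / L = M) with hS
    have hmin := Finset.min'_mem S hne
    set L := S.min' hne with hLdef
    have hsub : S ⊆ Finset.Ico L (L + 8) := by
      intro L' hL'
      rw [Finset.mem_Ico]
      refine ⟨Finset.min'_le S L' hL', ?_⟩
      rw [hS, Finset.mem_filter, Finset.mem_Ico] at hmin hL'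
      by_contra hcon
      have h1 : M * L' ≤ n := by rw [← hL'.2]; exact Nat.div_mul_le_self _ _
      have h2 : n < M * L + L := by rw [← hmin.2]; exact Nat.lt_div_mul_add (by omega)
      have h3 : M * (L + 8) ≤ M * L' := by gcongr; omega
      have h4 : 8 * M < L := by nlinarith
      have h5 : 1 ≤ M := by
        rw [← hmin.2]
        by_contra hz
        have hz : n / L = 0 := by omega
        rw [Nat.div_eq_zero_iff] at hz
        have : L0 ≤ 1 := by
          by_contra hh
          have : 2 * L0 ≤ L0^2 := by nlinarith
          omega
        have : L0 = 1 := by omega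
        subst this
        omega
      nlinarith
    calc S.card ≤ (Finset.Ico L (L+8)).card := Finset.card_le_card hsub
      _ = 8 := by simp
  exact_mod_cast hc

lemma E3_sq (h : CHI χ q ρ c) (H M N : ℕ) (n0 : ℕ) :
    N * ∑ n ∈ Finset.range N, (E3 χ H M (n0 + n))^2 ≤
      q^2 * ((4 * (N:ℝ)^2 + 12 * ((q * M : ℕ):ℝ)^4) * (H * (1 + Real.log (q * M : ℕ))^3)) := by
  set g : ℕ → ℕ → ℝ := fun a n => GG (fun m => if q ∣ m then 1 else 0) (fun m => a * (m / q : ℕ)) (q * M) H ((n0:ℤ) + n) with hg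
  have h1 : ∀ n, (E3 χ H M (n0 + n))^2 ≤ q * ∑ a ∈ Finset.range q, (g a n)^2 := by
    intro n
    rw [h.E3_eq]
    have := sq_sum_le_card_mul_sum_sq (s := Finset.range q) (f := fun a => χ a * GG (fun m => if q ∣ m then 1 else 0) (fun m => a * (m / q : ℕ)) (q * M) H ((n0 + n : ℕ):ℤ))
    refine this.trans ?_
    rw [Finset.card_range]
    apply mul_le_mul_of_nonneg_left _ (Nat.cast_nonneg q)
    apply Finset.sum_le_sum
    intro a _
    rw [mul_pow]
    push_cast
    have h1 := h.bd a
    have : (χ a)^2 ≤ 1 := by rw [← sq_abs]; nlinarith [abs_nonneg (χ a)]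
    simp only [hg]
    exact mul_le_of_le_one_left (sq_nonneg _) this
  calc N * ∑ n ∈ Finset.range N, (E3 χ H M (n0 + n))^2 ≤ N * ∑ n ∈ Finset.range N, (q * ∑ a ∈ Finset.range q, (g a n)^2) := by
        gcongr with n _; exact h1 n
    _ = q * ∑ a ∈ Finset.range q, (N * ∑ n ∈ Finset.range N, (g a n)^2) := by
        simp_rw [← Finset.mul_sum]
        rw [Finset.sum_comm]; ring
    _ ≤ q * ∑ a ∈ Finset.range q, ((4 * (N:ℝ)^2 + 12 * ((q * M : ℕ):ℝ)^4) * (H * (1 + Real.log (q * M : ℕ))^3)) := by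
        apply mul_le_mul_of_nonneg_left _ (Nat.cast_nonneg q)
        apply Finset.sum_le_sum
        intro a _
        exact ES (fun m => if q ∣ m then 1 else 0) _ _ _ _ (by intro m; split_ifs <;> simp) _
    _ = _ := by simp; ring

lemma log_bd (A x y : ℝ) (hA : 1 ≤ A) (hx : 0 ≤ x) (hy : 1 ≤ y) (hxy : x ≤ A * y) : 1 + Real.log x ≤ (1 + Real.log A) * (1 + Real.log y) := by
  have h1 : 0 ≤ Real.log A := Real.log_nonneg hA
  have h2 : 0 ≤ Real.log y := Real.log_nonneg hy
  rcases hx.eq_or_lt with h0 | h0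
  · rw [← h0, Real.log_zero]; nlinarith
  · have := Real.log_le_log h0 hxy
    rw [Real.log_mul (by linarith) (by linarith)] at this
    nlinarith

set_option maxHeartbeats 1600000 in
lemma VA (h : CHI χ q ρ c) : ∃ C : ℝ, 0 < C ∧ ∀ N H : ℕ, 1 ≤ N → 1 ≤ H → H ≤ 64 * N →
    ∑ n ∈ Finset.range N, (AA χ (N + n + H) - AA χ (N + n) - ρ * H)^2 ≤ C * (N * H * (1 + Real.log N)^3) := by
  set k1 : ℝ := 196 * (1 + Real.log 2)^3 with hk1
  set k3 : ℝ := q^2 * ((4 + 12 * (8*q)^4) * (1 + Real.log (8*q))^3) with hk3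
  set B : ℝ := 4 * (4 * ((1 + 2*q + c)^2 + 8 * q^2) * 64 + 8 * q^2) with hB
  have hq : (1:ℝ) ≤ q := by exact_mod_cast h.q_pos
  have hl2 : 0 ≤ Real.log 2 := Real.log_nonneg (by norm_num)
  have hl8 : 0 ≤ Real.log (8 * q) := Real.log_nonneg (by linarith)
  have k1p : 0 < k1 := by positivity
  have k3p : 0 ≤ k3 := by positivity
  have Bp : 0 ≤ B := by positivity
  refine ⟨4 * k1 + 4 * (8 * (9 * k3)) + B, by positivity, ?_⟩
  intro N H hN hH hHN
  set L0 := Nat.sqrt N with hL0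
  have hL1 : 1 ≤ L0 := Nat.sqrt_pos.mpr hN
  have hs1 : L0^2 ≤ N := by rw [sq]; exact Nat.sqrt_le N
  have hs2 : N ≤ 4 * L0^2 := by
    have := Nat.lt_succ_sqrt N
    rw [← hL0] at this
    simp only [Nat.succ_eq_add_one] at this
    nlinarith
  have hNr : (1:ℝ) ≤ N := by exact_mod_cast hN
  have hHr : (1:ℝ) ≤ H := by exact_mod_cast hH
  have hHNr : (H:ℝ) ≤ 64 * N := by exact_mod_cast hHN
  have hL1r : (1:ℝ) ≤ L0 := by exact_mod_cast hL1
  have hs1r : (L0:ℝ)^2 ≤ N := by exact_mod_cast hs1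
  have hL0N : (L0:ℝ) ≤ N := by nlinarith
  set lg := 1 + Real.log N with hlg
  have hlg1 : 1 ≤ lg := by rw [hlg]; linarith [Real.log_nonneg hNr]
  set T : ℝ := N * H * lg^3 with hT
  have hTp : 0 < T := by positivity
  -- E1
  have hE1 : ∀ L ∈ Finset.Ico L0 (2*L0), ∑ n ∈ Finset.range N, (GG χ (fun _ => 0) L H ((N + n : ℕ):ℤ))^2 ≤ k1 * T := by
    intro L hL
    rw [Finset.mem_Ico] at hL
    have hes := ES χ (fun _ => 0) L H N h.bd N
    have hLr : (L:ℝ) ≤ 2 * L0 := by exact_mod_cast hL.2.le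
    have l1 : 1 + Real.log L ≤ (1 + Real.log 2) * lg := log_bd 2 L N (by norm_num) (by positivity) hNr (by linarith)
    have l0 : 0 ≤ 1 + Real.log L := by linarith [Real.log_natCast_nonneg L]
    have b1 : (L:ℝ)^4 ≤ 16 * N^2 := by
      have : (L:ℝ)^2 ≤ 4 * N := by nlinarith
      nlinarith [sq_nonneg (L:ℝ)]
    have b2 : N * ∑ n ∈ Finset.range N, (GG χ (fun _ => 0) L H (N + n))^2 ≤ N * (k1 * T) := by
      refine hes.trans ?_
      calc (4 * (N:ℝ)^2 + 12 * (L:ℝ)^4) * (H * (1 + Real.log L)^3) ≤ (196 * (N:ℝ)^2) * (H * ((1 + Real.log 2) * lg)^3) := by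
            gcongr; linarith
        _ = _ := by rw [hk1, hT]; ring
    have := le_of_mul_le_mul_left b2 (by linarith)
    push_cast; exact this
  have hE3 : ∀ M ∈ Finset.range (8*L0+1), ∑ n ∈ Finset.range N, (E3 χ H M (N + n))^2 ≤ k3 * T := by
    intro M hM
    rw [Finset.mem_range] at hM
    have hes := E3_sq h H M N N
    have hMr : (M:ℝ) ≤ 8 * L0 := by exact_mod_cast (by omega : M ≤ 8 * L0)
    have hqM : ((q * M : ℕ) : ℝ) ≤ 8 * q * L0 := by push_cast; nlinarith
    have l1 : 1 + Real.log (q * M : ℕ) ≤ (1 + Real.log (8*q)) * lg := log_bd (8*q) _ N (by linarith) (by positivity) hNr (by nlinarith)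
    have l0 : 0 ≤ 1 + Real.log (q * M : ℕ) := by linarith [Real.log_natCast_nonneg (q * M)]
    have b1 : ((q * M : ℕ) : ℝ)^4 ≤ (8*q)^4 * N^2 := by
      calc ((q * M : ℕ) : ℝ)^4 ≤ (8 * q * L0)^4 := by gcongr
        _ = (8*q)^4 * ((L0:ℝ)^2)^2 := by ring
        _ ≤ _ := by gcongr
    have b2 : N * ∑ n ∈ Finset.range N, (E3 χ H M (N + n))^2 ≤ N * (k3 * T) := by
      refine hes.trans ?_
      calc _ ≤ (q:ℝ)^2 * ((4 * (N:ℝ)^2 + 12 * ((8*q)^4 * N^2)) * (H * ((1 + Real.log (8*q)) * lg)^3)) := by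
            gcongr
        _ = _ := by rw [hk3, hT]; ring
    exact le_of_mul_le_mul_left b2 (by linarith)
  have hB' : ∀ n, (AA χ (N + n + H) - AA χ (N + n) - ρ * H)^2 ≥ 0 := fun n => sq_nonneg _
  have main : ∀ n ∈ Finset.range N, L0 * (AA χ (N + n + H) - AA χ (N + n) - ρ * H)^2 ≤ 
      4 * ∑ L ∈ Finset.Ico L0 (2*L0), (GG χ (fun _ => 0) L H ((N + n : ℕ):ℤ))^2 
      + 4 * (8 * ∑ M ∈ Finset.range (8*L0+1), (E3 χ H M (N + n))^2) + L0 * (B * H) := by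
    intro n hn
    rw [Finset.mem_range] at hn
    have f1 := fibre (fun M => (E3 χ H M (N + n))^2) (fun _ => sq_nonneg _) (N + n) L0 hL1 (by omega) (by omega)
    have hb : 4 * (4 * ((1 + 2*q + c)^2 + 8 * q^2) * ((H:ℝ)^2 / N) + 8 * q^2) ≤ B * H := by
      have : (H:ℝ)^2 / N ≤ 64 * H := by
        rw [div_le_iff₀ (by linarith)]; nlinarith
      rw [hB]
      clear_value L0 lg T k1 k3
      have t1 := mul_le_mul_of_nonneg_left this (by positivity : 0 ≤ 4 * ((1 + 2*(q:ℝ) + c)^2 + 8 * q^2))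
      have t2 : 8 * (q:ℝ)^2 ≤ 8 * q^2 * H := by nlinarith [sq_nonneg (q:ℝ)]
      linarith
    have : ∑ L ∈ Finset.Ico L0 (2*L0), (AA χ (N + n + H) - AA χ (N + n) - ρ * H)^2 ≤ ∑ L ∈ Finset.Ico L0 (2*L0), (4 * (GG χ (fun _ => 0) L H ((N + n : ℕ):ℤ))^2 + 4 * (E3 χ H ((N+n) / L) (N+n))^2 + B * H) := by
      apply Finset.sum_le_sum
      intro L hL
      rw [Finset.mem_Ico] at hL
      have := V_sq h (N + n) H L N (by omega) hN (by nlinarith)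
      linarith
    rw [Finset.sum_const, Nat.card_Ico, Finset.sum_add_distrib, Finset.sum_add_distrib, Finset.sum_const, Nat.card_Ico, ← Finset.mul_sum, ← Finset.mul_sum, nsmul_eq_mul, nsmul_eq_mul, show 2 * L0 - L0 = L0 by omega] at this
    linarith
  have tot := Finset.sum_le_sum main
  rw [← Finset.mul_sum, Finset.sum_add_distrib, Finset.sum_add_distrib, ← Finset.mul_sum, ← Finset.mul_sum, ← Finset.mul_sum, Finset.sum_comm, Finset.sum_comm (s := Finset.range N) (t := Finset.range (8*L0+1))] at tot
  have s1 := Finset.sum_le_sum hE1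
  have s3 := Finset.sum_le_sum hE3
  rw [Finset.sum_const, Nat.card_Ico, nsmul_eq_mul, show 2 * L0 - L0 = L0 by omega] at s1
  rw [Finset.sum_const, Finset.card_range, nsmul_eq_mul] at s3
  simp only [Finset.sum_const, Finset.card_range, nsmul_eq_mul] at tot
  have s3' : ((8 * L0 + 1 : ℕ):ℝ) * (k3 * T) ≤ 9 * L0 * (k3 * T) := by
    apply mul_le_mul_of_nonneg_right _ (by positivity)
    push_cast; linarith
  have hbT : (N:ℝ) * (L0 * (B * H)) ≤ L0 * (B * T) := by
    have : N * H ≤ T := by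
      rw [hT]; exact le_mul_of_one_le_right (by positivity) (one_le_pow₀ hlg1)
    have := mul_le_mul_of_nonneg_left this (by positivity : 0 ≤ (L0:ℝ) * B)
    linarith
  have fin : L0 * ∑ n ∈ Finset.range N, (AA χ (N + n + H) - AA χ (N + n) - ρ * H)^2 ≤ L0 * ((4 * k1 + 4 * (8 * (9 * k3)) + B) * T) := by
    have s3'' := s3.trans s3'
    linarith
  exact le_of_mul_le_mul_left fin (by linarith)
end C1proof

namespace C1proof
variable {χ : ℕ → ℝ} {q : ℕ} {ρ c : ℝ}

/-- error term -/
noncomputable def Dl (χ : ℕ → ℝ) (ρ x : ℝ) : ℝ := AA χ ⌊x⌋₊ - ρ * x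

lemma Dl_nat (χ : ℕ → ℝ) (ρ : ℝ) (n : ℕ) : Dl χ ρ n = AA χ n - ρ * n := by
  unfold Dl; rw [Nat.floor_natCast]

lemma VA1 (h : CHI χ q ρ c) : ∃ C : ℝ, 0 < C ∧ ∀ N H : ℕ, 1 ≤ N → 1 ≤ H → H ≤ 64 * N →
    ∑ n ∈ Finset.Ico N (2*N), (Dl χ ρ (n + H : ℕ) - Dl χ ρ (n:ℕ))^2 ≤ C * (N * H * (1 + Real.log N)^3) := by
  obtain ⟨C, hC, hV⟩ := VA h
  refine ⟨C, hC, fun N H hN hH hHN => ?_⟩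
  refine le_trans (le_of_eq ?_) (hV N H hN hH hHN)
  rw [Finset.sum_Ico_eq_sum_range, show 2*N - N = N by omega]
  apply Finset.sum_congr rfl
  intro n _
  rw [Dl_nat, Dl_nat]; push_cast; ring

lemma VA16 (h : CHI χ q ρ c) : ∃ C : ℝ, 0 < C ∧ ∀ N H : ℕ, 1 ≤ N → 1 ≤ H → H ≤ 64 * N →
    ∑ n ∈ Finset.Ico N (16*N), (Dl χ ρ (n + H : ℕ) - Dl χ ρ (n:ℕ))^2 ≤ C * (N * H * (1 + Real.log N)^3) := by
  obtain ⟨C, hC, hV⟩ := VA1 h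
  have hl : 0 ≤ Real.log 8 := Real.log_nonneg (by norm_num)
  refine ⟨C * (4 * (8 * (1 + Real.log 8)^3)), by positivity, fun N H hN hH hHN => ?_⟩
  have hNr : (1:ℝ) ≤ N := by exact_mod_cast hN
  have hlN : 0 ≤ Real.log N := Real.log_nonneg hNr
  have key : ∀ k : ℕ, 1 ≤ k → k ≤ 8 → ∑ n ∈ Finset.Ico (k*N) (2*(k*N)), (Dl χ ρ (n + H : ℕ) - Dl χ ρ (n:ℕ))^2 ≤ C * (8 * (1 + Real.log 8)^3) * (N * H * (1 + Real.log N)^3) := by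
    intro k hk1 hk8
    have hkN : 1 ≤ k * N := by nlinarith
    refine (hV (k*N) H hkN hH (by nlinarith)).trans ?_
    have hk : (k:ℝ) ≤ 8 := by exact_mod_cast hk8
    have l1 : 1 + Real.log (k*N : ℕ) ≤ (1 + Real.log 8) * (1 + Real.log N) := log_bd 8 _ N (by norm_num) (by positivity) hNr (by push_cast; nlinarith)
    have l0 : 0 ≤ 1 + Real.log (k*N : ℕ) := by linarith [Real.log_natCast_nonneg (k*N)]
    rw [mul_assoc C]
    apply mul_le_mul_of_nonneg_left _ hC.le
    calc ((k*N:ℕ):ℝ) * H * (1 + Real.log (k*N:ℕ))^3 ≤ (8 * N) * H * ((1 + Real.log 8) * (1 + Real.log N))^3 := by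
          gcongr; push_cast; nlinarith
      _ = _ := by ring
  have k1 := key 1 (by norm_num) (by norm_num)
  have k2 := key 2 (by norm_num) (by norm_num)
  have k4 := key 4 (by norm_num) (by norm_num)
  have k8 := key 8 (by norm_num) (by norm_num)
  set f : ℕ → ℝ := fun n => (Dl χ ρ (n + H : ℕ) - Dl χ ρ (n:ℕ))^2 with hf
  have e1 : ∑ n ∈ Finset.Ico N (16*N), f n = ∑ n ∈ Finset.Ico (1*N) (2*(1*N)), f n + ∑ n ∈ Finset.Ico (2*N) (2*(2*N)), f n + ∑ n ∈ Finset.Ico (4*N) (2*(4*N)), f n + ∑ n ∈ Finset.Ico (8*N) (2*(8*N)), f n := by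
    rw [show 2*(1*N) = 2*N by ring, show 2*(2*N) = 4*N by ring, show 2*(4*N)=8*N by ring, show 2*(8*N) = 16*N by ring, one_mul]
    rw [Finset.sum_Ico_consecutive _ (by omega) (by omega), Finset.sum_Ico_consecutive _ (by omega) (by omega), Finset.sum_Ico_consecutive _ (by omega) (by omega)]
  rw [e1]
  linarith

lemma card_int (I : Finset ℤ) (u : ℝ) (k : ℕ) (h : ∀ i ∈ I, u ≤ i ∧ (i:ℝ) < u + k) : I.card ≤ k := by
  have : I ⊆ Finset.Ico ⌈u⌉ (⌈u⌉ + k) := by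
    intro i hi
    obtain ⟨h1, h2⟩ := h i hi
    rw [Finset.mem_Ico]
    refine ⟨Int.ceil_le.mpr h1, ?_⟩
    have := Int.lt_ceil.mpr h2
    rwa [Int.ceil_add_natCast] at this
  calc I.card ≤ _ := Finset.card_le_card this
    _ = k := by simp

lemma card_int' (I : Finset ℤ) (u v : ℝ) (huv : u ≤ v) (h : ∀ i ∈ I, u ≤ i ∧ (i:ℝ) < v) : (I.card : ℝ) ≤ v - u + 1 := by
  have h1 := card_int I u ⌈v - u⌉₊ (by
    intro i hi
    refine ⟨(h i hi).1, ?_⟩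
    have := Nat.le_ceil (v - u)
    linarith [(h i hi).2])
  have h2 := (Nat.ceil_lt_add_one (sub_nonneg.mpr huv)).le
  have : (I.card : ℝ) ≤ ⌈v - u⌉₊ := by exact_mod_cast h1
  linarith

/-- number of grid points in a multiplicative interval -/
lemma card_grid (δ : ℝ) (hδ : 0 < δ) (I : Finset ℤ) (a b : ℝ) (ha : 0 < a) (hab : a ≤ b) 
    (h : ∀ i ∈ I, a ≤ Real.exp (δ * i) ∧ Real.exp (δ * i) < b) : (I.card : ℝ) ≤ (b - a) / (a * δ) + 1 := by
  have h1 := card_int' I (Real.log a / δ) (Real.log b / δ) (by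
    gcongr) (by
    intro i hi
    obtain ⟨h1, h2⟩ := h i hi
    rw [div_le_iff₀ hδ, lt_div_iff₀ hδ, mul_comm (i:ℝ)]
    exact ⟨(Real.log_le_iff_le_exp ha).mpr h1, (Real.lt_log_iff_exp_lt (by linarith)).mpr h2⟩)
  have h2 : Real.log b - Real.log a ≤ (b - a)/a := by
    rw [← Real.log_div (by linarith) (by linarith)]
    have hb : 0 < b := by linarith
    have := Real.log_le_sub_one_of_pos (x := b/a) (by positivity)
    rw [sub_div, div_self (by linarith)]; exact this
  have h3 : Real.log b / δ - Real.log a / δ ≤ (b - a) / (a * δ) := by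
    rw [← sub_div, ← div_div]; gcongr
  linarith

noncomputable def Gr (χ : ℕ → ℝ) (ρ δ : ℝ) (i : ℤ) : ℝ := Dl χ ρ (Real.exp (δ * i))

lemma exp_step (δ : ℝ) (i : ℤ) (h : ℕ) : Real.exp (δ * ((i + h : ℤ):ℝ)) = Real.exp (δ * i) * Real.exp (δ * h) := by
  rw [← Real.exp_add]; congr 1; push_cast; ring

lemma exp_sub_one_le (t : ℝ) (h0 : 0 ≤ t) (h1 : t ≤ 1) : Real.exp t ≤ 1 + 2 * t := by
  have := Real.abs_exp_sub_one_le (x := t) (by rw [abs_of_nonneg h0]; exact h1)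
  rw [abs_of_nonneg h0] at this
  linarith [le_abs_self (Real.exp t - 1)]

lemma AA_sub (χ : ℕ → ℝ) {a b : ℕ} (h : a ≤ b) : ∑ l ∈ Finset.Ioc a b, aa χ l = AA χ b - AA χ a := PP_sub (aa χ) h

end C1proof

namespace C1proof
variable {χ : ℕ → ℝ} {q : ℕ} {ρ c : ℝ}

lemma sq_add_le (a b : ℝ) : (a + b)^2 ≤ 2 * a^2 + 2 * b^2 := by nlinarith [sq_nonneg (a - b)]

lemma grid_fibre (δ : ℝ) (hδ : 0 < δ) (N : ℕ) (hN : 1 ≤ N) (hδN : δ * N ≤ 1) (f : ℕ → ℝ) (hf : ∀ n, 0 ≤ f n)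
    (I : Finset ℤ) (hI : ∀ i ∈ I, (N:ℝ) ≤ Real.exp (δ * i) ∧ Real.exp (δ * i) < 16 * N) :
    ∑ i ∈ I, f ⌊Real.exp (δ * i)⌋₊ ≤ 2 / (N * δ) * ∑ n ∈ Finset.Ico N (16 * N), f n := by
  have hNr : (0:ℝ) < N := by exact_mod_cast hN
  have hmaps : ∀ i ∈ I, ⌊Real.exp (δ * i)⌋₊ ∈ Finset.Ico N (16 * N) := by
    intro i hi
    obtain ⟨h1, h2⟩ := hI i hi
    rw [Finset.mem_Ico]
    refine ⟨Nat.le_floor h1, (Nat.floor_lt (Real.exp_pos _).le).mpr (by push_cast; exact h2)⟩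
  rw [← Finset.sum_fiberwise_of_maps_to hmaps, Finset.mul_sum]
  apply Finset.sum_le_sum
  intro n hn
  rw [Finset.mem_Ico] at hn
  have hnN : (N:ℝ) ≤ n := by exact_mod_cast hn.1
  have h1 : ∑ i ∈ I with ⌊Real.exp (δ * ((i:ℤ):ℝ))⌋₊ = n, f ⌊Real.exp (δ * i)⌋₊ = (((I.filter (fun i : ℤ => ⌊Real.exp (δ * i)⌋₊ = n)).card : ℕ) : ℝ) * f n := by
    rw [Finset.sum_congr rfl (g := fun _ => f n) (by intro i hi; rw [(Finset.mem_filter.mp hi).2])]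
    rw [Finset.sum_const, nsmul_eq_mul]
  rw [h1]
  apply mul_le_mul_of_nonneg_right _ (hf n)
  have h2 := card_grid δ hδ (I.filter (fun i : ℤ => ⌊Real.exp (δ * i)⌋₊ = n)) n (n+1) (by linarith) (by linarith) (by
    intro i hi
    rw [← (Finset.mem_filter.mp hi).2]
    exact ⟨Nat.floor_le (Real.exp_pos _).le, Nat.lt_floor_add_one _⟩)
  refine h2.trans ?_
  have h3 : ((n:ℝ) + 1 - n) / (n * δ) ≤ 1 / (N * δ) := by
    rw [add_sub_cancel_left]; gcongr
  have h4 : 1 ≤ 1 / (N * δ) := by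
    rw [le_div_iff₀ (by positivity)]; linarith
  calc _ ≤ 1 / (N * δ) + 1 / (N * δ) := by linarith
    _ = _ := by ring

lemma grid_step (δ : ℝ) (hδ : 0 < δ) (N h : ℕ) (hδh : δ * h ≤ 1) (i : ℤ)
    (hi : (N:ℝ) ≤ Real.exp (δ * i) ∧ Real.exp (δ * i) < 2 * N) :
    Real.exp (δ * i) ≤ Real.exp (δ * ((i + h : ℤ):ℝ)) ∧ Real.exp (δ * ((i + h : ℤ):ℝ)) ≤ Real.exp (δ * i) + 4 * h * δ * N := by
  rw [exp_step]
  have h1 := exp_sub_one_le (δ * h) (by positivity) hδh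
  have h2 : 1 ≤ Real.exp (δ * h) := Real.one_le_exp (by positivity)
  have hp := Real.exp_pos (δ * i)
  refine ⟨by nlinarith, ?_⟩
  have h3 : 0 ≤ δ * h := by positivity
  nlinarith

lemma VkA (h : CHI χ q ρ c) : ∃ C : ℝ, 0 < C ∧ ∀ (δ : ℝ) (N k : ℕ), 0 < δ → 1 ≤ N → 1 ≤ k → δ * k ≤ 1 → δ * N ≤ 1/16 →
    k * δ * N ≤ 1 → ∀ I : Finset ℤ, (∀ i ∈ I, (N:ℝ) ≤ Real.exp (δ * i) ∧ Real.exp (δ * i) < 2 * N) →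
    ∑ i ∈ I, (Gr χ ρ δ (i + k) - Gr χ ρ δ i)^2 ≤ C * (k * N * (1 + Real.log N)^3) := by
  obtain ⟨C, hC, hV⟩ := VA16 h
  refine ⟨10 * (2 * C + 30 * ρ^2) + 64 * ρ^2, by positivity, ?_⟩
  intro δ N k hδ hN hk hδk hδN hkN I hI
  have hNr : (1:ℝ) ≤ N := by exact_mod_cast hN
  have hkr : (1:ℝ) ≤ k := by exact_mod_cast hk
  have hlN : 0 ≤ Real.log N := Real.log_nonneg hNr
  set x : ℤ → ℝ := fun i => Real.exp (δ * i) with hx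
  have hstep := fun i hi => grid_step δ hδ N k hδk i (hI i hi)
  have hpt : ∀ i ∈ I, (Gr χ ρ δ (i + k) - Gr χ ρ δ i)^2 ≤ 10 * ∑ m ∈ Finset.Ioc N (8*N), (if ⌊x i⌋₊ < m ∧ m ≤ ⌊x (i+k)⌋₊ then (aa χ m)^2 else 0) + 2 * (ρ * (4 * k * δ * N))^2 := by
    intro i hi
    obtain ⟨s1, s2⟩ := hstep i hi
    obtain ⟨i1, i2⟩ := hI i hi
    have hfl : ⌊x i⌋₊ ≤ ⌊x (i+k)⌋₊ := Nat.floor_le_floor s1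
    have e1 : Gr χ ρ δ (i + k) - Gr χ ρ δ i = ∑ m ∈ Finset.Ioc ⌊x i⌋₊ ⌊x (i+k)⌋₊, aa χ m + (- (ρ * (x (i+k) - x i))) := by
      rw [AA_sub χ hfl]; unfold Gr Dl; simp only [hx]; ring
    rw [e1]
    refine (sq_add_le _ _).trans ?_
    have hcard : (((Finset.Ioc ⌊x i⌋₊ ⌊x (i+k)⌋₊).card : ℕ) : ℝ) ≤ 5 := by
      rw [Nat.card_Ioc]
      have : ⌊x (i+k)⌋₊ ≤ ⌊x i⌋₊ + 4 := by
        rw [← Nat.floor_add_natCast (Real.exp_pos _).le]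
        apply Nat.floor_le_floor
        push_cast
        refine s2.trans ?_
        have : 4 * k * δ * N ≤ 4 := by linarith
        linarith
      have : ⌊x (i+k)⌋₊ - ⌊x i⌋₊ ≤ 5 := by omega
      exact_mod_cast this
    have h2 := sq_sum_le_card_mul_sum_sq (s := Finset.Ioc ⌊x i⌋₊ ⌊x (i+k)⌋₊) (f := aa χ)
    have h3 : (∑ m ∈ Finset.Ioc ⌊x i⌋₊ ⌊x (i+k)⌋₊, aa χ m)^2 ≤ 5 * ∑ m ∈ Finset.Ioc ⌊x i⌋₊ ⌊x (i+k)⌋₊, (aa χ m)^2 := by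
      refine h2.trans ?_
      apply mul_le_mul_of_nonneg_right hcard (Finset.sum_nonneg fun _ _ => sq_nonneg _)
    have h4 : ∑ m ∈ Finset.Ioc ⌊x i⌋₊ ⌊x (i+k)⌋₊, (aa χ m)^2 ≤ ∑ m ∈ Finset.Ioc N (8*N), (if ⌊x i⌋₊ < m ∧ m ≤ ⌊x (i+k)⌋₊ then (aa χ m)^2 else 0) := by
      rw [← Finset.sum_filter]
      apply Finset.sum_le_sum_of_subset_of_nonneg
      · intro m hm
        rw [Finset.mem_Ioc] at hm
        rw [Finset.mem_filter, Finset.mem_Ioc]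
        refine ⟨⟨lt_of_le_of_lt (Nat.le_floor i1) hm.1, hm.2.trans ?_⟩, hm⟩
        apply Nat.floor_le_of_le
        push_cast
        refine s2.trans ?_
        have : 4 * k * δ * N ≤ 4 * N := by nlinarith
        linarith
      · intros; positivity
    have h5 : (-(ρ * (x (i+k) - x i)))^2 ≤ (ρ * (4 * k * δ * N))^2 := by
      rw [neg_sq, mul_pow, mul_pow]
      have : 0 ≤ x (i+k) - x i := sub_nonneg.mpr s1
      have : x (i+k) - x i ≤ 4 * k * δ * N := by simp only [hx]; linarith
      gcongr
    linarith
  have hcnt : ∀ m ∈ Finset.Ioc N (8*N), ∑ i ∈ I, (if ⌊x i⌋₊ < m ∧ m ≤ ⌊x (i+k)⌋₊ then (aa χ m)^2 else 0) ≤ k * (aa χ m)^2 := by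
    intro m hm
    rw [Finset.mem_Ioc] at hm
    rw [← Finset.sum_filter, Finset.sum_const, nsmul_eq_mul]
    apply mul_le_mul_of_nonneg_right _ (sq_nonneg _)
    have hm0 : (0:ℝ) < m := by exact_mod_cast (by omega : 0 < m)
    have := card_int {i ∈ I | ⌊x i⌋₊ < m ∧ m ≤ ⌊x (i+k)⌋₊} (Real.log m / δ - k) k (by
      intro i hi
      rw [Finset.mem_filter] at hi
      obtain ⟨_, h1, h2⟩ := hi
      rw [Nat.floor_lt (Real.exp_pos _).le] at h1
      have h2 := (Nat.le_floor_iff (Real.exp_pos _).le).mp h2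
      have h1' : δ * i < Real.log m := (Real.lt_log_iff_exp_lt hm0).mpr h1
      have h2' := (Real.log_le_iff_le_exp hm0).mpr h2
      push_cast at h2'
      refine ⟨?_, ?_⟩
      · rw [sub_le_iff_le_add, div_le_iff₀ hδ]; linarith
      · rw [sub_add_cancel, lt_div_iff₀ hδ]; linarith)
    exact_mod_cast this
  have hsum : ∑ m ∈ Finset.Ioc N (8*N), (aa χ m)^2 ≤ (2 * C + 30 * ρ^2) * (N * (1 + Real.log N)^3) := by
    have hv := hV N 1 hN le_rfl (by omega)
    have e : ∑ m ∈ Finset.Ioc N (8*N), (aa χ m)^2 = ∑ m ∈ Finset.Ico N (8*N), (aa χ (m+1))^2 := by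
      rw [Finset.sum_Ico_add' (fun m => (aa χ m)^2) N (8*N) 1]
      congr 1; ext; simp
    rw [e]
    calc ∑ m ∈ Finset.Ico N (8*N), (aa χ (m+1))^2 ≤ ∑ m ∈ Finset.Ico N (16*N), (aa χ (m+1))^2 := by
          apply Finset.sum_le_sum_of_subset_of_nonneg
          · intro m hm; rw [Finset.mem_Ico] at *; omega
          · intros; positivity
      _ ≤ ∑ m ∈ Finset.Ico N (16*N), (2 * (Dl χ ρ (m + 1 : ℕ) - Dl χ ρ (m:ℕ))^2 + 2 * ρ^2) := by
          apply Finset.sum_le_sum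
          intro m _
          have : aa χ (m+1) = (Dl χ ρ (m + 1 : ℕ) - Dl χ ρ (m:ℕ)) + ρ := by
            have := AA_sub χ (Nat.le_succ m)
            rw [Dl_nat, Dl_nat]
            rw [Nat.succ_eq_add_one, Nat.Ioc_succ_singleton, Finset.sum_singleton] at this
            rw [this]; push_cast; ring
          rw [this]; exact sq_add_le _ _
      _ ≤ 2 * (C * (N * (1:ℕ) * (1 + Real.log N)^3)) + 30 * ρ^2 * N := by
          rw [Finset.sum_add_distrib, ← Finset.mul_sum, Finset.sum_const, Nat.card_Ico, show 16 * N - N = 15 * N by omega]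
          rw [nsmul_eq_mul]; push_cast at hv ⊢; linarith
      _ ≤ _ := by
          have : 1 ≤ (1 + Real.log N)^3 := one_le_pow₀ (by linarith)
          have : 30 * ρ^2 * N * 1 ≤ 30 * ρ^2 * N * (1 + Real.log N)^3 := by gcongr
          push_cast; linarith
  have hcI : (I.card : ℝ) ≤ 2 / δ := by
    have := card_grid δ hδ I N (2*N) (by linarith) (by linarith) hI
    rw [show (2 * (N:ℝ) - N) = N by ring] at this
    have e : (N:ℝ) / (N * δ) = 1 / δ := by field_simp
    rw [e] at this
    have : 1 ≤ 1 / δ := by rw [le_div_iff₀ hδ]; nlinarith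
    calc _ ≤ 1/δ + 1/δ := by linarith
      _ = _ := by ring
  calc _ ≤ ∑ i ∈ I, (10 * ∑ m ∈ Finset.Ioc N (8*N), (if ⌊x i⌋₊ < m ∧ m ≤ ⌊x (i+k)⌋₊ then (aa χ m)^2 else 0) + 2 * (ρ * (4 * k * δ * N))^2) := Finset.sum_le_sum hpt
    _ = 10 * (∑ m ∈ Finset.Ioc N (8*N), ∑ i ∈ I, (if ⌊x i⌋₊ < m ∧ m ≤ ⌊x (i+k)⌋₊ then (aa χ m)^2 else 0)) + I.card * (2 * (ρ * (4 * k * δ * N))^2) := by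
        rw [Finset.sum_add_distrib, ← Finset.mul_sum, Finset.sum_comm, Finset.sum_const, nsmul_eq_mul]
    _ ≤ 10 * (∑ m ∈ Finset.Ioc N (8*N), k * (aa χ m)^2) + (2 / δ) * (2 * (ρ * (4 * k * δ * N))^2) := by
        have := Finset.sum_le_sum hcnt
        gcongr
    _ = 10 * (k * (∑ m ∈ Finset.Ioc N (8*N), (aa χ m)^2)) + 64 * ρ^2 * (k * N * (k * δ * N)) := by
        rw [← Finset.mul_sum]; field_simp; ring
    _ ≤ 10 * (k * ((2 * C + 30 * ρ^2) * (N * (1 + Real.log N)^3))) + 64 * ρ^2 * (k * N * (1 + Real.log N)^3) := by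
        have : k * δ * N ≤ (1 + Real.log N)^3 := hkN.trans (one_le_pow₀ (by linarith))
        gcongr
    _ = _ := by ring

lemma VkB (h : CHI χ q ρ c) : ∃ C : ℝ, 0 < C ∧ ∀ (δ : ℝ) (N k : ℕ), 0 < δ → 1 ≤ N → 1 ≤ k → δ * k ≤ 1 → δ * N ≤ 1/16 →
    1 ≤ k * δ * N → ∀ I : Finset ℤ, (∀ i ∈ I, (N:ℝ) ≤ Real.exp (δ * i) ∧ Real.exp (δ * i) < 2 * N) →
    ∑ i ∈ I, (Gr χ ρ δ (i + k) - Gr χ ρ δ i)^2 ≤ C * (k * N * (1 + Real.log N)^3) := by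
  obtain ⟨C, hC, hV⟩ := VA16 h
  refine ⟨320 * C + 4 * ρ^2, by positivity, ?_⟩
  intro δ N k hδ hN hk hδk hδN hkN I hI
  have hNr : (1:ℝ) ≤ N := by exact_mod_cast hN
  have hkr : (1:ℝ) ≤ k := by exact_mod_cast hk
  have hlN : 0 ≤ Real.log N := Real.log_nonneg hNr
  set x : ℤ → ℝ := fun i => Real.exp (δ * i) with hx
  have hstep := fun i hi => grid_step δ hδ N k hδk i (hI i hi)
  set K := ⌈4 * k * δ * N⌉₊ with hK
  have hK1 : 4 * k * δ * N ≤ K := Nat.le_ceil _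
  have hK2 : (K:ℝ) ≤ 5 * k * δ * N := by
    have := (Nat.ceil_lt_add_one (show 0 ≤ 4 * k * δ * N by positivity)).le
    rw [← hK] at this; linarith
  have hK0 : (0:ℝ) < K := by linarith
  have hKN : (K:ℝ) ≤ 5 * N := by nlinarith
  have hKN' : K ≤ 5 * N := by exact_mod_cast hKN
  set D : ℕ → ℝ := fun n => Dl χ ρ n with hD
  set Q : ℕ → ℝ := fun n => ∑ t ∈ Finset.Icc 1 (2*K), (D (n+t) - D n)^2 with hQ
  have hQ0 : ∀ n, 0 ≤ Q n := fun n => Finset.sum_nonneg fun _ _ => sq_nonneg _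
  have hpt : ∀ i ∈ I, (Gr χ ρ δ (i + k) - Gr χ ρ δ i)^2 ≤ 4 / K * (Q ⌊x i⌋₊ + Q ⌊x (i+k)⌋₊) + 2 * ρ^2 := by
    intro i hi
    obtain ⟨s1, s2⟩ := hstep i hi
    have hfl : ⌊x i⌋₊ ≤ ⌊x (i+k)⌋₊ := Nat.floor_le_floor s1
    have hfu : ⌊x (i+k)⌋₊ ≤ ⌊x i⌋₊ + K := by
      rw [← Nat.floor_add_natCast (Real.exp_pos _).le]
      apply Nat.floor_le_floor
      refine s2.trans ?_
      linarith
    set n := ⌊x i⌋₊ with hn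
    set n' := ⌊x (i+k)⌋₊ with hn'
    have e1 : Gr χ ρ δ (i + k) - Gr χ ρ δ i = (D n' - D n) + (- (ρ * ((x (i+k) - n') - (x i - n)))) := by
      simp only [hD, Dl_nat]; unfold Gr Dl; simp only [hx, hn, hn']; ring
    have f1 := Nat.floor_le (Real.exp_pos (δ * i)).le
    have f2 := Nat.lt_floor_add_one (x i)
    have f3 := Nat.floor_le (Real.exp_pos (δ * ((i + k : ℤ):ℝ))).le
    have f4 := Nat.lt_floor_add_one (x (i+k))
    have e2 : (- (ρ * ((x (i+k) - n') - (x i - n))))^2 ≤ ρ^2 := by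
      rw [neg_sq, mul_pow]
      have : ((x (i+k) - n') - (x i - n))^2 ≤ 1 := by
        rw [sq_le_one_iff_abs_le_one, abs_le]
        simp only [hn, hn', hx] at *
        constructor <;> linarith
      nlinarith [sq_nonneg ρ]
    have e3 : K * (D n' - D n)^2 ≤ 2 * (Q n + Q n') := by
      calc K * (D n' - D n)^2 = ∑ s ∈ Finset.Icc 1 K, (D n' - D n)^2 := by simp
        _ ≤ ∑ s ∈ Finset.Icc 1 K, (2 * (D (n + (K + s)) - D n)^2 + 2 * (D (n' + (n + K - n' + s)) - D n')^2) := by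
            apply Finset.sum_le_sum
            intro s _
            rw [show n' + (n + K - n' + s) = n + (K + s) by omega]
            nlinarith [sq_nonneg ((D (n + (K+s)) - D n) + (D (n + (K+s)) - D n'))]
        _ = 2 * (∑ s ∈ Finset.Icc 1 K, (D (n + (K + s)) - D n)^2 + ∑ s ∈ Finset.Icc 1 K, (D (n' + (n + K - n' + s)) - D n')^2) := by
            rw [Finset.sum_add_distrib, ← Finset.mul_sum, ← Finset.mul_sum]; ring
        _ ≤ _ := by
            have sub : ∀ a u : ℕ, u ≤ K → ∑ s ∈ Finset.Icc 1 K, (D (a + (u + s)) - D a)^2 ≤ Q a := by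
              intro a u hu
              simp only [hQ]
              rw [← Finset.sum_image (s := Finset.Icc 1 K) (g := fun s => u + s) (f := fun t => (D (a + t) - D a)^2) (by intro p _ q _ hpq; simpa using hpq)]
              apply Finset.sum_le_sum_of_subset_of_nonneg
              · intro t ht
                rw [Finset.mem_image] at ht
                obtain ⟨s, hs, rfl⟩ := ht
                rw [Finset.mem_Icc] at *
                omega
              · intros; positivity
            have a1 := sub n K le_rfl
            have a2 := sub n' (n + K - n') (by omega)
            linarith
    rw [e1]
    refine (sq_add_le _ _).trans ?_
    have e4 : (D n' - D n)^2 ≤ 2 / K * (Q n + Q n') := by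
      rw [div_mul_eq_mul_div, le_div_iff₀ hK0]; linarith
    calc _ ≤ 2 * (2 / K * (Q n + Q n')) + 2 * ρ^2 := by linarith
      _ = _ := by ring
  have hQs : ∑ n ∈ Finset.Ico N (16*N), Q n ≤ C * (N * (1 + Real.log N)^3) * (2 * K)^2 := by
    simp only [hQ]
    rw [Finset.sum_comm]
    calc _ ≤ ∑ t ∈ Finset.Icc 1 (2*K), C * (N * (1 + Real.log N)^3) * (2 * K) := by
          apply Finset.sum_le_sum
          intro t ht
          rw [Finset.mem_Icc] at ht
          have ht' : (t:ℝ) ≤ 2 * K := by exact_mod_cast ht.2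
          refine (hV N t hN ht.1 (by omega)).trans ?_
          calc C * (N * t * (1 + Real.log N)^3) = C * (N * (1 + Real.log N)^3) * t := by ring
            _ ≤ _ := by gcongr
      _ = _ := by simp; ring
  have hcI : (I.card : ℝ) ≤ 2 / δ := by
    have := card_grid δ hδ I N (2*N) (by linarith) (by linarith) hI
    rw [show (2 * (N:ℝ) - N) = N by ring] at this
    have e : (N:ℝ) / (N * δ) = 1 / δ := by field_simp
    rw [e] at this
    have : 1 ≤ 1 / δ := by rw [le_div_iff₀ hδ]; nlinarith
    calc _ ≤ 1/δ + 1/δ := by linarith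
      _ = _ := by ring
  have g1 : ∑ i ∈ I, Q ⌊x i⌋₊ ≤ 2 / (N * δ) * ∑ n ∈ Finset.Ico N (16 * N), Q n :=
    grid_fibre δ hδ N hN (by linarith) Q hQ0 I (by
      intro i hi
      have := hI i hi
      exact ⟨this.1, by linarith [this.2]⟩)
  have g2 : ∑ i ∈ I, Q ⌊x (i+k)⌋₊ ≤ 2 / (N * δ) * ∑ n ∈ Finset.Ico N (16 * N), Q n := by
    have := grid_fibre δ hδ N hN (by linarith) Q hQ0 (I.map (addRightEmbedding (k:ℤ))) (by
      intro j hj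
      rw [Finset.mem_map] at hj
      obtain ⟨i, hi, rfl⟩ := hj
      obtain ⟨s1, s2⟩ := hstep i hi
      have h1 := hI i hi
      simp only [addRightEmbedding_apply]
      have : 4 * k * δ * N ≤ 4 * N := by nlinarith
      exact ⟨by linarith, by linarith⟩)
    rw [Finset.sum_map] at this
    exact this
  have hd : 1 / δ ≤ k * N * (1 + Real.log N)^3 := by
    calc 1 / δ ≤ k * N := by rw [div_le_iff₀ hδ]; linarith
      _ ≤ _ := le_mul_of_one_le_right (by positivity) (one_le_pow₀ (by linarith))
  calc _ ≤ ∑ i ∈ I, (4 / K * (Q ⌊x i⌋₊ + Q ⌊x (i+k)⌋₊) + 2 * ρ^2) := Finset.sum_le_sum hpt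
    _ = 4 / K * (∑ i ∈ I, Q ⌊x i⌋₊ + ∑ i ∈ I, Q ⌊x (i+k)⌋₊) + I.card * (2 * ρ^2) := by
        rw [Finset.sum_add_distrib, ← Finset.mul_sum, Finset.sum_add_distrib, Finset.sum_const, nsmul_eq_mul]
    _ ≤ 4 / K * (2 * (2 / (N * δ) * (C * (N * (1 + Real.log N)^3) * (2 * K)^2))) + 2 / δ * (2 * ρ^2) := by
        have : 2 / (N * δ) * ∑ n ∈ Finset.Ico N (16 * N), Q n ≤ 2 / (N * δ) * (C * (N * (1 + Real.log N)^3) * (2 * K)^2) := by gcongr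
        have : ∑ i ∈ I, Q ⌊x i⌋₊ + ∑ i ∈ I, Q ⌊x (i+k)⌋₊ ≤ 2 * (2 / (N * δ) * (C * (N * (1 + Real.log N)^3) * (2 * K)^2)) := by linarith
        gcongr
    _ = 64 * C * (1 + Real.log N)^3 * (K / δ) + 4 * ρ^2 * (1 / δ) := by
        field_simp; ring
    _ ≤ 64 * C * (1 + Real.log N)^3 * (5 * k * N) + 4 * ρ^2 * (k * N * (1 + Real.log N)^3) := by
        have : K / δ ≤ 5 * k * N := by rw [div_le_iff₀ hδ]; linarith
        gcongr
    _ = _ := by ring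

lemma Vk (h : CHI χ q ρ c) : ∃ C : ℝ, 0 < C ∧ ∀ (δ : ℝ) (N k : ℕ), 0 < δ → 1 ≤ N → 1 ≤ k → δ * k ≤ 1 → δ * N ≤ 1/16 →
    ∀ I : Finset ℤ, (∀ i ∈ I, (N:ℝ) ≤ Real.exp (δ * i) ∧ Real.exp (δ * i) < 2 * N) →
    ∑ i ∈ I, (Gr χ ρ δ (i + k) - Gr χ ρ δ i)^2 ≤ C * (k * N * (1 + Real.log N)^3) := by
  obtain ⟨C1, h1, V1⟩ := VkA h
  obtain ⟨C2, h2, V2⟩ := VkB h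
  refine ⟨C1 + C2, by positivity, ?_⟩
  intro δ N k hδ hN hk hδk hδN I hI
  have hp : 0 ≤ (k * N * (1 + Real.log N)^3) := by
    have := Real.log_natCast_nonneg N
    positivity
  rcases le_total (k * δ * N) 1 with hh | hh
  · have := V1 δ N k hδ hN hk hδk hδN hh I hI
    nlinarith
  · have := V2 δ N k hδ hN hk hδk hδN hh I hI
    nlinarith

lemma Vstar (h : CHI χ q ρ c) : ∃ C : ℝ, 0 < C ∧ ∀ (δ : ℝ) (n k : ℕ), 0 < δ → 1 ≤ k → δ * k ≤ 1 → δ * 2^n ≤ 1/16 →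
    ∀ S : Finset ℤ, (∀ i ∈ S, 0 ≤ i ∧ Real.exp (δ * i) < 2^n) →
    ∑ i ∈ S, (Gr χ ρ δ (i + k) - Gr χ ρ δ i)^2 / Real.exp (δ * i) ≤ C * (k * (1 + n)^4) := by
  obtain ⟨C, hC, hV⟩ := Vk h
  refine ⟨C, hC, ?_⟩
  intro δ n k hδ hk hδk hδn S hS
  have hmaps : ∀ i ∈ S, Nat.log 2 ⌊Real.exp (δ * i)⌋₊ ∈ Finset.range n := by
    intro i hi
    obtain ⟨h1, h2⟩ := hS i hi
    rw [Finset.mem_range]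
    have h3 : ⌊Real.exp (δ * i)⌋₊ < 2^n := by
      rw [Nat.floor_lt (Real.exp_pos _).le]; push_cast; exact h2
    have h4 : ⌊Real.exp (δ * i)⌋₊ ≠ 0 := by
      have : 1 ≤ ⌊Real.exp (δ * i)⌋₊ := Nat.le_floor (by
        push_cast; apply Real.one_le_exp
        have : (0:ℝ) ≤ i := by exact_mod_cast h1
        positivity)
      omega
    exact Nat.log_lt_of_lt_pow h4 h3
  rw [← Finset.sum_fiberwise_of_maps_to hmaps]
  calc _ ≤ ∑ j ∈ Finset.range n, C * (k * (1 + n)^3) := by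
        apply Finset.sum_le_sum
        intro j hj
        rw [Finset.mem_range] at hj
        have hI : ∀ i ∈ ({i ∈ S | Nat.log 2 ⌊Real.exp (δ * i)⌋₊ = j} : Finset ℤ), ((2^j : ℕ):ℝ) ≤ Real.exp (δ * i) ∧ Real.exp (δ * i) < 2 * (2^j : ℕ) := by
          intro i hi
          rw [Finset.mem_filter] at hi
          obtain ⟨hi, hj⟩ := hi
          obtain ⟨h1, h2⟩ := hS i hi
          have h4 : ⌊Real.exp (δ * i)⌋₊ ≠ 0 := by
            have : 1 ≤ ⌊Real.exp (δ * i)⌋₊ := Nat.le_floor (by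
              push_cast; apply Real.one_le_exp
              have : (0:ℝ) ≤ i := by exact_mod_cast h1
              positivity)
            omega
          constructor
          · have := Nat.pow_log_le_self 2 h4
            rw [hj] at this
            exact (Nat.le_floor_iff (Real.exp_pos _).le).mp this
          · have := Nat.lt_pow_succ_log_self (b := 2) (by norm_num) ⌊Real.exp (δ * i)⌋₊
            rw [hj, Nat.floor_lt (Real.exp_pos _).le] at this
            refine this.trans_le ?_
            rw [pow_succ]; push_cast; linarith
        have h2j : (2:ℝ)^j ≤ 2^n := pow_le_pow_right₀ (by norm_num) hj.le
        have hv := hV δ (2^j) k hδ Nat.one_le_two_pow hk hδk (by push_cast; nlinarith) _ hI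
        calc _ ≤ ∑ i ∈ S with Nat.log 2 ⌊Real.exp (δ * ((i:ℤ):ℝ))⌋₊ = j, (Gr χ ρ δ (i + k) - Gr χ ρ δ i)^2 / 2^j := by
              apply Finset.sum_le_sum
              intro i hi
              have := (hI i hi).1
              push_cast at this
              gcongr
          _ ≤ C * (k * (2^j:ℕ) * (1 + Real.log (2^j:ℕ))^3) / 2^j := by
              rw [← Finset.sum_div]; gcongr
          _ = C * (k * (1 + Real.log (2^j:ℕ))^3) := by push_cast; field_simp
          _ ≤ _ := by
              have l0 : 0 ≤ Real.log (2^j:ℕ) := Real.log_natCast_nonneg _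
              have l1 : Real.log (2^j:ℕ) ≤ n := by
                push_cast; rw [Real.log_pow]
                have : Real.log 2 ≤ 1 := by linarith [Real.log_two_lt_d9]
                have : (j:ℝ) ≤ n := by exact_mod_cast hj.le
                have := Real.log_nonneg (show (1:ℝ) ≤ 2 by norm_num)
                nlinarith
              gcongr
    _ = C * (k * (1+n)^3) * n := by simp; ring
    _ ≤ C * (k * (1+n)^3) * (1+n) := by gcongr; linarith
    _ = _ := by ring

end C1proof

namespace C1proof
variable {χ : ℕ → ℝ} {q : ℕ} {ρ c : ℝ}

/-- bilinear sum over the grid at step `k` -/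
noncomputable def ww (χ : ℕ → ℝ) (ρ δ : ℝ) (I a b k : ℤ) : ℝ :=
  ∑ i ∈ Finset.Ico a b, Gr χ ρ δ (I - i) * (Gr χ ρ δ i - Gr χ ρ δ (i - k))

lemma Gr_bd (h : CHI χ q ρ c) (δ : ℝ) (i : ℤ) : |Gr χ ρ δ i| ≤ c * Real.exp (δ * i) ^ ((1:ℝ)/3) := 
  h.land _ (Real.exp_pos _)

lemma Gr_prod (h : CHI χ q ρ c) (δ : ℝ) (hδ : 0 < δ) (I i j k l : ℤ) (hi : i ≤ l) (hj : j ≤ l) (hk : I - l ≤ k) (hk' : k ≤ I - l) :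
    |Gr χ ρ δ k * (Gr χ ρ δ i - Gr χ ρ δ j)| ≤ 2 * c^2 * Real.exp (δ * I) ^ ((1:ℝ)/3) := by
  have hkk : k = I - l := le_antisymm hk' hk
  subst hkk
  have h0 := h.c_nonneg
  have hmono : ∀ u : ℤ, u ≤ l → |Gr χ ρ δ u| ≤ c * Real.exp (δ * l) ^ ((1:ℝ)/3) := by
    intro u hu
    refine (Gr_bd h δ u).trans ?_
    have : (u:ℝ) ≤ l := by exact_mod_cast hu
    gcongr
  have e : Real.exp (δ * I) ^ ((1:ℝ)/3) = Real.exp (δ * ((I - l : ℤ):ℝ)) ^ ((1:ℝ)/3) * Real.exp (δ * l) ^ ((1:ℝ)/3) := by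
    rw [← Real.mul_rpow (Real.exp_pos _).le (Real.exp_pos _).le, ← Real.exp_add]
    congr 2; push_cast; ring
  rw [e, abs_mul]
  have h1 := Gr_bd h δ (I - l)
  have h2 : |Gr χ ρ δ i - Gr χ ρ δ j| ≤ 2 * (c * Real.exp (δ * l) ^ ((1:ℝ)/3)) := by
    have := abs_sub (Gr χ ρ δ i) (Gr χ ρ δ j)
    linarith [hmono i hi, hmono j hj]
  calc _ ≤ (c * Real.exp (δ * ((I - l : ℤ):ℝ)) ^ ((1:ℝ)/3)) * (2 * (c * Real.exp (δ * l) ^ ((1:ℝ)/3))) := by gcongr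
    _ = _ := by ring

lemma ww_id (χ : ℕ → ℝ) (ρ δ : ℝ) (I a b k : ℤ) (hab : a ≤ b) (hk : 0 ≤ k) :
    2 * ww χ ρ δ I a b k - ww χ ρ δ I a b (2*k) = 
     ∑ i ∈ Finset.Ico a b, (Gr χ ρ δ (I - i) - Gr χ ρ δ (I - i - k)) * (Gr χ ρ δ i - Gr χ ρ δ (i - k))
     + ∑ i ∈ Finset.Ico (b - k) b, Gr χ ρ δ (I - i - k) * (Gr χ ρ δ i - Gr χ ρ δ (i - k))
     - ∑ i ∈ Finset.Ico (a - k) a, Gr χ ρ δ (I - i - k) * (Gr χ ρ δ i - Gr χ ρ δ (i - k)) := by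
  unfold ww
  set g : ℤ → ℝ := fun i => Gr χ ρ δ (I - i - k) * (Gr χ ρ δ i - Gr χ ρ δ (i - k)) with hg
  have h1 : ∑ i ∈ Finset.Ico a b, Gr χ ρ δ (I - i) * (Gr χ ρ δ (i - k) - Gr χ ρ δ (i - 2*k)) = ∑ i ∈ Finset.Ico (a - k) (b - k), g i := by
    have := Finset.sum_image (s := Finset.Ico a b) (g := fun i => i - k) (f := g) (by intro p _ q _ hpq; simpa using hpq)
    rw [show (Finset.Ico a b).image (fun i => i - k) = Finset.Ico (a - k) (b - k) by
      ext x; simp only [Finset.mem_image, Finset.mem_Ico]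
      constructor
      · rintro ⟨y, hy, rfl⟩; omega
      · intro hx; exact ⟨x + k, by omega, by ring⟩] at this
    rw [this]
    apply Finset.sum_congr rfl
    intro i _
    simp only [hg]
    rw [show I - (i - k) - k = I - i by ring, show i - k - k = i - 2 * k by ring]
  have h2 : ∑ i ∈ Finset.Ico (a-k) (b-k), g i + ∑ i ∈ Finset.Ico (b-k) b, g i = ∑ i ∈ Finset.Ico (a-k) b, g i := by
    rw [← Finset.sum_union]
    · congr 1; ext x; simp only [Finset.mem_union, Finset.mem_Ico]; omega
    · rw [Finset.disjoint_left]; intro x; simp only [Finset.mem_Ico]; omega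
  have h3 : ∑ i ∈ Finset.Ico (a-k) a, g i + ∑ i ∈ Finset.Ico a b, g i = ∑ i ∈ Finset.Ico (a-k) b, g i := by
    rw [← Finset.sum_union]
    · congr 1; ext x; simp only [Finset.mem_union, Finset.mem_Ico]; omega
    · rw [Finset.disjoint_left]; intro x; simp only [Finset.mem_Ico]; omega
  have h4 : ∑ i ∈ Finset.Ico a b, (Gr χ ρ δ (I - i) - Gr χ ρ δ (I - i - k)) * (Gr χ ρ δ i - Gr χ ρ δ (i - k)) = ∑ i ∈ Finset.Ico a b, Gr χ ρ δ (I - i) * (Gr χ ρ δ i - Gr χ ρ δ (i - k)) - ∑ i ∈ Finset.Ico a b, g i := by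
    rw [← Finset.sum_sub_distrib]
    apply Finset.sum_congr rfl; intro i _; simp only [hg]; ring
  have h5 : ∑ i ∈ Finset.Ico a b, Gr χ ρ δ (I - i) * (Gr χ ρ δ i - Gr χ ρ δ (i - 2*k)) = ∑ i ∈ Finset.Ico a b, Gr χ ρ δ (I - i) * (Gr χ ρ δ i - Gr χ ρ δ (i - k)) + ∑ i ∈ Finset.Ico a b, Gr χ ρ δ (I - i) * (Gr χ ρ δ (i - k) - Gr χ ρ δ (i - 2*k)) := by
    rw [← Finset.sum_add_distrib]
    apply Finset.sum_congr rfl; intro i _; ring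
  rw [h4, h5, h1]
  linarith

lemma amgm (u v x y : ℝ) (hx : 0 < x) (hy : 0 < y) : |u * v| ≤ Real.sqrt (x * y) / 2 * (u^2 / x + v^2 / y) := by
  have hs : 0 < Real.sqrt (x*y) := Real.sqrt_pos.mpr (by positivity)
  have hs2 := Real.sq_sqrt (show 0 ≤ x*y by positivity)
  set s := Real.sqrt (x*y)
  have e : s / 2 * (u^2 / x + v^2 / y) = (s * (u^2 * y + v^2 * x)) / (2 * (x*y)) := by field_simp
  rw [e, ← hs2, le_div_iff₀ (by positivity), abs_mul]
  have : 2 * (|u| * |v| * s) ≤ u^2 * y + v^2 * x := by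
    have h1 : 0 ≤ (|u| * Real.sqrt y - |v| * Real.sqrt x)^2 := sq_nonneg _
    have h2 : Real.sqrt x * Real.sqrt y = s := (Real.sqrt_mul hx.le y).symm
    have h3 := Real.sq_sqrt hx.le
    have h4 := Real.sq_sqrt hy.le
    have h5 := sq_abs u
    have h6 := sq_abs v
    calc 2 * (|u| * |v| * s) = 2 * (|u| * Real.sqrt y) * (|v| * Real.sqrt x) := by rw [← h2]; ring
      _ ≤ (|u| * Real.sqrt y)^2 + (|v| * Real.sqrt x)^2 := by linarith [h1, sq_nonneg (|u| * Real.sqrt y - |v| * Real.sqrt x), two_mul_le_add_sq (|u| * Real.sqrt y) (|v| * Real.sqrt x)]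
      _ = _ := by rw [mul_pow, mul_pow, h3, h4, h5, h6]
  nlinarith

lemma ww_step (h : CHI χ q ρ c) : ∃ C : ℝ, 0 < C ∧ ∀ (δ : ℝ) (n k : ℕ) (I a b : ℤ), 0 < δ → 1 ≤ k → δ * k ≤ 1 → δ * 2^n ≤ 1/16 →
    Real.exp (δ * I) < 2^n → 1 ≤ δ * a → a ≤ b → δ * b ≤ δ * I - 1 →
    |2 * ww χ ρ δ I a b k - ww χ ρ δ I a b (2*k)| ≤ C * (k * (Real.sqrt (Real.exp (δ * I)) * (1 + n)^4)) := by
  obtain ⟨C, hC, hV⟩ := Vstar h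
  refine ⟨C + 4 * c^2, by positivity, ?_⟩
  intro δ n k I a b hδ hk hδk hδn hY ha hab hb
  have hkr : (1:ℝ) ≤ k := by exact_mod_cast hk
  rw [ww_id _ _ _ _ _ _ _ hab (by positivity)]
  set Y := Real.exp (δ * I) with hYd
  have hY1 : 1 ≤ Y := by
    apply Real.one_le_exp
    have : (a:ℝ) ≤ b := by exact_mod_cast hab
    have : δ * a ≤ δ * b := by gcongr
    linarith
  have hka : ∀ i : ℤ, a ≤ i → (k:ℤ) ≤ i := by
    intro i hi
    have : δ * k ≤ δ * a := by linarith
    have : (k:ℝ) ≤ a := le_of_mul_le_mul_left this hδ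
    have : (k:ℤ) ≤ a := by exact_mod_cast this
    omega
  have hkb : ∀ i : ℤ, i < b → 0 ≤ I - i - k := by
    intro i hi
    have : δ * (b + k) ≤ δ * I := by linarith
    have : ((b + k : ℤ):ℝ) ≤ I := by push_cast; exact le_of_mul_le_mul_left this hδ
    have : (b + k : ℤ) ≤ I := by exact_mod_cast this
    omega
  have hexp : ∀ i : ℤ, i ≤ I → Real.exp (δ * i) < 2^n := by
    intro i hi
    refine lt_of_le_of_lt ?_ hY
    have : (i:ℝ) ≤ I := by exact_mod_cast hi
    rw [hYd]; gcongr
  have hYp : Y ^ ((1:ℝ)/3) ≤ Real.sqrt Y := by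
    rw [Real.sqrt_eq_rpow]; exact Real.rpow_le_rpow_of_exponent_le hY1 (by norm_num)
  have bnd : ∀ u : ℤ, |∑ i ∈ Finset.Ico (u - k) u, Gr χ ρ δ (I - i - k) * (Gr χ ρ δ i - Gr χ ρ δ (i - k))| ≤ k * (2 * c^2 * Y ^ ((1:ℝ)/3)) := by
    intro u
    refine (Finset.abs_sum_le_sum_abs _ _).trans ?_
    refine (Finset.sum_le_sum (g := fun _ => 2 * c^2 * Y ^ ((1:ℝ)/3)) (fun i _ => Gr_prod h δ hδ I _ _ _ (i + k) (by omega) (by omega) (by omega) (by omega))).trans ?_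
    rw [Finset.sum_const, nsmul_eq_mul]; simp
  have main : |∑ i ∈ Finset.Ico a b, (Gr χ ρ δ (I - i) - Gr χ ρ δ (I - i - k)) * (Gr χ ρ δ i - Gr χ ρ δ (i - k))| ≤ C * (k * (Real.sqrt Y * (1+n)^4)) := by
    have v1 := hV δ n k hδ hk hδk hδn ((Finset.Ico a b).image (fun i => i - (k:ℤ))) (by
      intro j hj
      rw [Finset.mem_image] at hj
      obtain ⟨i, hi, rfl⟩ := hj
      rw [Finset.mem_Ico] at hi
      have := hka i hi.1
      have := hkb i hi.2
      exact ⟨by omega, hexp _ (by omega)⟩)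
    have v2 := hV δ n k hδ hk hδk hδn ((Finset.Ico a b).image (fun i => I - i - (k:ℤ))) (by
      intro j hj
      rw [Finset.mem_image] at hj
      obtain ⟨i, hi, rfl⟩ := hj
      rw [Finset.mem_Ico] at hi
      have := hka i hi.1
      have := hkb i hi.2
      exact ⟨by omega, hexp _ (by omega)⟩)
    rw [Finset.sum_image (by intro p _ q _ hpq; simpa using hpq)] at v1 v2
    refine (Finset.abs_sum_le_sum_abs _ _).trans ?_
    calc _ ≤ ∑ i ∈ Finset.Ico a b, Real.sqrt Y / 2 * ((Gr χ ρ δ (I - i - k + k) - Gr χ ρ δ (I - i - k))^2 / Real.exp (δ * ((I - i - k : ℤ):ℝ)) + (Gr χ ρ δ (i - k + k) - Gr χ ρ δ (i - k))^2 / Real.exp (δ * ((i - k : ℤ):ℝ))) := by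
          apply Finset.sum_le_sum
          intro i _
          rw [show I - i - k + k = I - i by ring, show i - (k:ℤ) + k = i by ring]
          refine (amgm _ _ (Real.exp (δ * ((I - i : ℤ):ℝ))) (Real.exp (δ * i)) (Real.exp_pos _) (Real.exp_pos _)).trans ?_
          have e : Real.exp (δ * ((I - i : ℤ):ℝ)) * Real.exp (δ * i) = Y := by
            rw [hYd, ← Real.exp_add]; congr 1; push_cast; ring
          rw [e]
          have m1 : Real.exp (δ * ((I - i - k : ℤ):ℝ)) ≤ Real.exp (δ * ((I - i : ℤ):ℝ)) := by
            apply Real.exp_le_exp.mpr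
            apply mul_le_mul_of_nonneg_left _ hδ.le
            push_cast; linarith
          have m2 : Real.exp (δ * ((i - k : ℤ):ℝ)) ≤ Real.exp (δ * i) := by
            apply Real.exp_le_exp.mpr
            apply mul_le_mul_of_nonneg_left _ hδ.le
            push_cast; linarith
          have p1 := Real.exp_pos (δ * ((I - i - k : ℤ):ℝ))
          have p2 := Real.exp_pos (δ * ((i - k : ℤ):ℝ))
          apply mul_le_mul_of_nonneg_left _ (by positivity)
          exact add_le_add (div_le_div_of_nonneg_left (sq_nonneg _) p1 m1) (div_le_div_of_nonneg_left (sq_nonneg _) p2 m2)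
      _ = Real.sqrt Y / 2 * (∑ i ∈ Finset.Ico a b, (Gr χ ρ δ (I - i - k + k) - Gr χ ρ δ (I - i - k))^2 / Real.exp (δ * ((I - i - k : ℤ):ℝ)) + ∑ i ∈ Finset.Ico a b, (Gr χ ρ δ (i - k + k) - Gr χ ρ δ (i - k))^2 / Real.exp (δ * ((i - k : ℤ):ℝ))) := by
          rw [← Finset.sum_add_distrib, ← Finset.mul_sum]
      _ ≤ Real.sqrt Y / 2 * (C * (k * (1 + n)^4) + C * (k * (1 + n)^4)) := by gcongr
      _ = _ := by ring
  have b1 := bnd a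
  have b2 := bnd b
  have f1 : k * (2 * c^2 * Y ^ ((1:ℝ)/3)) ≤ 2 * c^2 * (k * (Real.sqrt Y * (1+n)^4)) := by
    have : (1:ℝ) ≤ (1+n)^4 := one_le_pow₀ (by linarith [Nat.cast_nonneg (α := ℝ) n])
    calc k * (2 * c^2 * Y ^ ((1:ℝ)/3)) ≤ k * (2 * c^2 * (Real.sqrt Y * (1+n)^4)) := by
          gcongr
          exact hYp.trans (le_mul_of_one_le_right (Real.sqrt_nonneg _) this)
      _ = _ := by ring
  rw [abs_le] at main b1 b2 ⊢
  constructor <;> linarith [main.1, main.2, b1.1, b1.2, b2.1, b2.2]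

lemma tele (w : ℕ → ℝ) (J : ℕ) (E : ℝ) (hs : ∀ j < J, |2 * w j - w (j+1)| ≤ 2^(j+1) * E) : |w 0| ≤ |w J| / 2^J + J * E := by
  induction J with
  | zero => simp
  | succ J ih =>
    have h1 := ih (fun j hj => hs j (by omega))
    have h2 := hs J (by omega)
    have h3 : |w J| ≤ |w (J+1)| / 2 + 2^J * E := by
      have h4 : 2 * |w J| ≤ |w (J+1)| + 2^(J+1) * E := by
        calc 2 * |w J| = |2 * w J| := by rw [abs_mul]; norm_num
          _ = |w (J+1) + (2 * w J - w (J+1))| := by ring_nf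
          _ ≤ |w (J+1)| + |2 * w J - w (J+1)| := abs_add_le _ _
          _ ≤ _ := by linarith
      rw [pow_succ] at h4; linarith
    have h5 : |w J| / 2^J ≤ |w (J+1)| / 2^(J+1) + E := by
      rw [div_le_iff₀ (by positivity), pow_succ]
      refine h3.trans (le_of_eq ?_); field_simp
    push_cast; linarith

lemma ww_one (h : CHI χ q ρ c) : ∃ C : ℝ, 0 < C ∧ ∀ (δ : ℝ) (n J : ℕ) (I a b : ℤ), 0 < δ → 1 / 2 ≤ δ * 2^J → δ * 2^J ≤ 1 → δ * 2^n ≤ 1/16 →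
    Real.exp (δ * I) < 2^n → 1 ≤ δ * a → a ≤ b → δ * b ≤ δ * I - 1 →
    |ww χ ρ δ I a b 1| ≤ C * (Real.sqrt (Real.exp (δ * I)) * (1 + n)^4 * (1 + J)) := by
  obtain ⟨C, hC, hS⟩ := ww_step h
  refine ⟨C + 4 * c^2, by positivity, ?_⟩
  intro δ n J I a b hδ hJ1 hJ2 hδn hY ha hab hb
  set Y := Real.exp (δ * I) with hYd
  have hY1 : 1 ≤ Y := by
    apply Real.one_le_exp
    have : (a:ℝ) ≤ b := by exact_mod_cast hab
    have : δ * a ≤ δ * b := by gcongr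
    linarith
  have hYp : Y ^ ((1:ℝ)/3) ≤ Real.sqrt Y := by
    rw [Real.sqrt_eq_rpow]; exact Real.rpow_le_rpow_of_exponent_le hY1 (by norm_num)
  have t := tele (fun j => ww χ ρ δ I a b (2^j)) J (C * (Real.sqrt Y * (1 + n)^4)) (by
    intro j hj
    have h2j : (2:ℝ)^j ≤ 2^J := pow_le_pow_right₀ (by norm_num) hj.le
    have := hS δ n (2^j) I a b hδ Nat.one_le_two_pow (by push_cast; nlinarith) hδn hY ha hab hb
    push_cast at this
    simp only [pow_succ']
    refine this.trans ?_
    have h0 : 0 ≤ C * (2^j * (Real.sqrt Y * (1 + n)^4)) := by positivity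
    linarith)
  simp only [pow_zero] at t
  have t2 : |ww χ ρ δ I a b (2^J)| ≤ (b - a) * (2 * c^2 * Y ^ ((1:ℝ)/3)) := by
    unfold ww
    refine (Finset.abs_sum_le_sum_abs _ _).trans ?_
    refine (Finset.sum_le_sum (g := fun _ => 2 * c^2 * Y ^ ((1:ℝ)/3)) (fun i _ => Gr_prod h δ hδ I _ _ _ i (by omega) (by have : (0:ℤ) ≤ 2^J := by positivity
                                                                                                                          omega) (by omega) (by omega))).trans ?_
    rw [Finset.sum_const, nsmul_eq_mul]
    have : (((b - a).toNat : ℕ):ℝ) = b - a := by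
      have : ((b-a).toNat : ℤ) = b - a := Int.toNat_of_nonneg (by omega)
      exact_mod_cast this
    simp [this]
  have hba : (b:ℝ) - a ≤ 2 * n * 2^J := by
    have hl : δ * I < n := by
      have := Real.log_lt_log (Real.exp_pos _) hY
      rw [Real.log_exp, Real.log_pow] at this
      have h2 : Real.log 2 ≤ 1 := by linarith [Real.log_two_lt_d9]
      nlinarith [Nat.cast_nonneg (α := ℝ) n]
    have : δ * (b - a) ≤ n := by linarith
    have hn : (0:ℝ) ≤ n := Nat.cast_nonneg _
    have h1 : δ * (b - a) ≤ δ * (2 * n * 2^J) := by nlinarith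
    exact le_of_mul_le_mul_left h1 hδ
  have t3 : |ww χ ρ δ I a b (2^J)| / 2^J ≤ 4 * c^2 * (Real.sqrt Y * (1+n)^4) := by
    rw [div_le_iff₀ (by positivity)]
    have hn : (n:ℝ) ≤ (1+n)^4 := by
      have hn0 : (0:ℝ) ≤ n := Nat.cast_nonneg _
      calc (n:ℝ) ≤ 1 + n := by linarith
        _ ≤ (1+n)^4 := le_self_pow₀ (by linarith) (by norm_num)
    calc _ ≤ (b - a) * (2 * c^2 * Y ^ ((1:ℝ)/3)) := t2
      _ ≤ (2 * n * 2^J) * (2 * c^2 * Real.sqrt Y) := by gcongr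
      _ ≤ (2 * (1+n)^4 * 2^J) * (2 * c^2 * Real.sqrt Y) := by gcongr
      _ = _ := by ring
  have hP : 0 ≤ Real.sqrt Y * (1+n)^4 := by positivity
  calc _ ≤ _ := t
    _ ≤ 4 * c^2 * (Real.sqrt Y * (1+n)^4) + J * (C * (Real.sqrt Y * (1 + n)^4)) := by linarith
    _ ≤ _ := by
      have hJ : (0:ℝ) ≤ J := Nat.cast_nonneg _
      have : 0 ≤ c^2 * J * (Real.sqrt Y * (1+n)^4) := by positivity
      have : 0 ≤ C * (Real.sqrt Y * (1+n)^4) := by positivity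
      linarith

end C1proof

namespace C1proof
variable {χ : ℕ → ℝ} {q : ℕ} {ρ c : ℝ}

lemma abel (h : CHI χ q ρ c) (φ : ℕ → ℝ) (m n : ℕ) (hmn : m + 1 ≤ n) :
    |∑ l ∈ Finset.Icc (m+1) n, χ l * φ l| ≤ q * (|φ n| + |φ (m+1)| + ∑ l ∈ Finset.Ico (m+1) n, |φ (l+1) - φ l|) := by
  have key : ∑ l ∈ Finset.Icc (m+1) n, χ l * φ l = PP χ n * φ n - PP χ m * φ (m+1) - ∑ l ∈ Finset.Ico (m+1) n, PP χ l * (φ (l+1) - φ l) := by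
    induction n, hmn using Nat.le_induction with
    | base => 
      simp only [Finset.Icc_self, Finset.sum_singleton, Finset.Ico_self, Finset.sum_empty]
      unfold PP; rw [Finset.sum_Icc_succ_top (by omega)]; ring
    | succ n hn ih =>
      rw [Finset.sum_Icc_succ_top (by omega), ih, Finset.sum_Ico_succ_top hn]
      have : PP χ (n+1) = PP χ n + χ (n+1) := by unfold PP; rw [Finset.sum_Icc_succ_top (by omega)]
      rw [this]; ring
  have hq : (0:ℝ) ≤ q := Nat.cast_nonneg _
  rw [key]
  have h1 : |PP χ n * φ n| ≤ q * |φ n| := by rw [abs_mul]; gcongr; exact h.PP_bd n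
  have h2 : |PP χ m * φ (m+1)| ≤ q * |φ (m+1)| := by rw [abs_mul]; gcongr; exact h.PP_bd m
  have h3 : |∑ l ∈ Finset.Ico (m+1) n, PP χ l * (φ (l+1) - φ l)| ≤ q * ∑ l ∈ Finset.Ico (m+1) n, |φ (l+1) - φ l| := by
    refine (Finset.abs_sum_le_sum_abs _ _).trans ?_
    rw [Finset.mul_sum]
    apply Finset.sum_le_sum
    intro l _
    rw [abs_mul]; gcongr; exact h.PP_bd l
  have h4 := abs_sub (PP χ n * φ n - PP χ m * φ (m+1)) (∑ l ∈ Finset.Ico (m+1) n, PP χ l * (φ (l+1) - φ l))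
  have h5 := abs_sub (PP χ n * φ n) (PP χ m * φ (m+1))
  nlinarith

noncomputable def vv (L : ℕ) (y : ℝ) : ℝ := ∑ d ∈ Finset.Icc 1 L, max (y / d - 1) 0
noncomputable def kap : ℝ := Real.eulerMascheroniConstant - 1
noncomputable def ev (L : ℕ) (y : ℝ) : ℝ := vv L y - y * Real.log y - kap * y

lemma harm_gamma (n : ℕ) (hn : 1 ≤ n) (t : ℝ) (h1 : (n:ℝ) ≤ t) (h2 : t < n + 1) :
    |(∑ d ∈ Finset.Icc 1 n, (1:ℝ) / d) - Real.log t - Real.eulerMascheroniConstant| ≤ 2 / t := by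
  have hn0 : (1:ℝ) ≤ n := by exact_mod_cast hn
  have ht : 0 < t := by linarith
  have hH : ((harmonic n : ℚ) : ℝ) = ∑ d ∈ Finset.Icc 1 n, (1:ℝ) / d := by
    rw [harmonic_eq_sum_Icc]; push_cast; simp
  have g1 := Real.eulerMascheroniSeq_lt_eulerMascheroniConstant n
  have g2 := Real.eulerMascheroniConstant_lt_eulerMascheroniSeq' n
  unfold Real.eulerMascheroniSeq at g1
  unfold Real.eulerMascheroniSeq' at g2
  rw [if_neg (by omega)] at g2
  rw [hH] at g1 g2
  have l1 : Real.log n ≤ Real.log t := Real.log_le_log (by linarith) h1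
  have l2 : Real.log t ≤ Real.log (n+1) := Real.log_le_log ht h2.le
  have l3 : Real.log (n+1) - Real.log n ≤ 1 / n := by
    rw [← Real.log_div (by linarith) (by linarith)]
    have := Real.log_le_sub_one_of_pos (x := ((n:ℝ)+1)/n) (by positivity)
    rw [add_div, div_self (by linarith)] at this ⊢
    linarith
  have l4 : 1 / (n:ℝ) ≤ 2 / t := by
    rw [div_le_div_iff₀ (by linarith) ht]; linarith
  rw [abs_le]; constructor <;> linarith

lemma max_deriv (d : ℕ) (hd : 1 ≤ d) (t : ℝ) : HasDerivWithinAt (fun y : ℝ => max (y / d - 1) 0) (if (d:ℝ) ≤ t then 1 / (d:ℝ) else 0) (Set.Ici t) t := by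
  have hd0 : (0:ℝ) < d := by exact_mod_cast hd
  split_ifs with h
  · have : HasDerivWithinAt (fun y : ℝ => y / d - 1) (1 / (d:ℝ)) (Set.Ici t) t := 
      (((hasDerivAt_id t).div_const _).sub_const 1).hasDerivWithinAt
    apply this.congr
    · intro y hy
      have : (d:ℝ) ≤ y := h.trans hy
      apply max_eq_left
      rw [sub_nonneg, le_div_iff₀ hd0]; linarith
    · apply max_eq_left
      rw [sub_nonneg, le_div_iff₀ hd0]; linarith
  · have h := not_le.mp h
    apply HasDerivAt.hasDerivWithinAt
    apply (hasDerivAt_const t (0:ℝ)).congr_of_eventuallyEq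
    filter_upwards [gt_mem_nhds h] with y hy
    apply max_eq_right
    rw [sub_nonpos, div_le_iff₀ hd0]; linarith

lemma ev_lip (L : ℕ) (y' y : ℝ) (h1 : 1 ≤ y') (h2 : y' ≤ y) (h3 : y ≤ L) : |ev L y - ev L y'| ≤ 2 * (Real.log y - Real.log y') := by
  have := image_norm_le_of_norm_deriv_right_le_deriv_boundary' (a := y') (b := y) (f := fun t => ev L t - ev L y')
    (f' := fun t => (∑ d ∈ Finset.Icc 1 L, if (d:ℝ) ≤ t then 1 / (d:ℝ) else 0) - (1 * Real.log t + t * t⁻¹) - kap * 1)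
    (B := fun t => 2 * (Real.log t - Real.log y')) (B' := fun t => 2 * t⁻¹) ?_ ?_ ?_ ?_ ?_ ?_ (x := y) ⟨h2, le_rfl⟩
  · simpa using this
  · unfold ev vv
    apply ContinuousOn.sub _ continuousOn_const
    apply ContinuousOn.sub
    · apply ContinuousOn.sub
      · fun_prop
      · apply continuousOn_id.mul
        apply Real.continuousOn_log.mono
        intro x hx; simp only [Set.mem_compl_iff, Set.mem_singleton_iff]; linarith [hx.1]
    · fun_prop
  · intro t ht
    have ht0 : t ≠ 0 := by linarith [ht.1]
    unfold ev vv
    apply HasDerivWithinAt.sub_const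
    apply HasDerivWithinAt.sub
    · apply HasDerivWithinAt.sub
      · apply HasDerivWithinAt.fun_sum
        intro d hd
        exact max_deriv d (Finset.mem_Icc.mp hd).1 t
      · exact ((hasDerivAt_id t).mul (Real.hasDerivAt_log ht0)).hasDerivWithinAt
    · exact ((hasDerivAt_id t).const_mul kap).hasDerivWithinAt
  · simp
  · apply ContinuousOn.mul continuousOn_const
    apply ContinuousOn.sub _ continuousOn_const
    apply Real.continuousOn_log.mono
    intro x hx; simp only [Set.mem_compl_iff, Set.mem_singleton_iff]; linarith [hx.1]
  · intro t ht
    have ht0 : t ≠ 0 := by linarith [ht.1]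
    exact (((Real.hasDerivAt_log ht0).sub_const _).const_mul 2).hasDerivWithinAt
  · intro t ht
    have ht1 : 1 ≤ t := h1.trans ht.1
    have e : (∑ d ∈ Finset.Icc 1 L, if (d:ℝ) ≤ t then 1 / (d:ℝ) else 0) = ∑ d ∈ Finset.Icc 1 ⌊t⌋₊, (1:ℝ) / d := by
      rw [← Finset.sum_filter]
      apply Finset.sum_congr _ (fun _ _ => rfl)
      ext d
      simp only [Finset.mem_filter, Finset.mem_Icc]
      rw [Nat.le_floor_iff (by linarith)]
      constructor
      · rintro ⟨⟨a, _⟩, b⟩; exact ⟨a, b⟩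
      · rintro ⟨a, b⟩
        refine ⟨⟨a, ?_⟩, b⟩
        have : (d:ℝ) ≤ L := by linarith [ht.2]
        exact_mod_cast this
    have hh := harm_gamma ⌊t⌋₊ (Nat.le_floor (by simpa using ht1)) t (Nat.floor_le (by linarith)) (Nat.lt_floor_add_one t)
    rw [e, Real.norm_eq_abs, mul_inv_cancel₀ (by linarith)]
    unfold kap
    rw [show ∀ a b g : ℝ, a - (1 * b + 1) - (g - 1) * 1 = a - b - g by intros; ring]
    rw [← div_eq_mul_inv]; exact hh

lemma ev_one (L : ℕ) : |ev L 1| ≤ 1 := by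
  have : vv L 1 = 0 := by
    unfold vv
    apply Finset.sum_eq_zero
    intro d hd
    have : (1:ℝ) ≤ d := by exact_mod_cast (Finset.mem_Icc.mp hd).1
    apply max_eq_right
    rw [sub_nonpos, div_le_iff₀ (by linarith)]; linarith
  unfold ev kap
  rw [this, Real.log_one]
  have := Real.one_half_lt_eulerMascheroniConstant
  have := Real.eulerMascheroniConstant_lt_two_thirds
  rw [abs_le]; constructor <;> linarith

lemma ev_bd (L : ℕ) (y : ℝ) (h1 : 1 ≤ y) (h3 : y ≤ L) : |ev L y| ≤ 1 + 2 * Real.log y := by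
  have h := ev_lip L 1 y le_rfl h1 h3
  have := ev_one L
  rw [Real.log_one, sub_zero] at h
  rw [abs_le] at *
  constructor <;> linarith [h.1, h.2]

lemma aa_sum (χ : ℕ → ℝ) (L : ℕ) (F : ℕ → ℝ) (hF : ∀ m, L < m → F m = 0) :
    ∑ m ∈ Finset.Icc 1 L, aa χ m * F m = ∑ l ∈ Finset.Icc 1 L, χ l * ∑ d ∈ Finset.Icc 1 L, F (l * d) := by
  have h1 : ∀ m ∈ Finset.Icc 1 L, aa χ m * F m = ∑ l ∈ Finset.Icc 1 L, ∑ d ∈ Finset.Icc 1 L, if l * d = m then χ l * F m else 0 := by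
    intro m hm
    rw [Finset.mem_Icc] at hm
    unfold aa
    have : m.divisors = (Finset.Icc 1 L).filter (fun l => l ∣ m) := by
      ext l
      simp only [Nat.mem_divisors, Finset.mem_filter, Finset.mem_Icc]
      constructor
      · rintro ⟨a, b⟩
        exact ⟨⟨Nat.pos_of_dvd_of_pos a (by omega), (Nat.le_of_dvd (by omega) a).trans hm.2⟩, a⟩
      · rintro ⟨⟨a, b⟩, c⟩
        exact ⟨c, by omega⟩
    rw [this, Finset.sum_filter, Finset.sum_mul]
    apply Finset.sum_congr rfl
    intro l hl
    rw [Finset.mem_Icc] at hl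
    split_ifs with hlm
    · obtain ⟨d, rfl⟩ := hlm
      rw [Finset.sum_eq_single d]
      · simp
      · intro b _ hb
        rw [if_neg]
        intro hh; exact hb (Nat.eq_of_mul_eq_mul_left (by omega) hh)
      · intro hd
        exfalso; apply hd
        rw [Finset.mem_Icc]
        constructor
        · by_contra h0
          have : d = 0 := by omega
          subst this; simp at hm
        · exact (Nat.le_mul_of_pos_left d (by omega)).trans hm.2
    · rw [zero_mul]; symm
      apply Finset.sum_eq_zero
      intro d _
      rw [if_neg]
      rintro rfl; exact hlm (dvd_mul_right _ _)
  rw [Finset.sum_congr rfl h1, Finset.sum_comm]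
  apply Finset.sum_congr rfl
  intro l hl
  rw [Finset.sum_comm, Finset.mul_sum]
  apply Finset.sum_congr rfl
  intro d hd
  rw [Finset.mem_Icc] at hl hd
  rw [Finset.sum_ite_eq (Finset.Icc 1 L) (l*d) (fun m => χ l * F m)]
  split_ifs with hm
  · rfl
  · rw [hF, mul_zero]
    rw [Finset.mem_Icc] at hm
    have : 1 ≤ l * d := Nat.mul_pos (by omega) (by omega)
    omega

noncomputable def WW (χ : ℕ → ℝ) (L : ℕ) (Y x : ℝ) : ℝ := ∑ m ∈ Finset.Icc 1 L, aa χ m * max (Y / m - x) 0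

lemma WW_eq (χ : ℕ → ℝ) (L : ℕ) (Y x : ℝ) (hY : Y ≤ L) (hx : 1 ≤ x) (hxY : x ≤ Y) :
    WW χ L Y x = Y * (∑ l ∈ Finset.Icc 1 ⌊Y/x⌋₊, χ l / l * (Real.log (Y/x) - Real.log l + kap)) + x * ∑ l ∈ Finset.Icc 1 ⌊Y/x⌋₊, χ l * ev L (Y / x / l) := by
  unfold WW
  have hz1 : 1 ≤ Y / x := by rw [le_div_iff₀ (by linarith)]; linarith
  have hzL : Y / x ≤ L := (div_le_self (by linarith) hx).trans hY
  rw [aa_sum χ L (fun m => max (Y / m - x) 0)]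
  · have h1 : ∀ l ∈ Finset.Icc 1 L, χ l * ∑ d ∈ Finset.Icc 1 L, max (Y / ((l * d : ℕ):ℝ) - x) 0 = χ l * (x * vv L (Y / x / l)) := by
      intro l hl
      congr 1
      unfold vv
      rw [Finset.mul_sum]
      apply Finset.sum_congr rfl
      intro d hd
      rw [mul_max_of_nonneg _ _ (by linarith), mul_zero, mul_sub, mul_one]
      congr 2
      push_cast
      rw [div_div, div_div, mul_div_assoc']
      rw [mul_div_mul_left _ _ (by linarith)]
    rw [Finset.sum_congr rfl h1]
    have hsub : Finset.Icc 1 ⌊Y/x⌋₊ ⊆ Finset.Icc 1 L := by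
      apply Finset.Icc_subset_Icc le_rfl
      exact Nat.floor_le_of_le hzL
    rw [← Finset.sum_subset hsub]
    · rw [Finset.mul_sum, Finset.mul_sum, ← Finset.sum_add_distrib]
      apply Finset.sum_congr rfl
      intro l hl
      have hl0 : (0:ℝ) < l := by exact_mod_cast (Finset.mem_Icc.mp hl).1
      unfold ev
      have hlog : Real.log (Y/x/l) = Real.log (Y/x) - Real.log l := Real.log_div (by linarith) hl0.ne'
      have hx0 : x ≠ 0 := by linarith
      rw [hlog]
      generalize Real.log (Y/x) = A
      generalize Real.log (l:ℝ) = B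
      generalize vv L (Y/x/l) = C
      field_simp
      ring
    · intro l hl hnl
      rw [Finset.mem_Icc] at hl hnl
      have hl0 : (0:ℝ) < l := by exact_mod_cast hl.1
      have hgt : Y / x < l := by
        apply Nat.lt_of_floor_lt; by_contra hh; exact hnl ⟨hl.1, not_lt.mp hh⟩
      have : vv L (Y / x / l) = 0 := by
        unfold vv
        apply Finset.sum_eq_zero
        intro d hd
        have hd1 : (1:ℝ) ≤ d := by exact_mod_cast (Finset.mem_Icc.mp hd).1
        apply max_eq_right
        rw [sub_nonpos, div_le_iff₀ (by linarith), div_le_iff₀ hl0]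
        nlinarith
      rw [this]; ring
  · intro m hm
    have hm' : (L:ℝ) < m := by exact_mod_cast hm
    apply max_eq_right
    have : Y / m ≤ 1 := by rw [div_le_iff₀ (by linarith)]; linarith
    linarith

lemma ev_sum (h : CHI χ q ρ c) (L : ℕ) (z : ℝ) (hz : 1 ≤ z) (hL : z ≤ L) : |∑ l ∈ Finset.Icc 1 ⌊z⌋₊, χ l * ev L (z / l)| ≤ q * (6 * (1 + Real.log z)) := by
  have hlz : 0 ≤ Real.log z := Real.log_nonneg hz
  have hn : 1 ≤ ⌊z⌋₊ := Nat.le_floor (by simpa using hz)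
  have hfl : (⌊z⌋₊:ℝ) ≤ z := Nat.floor_le (by linarith)
  have hb : ∀ l : ℕ, 1 ≤ l → l ≤ ⌊z⌋₊ → 1 ≤ z / l ∧ z / l ≤ z := by
    intro l h1 h2
    have h1' : (1:ℝ) ≤ l := by exact_mod_cast h1
    have h2' : (l:ℝ) ≤ ⌊z⌋₊ := by exact_mod_cast h2
    exact ⟨by rw [le_div_iff₀ (by linarith)]; linarith, div_le_self (by linarith) h1'⟩
  have hab := abel h (fun l => ev L (z / l)) 0 ⌊z⌋₊ (by omega)
  rw [zero_add] at hab
  refine hab.trans ?_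
  have hb2 : ∀ l : ℕ, 1 ≤ l → l ≤ ⌊z⌋₊ → |ev L (z/l)| ≤ 1 + 2 * Real.log z := by
    intro l h1 h2
    obtain ⟨a, b⟩ := hb l h1 h2
    refine (ev_bd L _ a (b.trans hL)).trans ?_
    have := Real.log_le_log (by linarith) b
    linarith
  have t1 := hb2 ⌊z⌋₊ hn le_rfl
  have t2 := hb2 1 le_rfl hn
  have t3 : ∑ l ∈ Finset.Ico 1 ⌊z⌋₊, |ev L (z / (l+1:ℕ)) - ev L (z / l)| ≤ 2 * Real.log z := by
    calc _ ≤ ∑ l ∈ Finset.Ico 1 ⌊z⌋₊, (2 * Real.log ((l+1:ℕ):ℝ) - 2 * Real.log (l:ℝ)) := by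
          apply Finset.sum_le_sum
          intro l hl
          rw [Finset.mem_Ico] at hl
          have hl0 : (0:ℝ) < l := by exact_mod_cast hl.1
          obtain ⟨a, b⟩ := hb (l+1) (by omega) (by omega)
          obtain ⟨a', b'⟩ := hb l (by omega) (by omega)
          rw [abs_sub_comm]
          refine (ev_lip L _ _ a (by push_cast; gcongr; linarith) (b'.trans hL)).trans ?_
          rw [Real.log_div (by linarith) (by linarith), Real.log_div (by linarith) (by positivity)]
          linarith
      _ = 2 * Real.log ⌊z⌋₊ - 2 * Real.log (1:ℕ) := by
          rw [Finset.sum_Ico_sub (fun l : ℕ => 2 * Real.log (l:ℝ)) hn]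
      _ ≤ _ := by
          have := Real.log_le_log (by exact_mod_cast hn) hfl
          simp; linarith
  gcongr
  linarith

lemma WB (h : CHI χ q ρ c) : ∃ C : ℝ, 0 < C ∧ ∀ (L : ℕ) (Y x x' : ℝ), Y ≤ L → 1 ≤ x → x ≤ x' → 3 * x' ≤ Y →
    |WW χ L Y x - WW χ L Y x' - ρ * Y * (Real.log (Y/x) - Real.log (Y/x'))| ≤ C * (x' * (1 + Real.log Y)) := by
  have hc := h.c_nonneg
  have hq : (1:ℝ) ≤ q := by exact_mod_cast h.q_pos
  refine ⟨12 * q + 4 * (1 + 2*q + c) + 4 * q, by positivity, ?_⟩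
  intro L Y x x' hY hx hxx hxY
  rw [WW_eq χ L Y x hY hx (by linarith), WW_eq χ L Y x' hY (by linarith) (by linarith)]
  have hzz : Y / x' ≤ Y / x := by gcongr; linarith
  have hz3 : 3 ≤ Y / x' := by rw [le_div_iff₀ (by linarith)]; linarith
  have hzL : Y / x ≤ L := (div_le_self (by linarith) hx).trans hY
  have e1 := ev_sum h L (Y/x) (by linarith) hzL
  have e2 := ev_sum h L (Y/x') (by linarith) (by linarith)
  have lz : Real.log (Y/x) ≤ Real.log Y := Real.log_le_log (by linarith) (div_le_self (by linarith) hx)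
  have lz' : Real.log (Y/x') ≤ Real.log Y := (Real.log_le_log (by linarith) hzz).trans lz
  have lp : 0 ≤ Real.log (Y/x) := Real.log_nonneg (by linarith)
  have lp' : 0 ≤ Real.log (Y/x') := Real.log_nonneg (by linarith)
  set z := Y / x with hz
  set z' := Y / x' with hz'
  set n := ⌊z⌋₊ with hn
  set n' := ⌊z'⌋₊ with hn'
  have hn3 : 3 ≤ n' := Nat.le_floor (by simpa using hz3)
  have hnn : n' ≤ n := Nat.floor_le_floor hzz
  have hn0 : (3:ℝ) ≤ n' := by exact_mod_cast hn3
  have hnn0 : (n':ℝ) ≤ n := by exact_mod_cast hnn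
  have hnz : z' ≤ 2 * n' := by
    have := Nat.lt_floor_add_one z'
    rw [← hn'] at this; linarith
  have kb : |kap| ≤ 1 := by
    unfold kap
    have := Real.one_half_lt_eulerMascheroniConstant
    have := Real.eulerMascheroniConstant_lt_two_thirds
    rw [abs_le]; constructor <;> linarith
  set S : ℕ → ℝ := fun n => ∑ l ∈ Finset.Icc 1 n, χ l / l with hS
  set P : ℕ → ℝ := fun n => ∑ l ∈ Finset.Icc 1 n, χ l * (Real.log l / l) with hP
  have hM : ∀ (m : ℕ) (t : ℝ), ∑ l ∈ Finset.Icc 1 m, χ l / l * (t - Real.log l + kap) = (t + kap) * S m - P m := by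
    intro m t
    simp only [hS, hP]
    rw [Finset.mul_sum, ← Finset.sum_sub_distrib]
    apply Finset.sum_congr rfl; intro l _; ring
  rw [hM, hM]
  set k0 : ℝ := 1 + 2*q + c with hk0
  have hk0p : 0 ≤ k0 := by positivity
  have s1 : |S n' - ρ| ≤ k0 / n' := h.Lval n' (by omega)
  have s2 : |S n - ρ| ≤ k0 / n' := (h.Lval n (by omega)).trans (by gcongr)
  have p1 : |P n - P n'| ≤ 2 * q * ((1 + Real.log Y) / n') := by
    have hlY : 0 ≤ Real.log Y := by linarith
    rcases hnn.eq_or_lt with he | he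
    · rw [he, sub_self, abs_zero]; positivity
    · have hs : P n - P n' = ∑ l ∈ Finset.Icc (n'+1) n, χ l * (Real.log l / l) := by
        simp only [hP]
        rw [sub_eq_iff_eq_add, add_comm]
        rw [show Finset.Icc 1 n = Finset.Ioc 0 n by rfl, show Finset.Icc 1 n' = Finset.Ioc 0 n' by rfl, show Finset.Icc (n'+1) n = Finset.Ioc n' n by ext; simp [Nat.succ_le_iff]]
        exact (Finset.sum_Ioc_consecutive _ (by omega) (by omega)).symm
      rw [hs]
      have hanti : ∀ a b : ℕ, 3 ≤ a → a ≤ b → Real.log b / b ≤ Real.log a / a := by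
        intro a b h3 hab
        have he : Real.exp 1 ≤ 3 := by linarith [Real.exp_one_lt_d9]
        have h3' : (3:ℝ) ≤ a := by exact_mod_cast h3
        have hab' : (a:ℝ) ≤ b := by exact_mod_cast hab
        exact Real.log_div_self_antitoneOn (Set.mem_Ici.mpr (by linarith)) (Set.mem_Ici.mpr (by linarith)) hab'
      refine (abel h (fun l => Real.log l / l) n' n he).trans ?_
      have v : ∑ l ∈ Finset.Ico (n'+1) n, |Real.log ((l+1:ℕ):ℝ) / ((l+1:ℕ):ℝ) - Real.log l / l| = Real.log ((n'+1:ℕ):ℝ) / ((n'+1:ℕ):ℝ) - Real.log n / n := by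
        rw [← neg_sub (Real.log n / n), ← Finset.sum_Ico_sub (fun l : ℕ => Real.log (l:ℝ) / (l:ℝ)) he, ← Finset.sum_neg_distrib]
        apply Finset.sum_congr rfl
        intro l hl
        rw [Finset.mem_Ico] at hl
        rw [abs_of_nonpos]
        have := hanti l (l+1) (by omega) (by omega)
        linarith
      have a1 : 0 ≤ Real.log (n:ℝ) / n := div_nonneg (Real.log_natCast_nonneg _) (by positivity)
      have a2 : 0 ≤ Real.log ((n'+1:ℕ):ℝ) / ((n'+1:ℕ):ℝ) := div_nonneg (Real.log_natCast_nonneg _) (by positivity)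
      rw [v, abs_of_nonneg a1, abs_of_nonneg a2]
      have a3 : Real.log ((n'+1:ℕ):ℝ) / ((n'+1:ℕ):ℝ) ≤ (1 + Real.log Y) / n' := by
        have : ((n'+1:ℕ):ℝ) ≤ z := by
          have : ((n'+1:ℕ):ℝ) ≤ n := by exact_mod_cast he
          exact this.trans (Nat.floor_le (by linarith))
        have := Real.log_le_log (by positivity) this
        gcongr
        · linarith
        · linarith
      calc _ = 2 * q * (Real.log ((n'+1:ℕ):ℝ) / ((n'+1:ℕ):ℝ)) := by ring
        _ ≤ _ := by gcongr
  have hYn : Y / n' ≤ 2 * x' := by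
    rw [div_le_iff₀ (by linarith)]
    have : Y = z' * x' := (div_mul_cancel₀ Y (by linarith)).symm
    rw [this]; nlinarith
  have hY0 : 0 < Y := by linarith
  have hlY : 0 ≤ Real.log Y := by linarith
  have m1 : |(Real.log z + kap) * (S n - ρ)| ≤ (1 + Real.log Y) * (k0 / n') := by
    rw [abs_mul]
    have : |Real.log z + kap| ≤ 1 + Real.log Y := by
      have := abs_add_le (Real.log z) kap
      rw [abs_of_nonneg lp] at this; linarith
    gcongr
  have m2 : |(Real.log z' + kap) * (S n' - ρ)| ≤ (1 + Real.log Y) * (k0 / n') := by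
    rw [abs_mul]
    have : |Real.log z' + kap| ≤ 1 + Real.log Y := by
      have := abs_add_le (Real.log z') kap
      rw [abs_of_nonneg lp'] at this; linarith
    gcongr
  set E1 := ∑ l ∈ Finset.Icc 1 n, χ l * ev L (z / l)
  set E2 := ∑ l ∈ Finset.Icc 1 n', χ l * ev L (z' / l)
  have id : Y * ((Real.log z + kap) * S n - P n) + x * E1 - (Y * ((Real.log z' + kap) * S n' - P n') + x' * E2) - ρ * Y * (Real.log z - Real.log z')
     = Y * ((Real.log z + kap) * (S n - ρ) - (Real.log z' + kap) * (S n' - ρ) - (P n - P n')) + (x * E1 - x' * E2) := by ring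
  rw [id]
  have b1 : |Y * ((Real.log z + kap) * (S n - ρ) - (Real.log z' + kap) * (S n' - ρ) - (P n - P n'))| ≤ Y * (2 * (1 + Real.log Y) * (k0 / n') + 2 * q * ((1 + Real.log Y) / n')) := by
    rw [abs_mul, abs_of_pos hY0]
    gcongr
    have := abs_sub ((Real.log z + kap) * (S n - ρ) - (Real.log z' + kap) * (S n' - ρ)) (P n - P n')
    have := abs_sub ((Real.log z + kap) * (S n - ρ)) ((Real.log z' + kap) * (S n' - ρ))
    linarith
  have hx'0 : 0 ≤ x' := by linarith
  have b2 : |x * E1 - x' * E2| ≤ 2 * (x' * (q * (6 * (1 + Real.log Y)))) := by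
    have c1 : |x * E1| ≤ x' * (q * (6 * (1 + Real.log Y))) := by
      rw [abs_mul, abs_of_nonneg (by linarith)]
      gcongr
      exact e1.trans (by gcongr)
    have c2 : |x' * E2| ≤ x' * (q * (6 * (1 + Real.log Y))) := by
      rw [abs_mul, abs_of_nonneg (by linarith)]
      gcongr
      exact e2.trans (by gcongr)
    have := abs_sub (x * E1) (x' * E2)
    linarith
  have b3 : Y * (2 * (1 + Real.log Y) * (k0 / n') + 2 * q * ((1 + Real.log Y) / n')) ≤ (2 * k0 + 2 * q) * (1 + Real.log Y) * (2 * x') := by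
    calc _ = (2 * k0 + 2 * q) * (1 + Real.log Y) * (Y / n') := by ring
      _ ≤ _ := by gcongr
  refine (abs_add_le _ _).trans ?_
  linarith

end C1proof

namespace C1proof
variable {χ : ℕ → ℝ} {q : ℕ} {ρ c : ℝ}

lemma tele_int (g : ℤ → ℝ) (a b : ℤ) (hab : a ≤ b) : ∑ i ∈ Finset.Ico a b, (g i - g (i-1)) = g (b-1) - g (a-1) := by
  induction b, hab using Int.leInduction with
  | base => simp
  | succ b hb ih =>
    rw [← Finset.insert_Ico_right_eq_Ico_add_one hb, Finset.sum_insert (by simp), ih]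
    simp

lemma cell (ρ : ℝ) (χ : ℕ → ℝ) (N k : ℕ) (δ x' x Y : ℝ) (hY : Y = N + 1/2) (hδ : 0 < δ) (hδN : 2 * (δ * N) ≤ 1/2)
    (hx' : x' < k) (hk : k ≤ x) (hk1 : 1 ≤ k) (hx : x ≤ x' * (1 + 2 * δ)) :
    |Dl χ ρ (Y / x) - Dl χ ρ (Y / k)| ≤ 2 * |ρ| * Y * δ := by
  have hk1' : (1:ℝ) ≤ k := by exact_mod_cast hk1
  have hx1 : 1 ≤ x := hk1'.trans hk
  have hxk : x ≤ k * (1 + 2 * δ) := hx.trans (by gcongr)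
  have hY0 : 0 < Y := by rw [hY]; positivity
  have hfl : ⌊Y / x⌋₊ = ⌊Y / k⌋₊ := by
    apply le_antisymm
    · apply Nat.floor_le_floor; gcongr
    · apply Nat.le_floor
      rw [le_div_iff₀ (by linarith)]
      set j := ⌊Y / k⌋₊ with hj
      have h1 : (j:ℝ) * k ≤ Y := by
        rw [← le_div_iff₀ (by linarith)]; exact Nat.floor_le (by positivity)
      have h2 : j * k ≤ N := by
        have : ((j * k : ℕ):ℝ) < (N + 1 : ℕ) := by push_cast; linarith
        have : j * k < N + 1 := by exact_mod_cast this
        omega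
      have h2' : (j:ℝ) * k ≤ N := by exact_mod_cast h2
      calc (j:ℝ) * x ≤ j * (k * (1 + 2 * δ)) := by gcongr
        _ = (j * k) * (1 + 2 * δ) := by ring
        _ ≤ N * (1 + 2 * δ) := by gcongr
        _ ≤ Y := by rw [hY]; linarith
  unfold Dl
  rw [hfl]
  have : AA χ ⌊Y / k⌋₊ - ρ * (Y / x) - (AA χ ⌊Y / k⌋₊ - ρ * (Y / k)) = ρ * (Y / k - Y / x) := by ring
  rw [this, abs_mul]
  have h0 : 0 ≤ Y / k - Y / x := by rw [sub_nonneg]; gcongr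
  rw [abs_of_nonneg h0]
  have : Y / k - Y / x ≤ 2 * Y * δ := by
    have : Y / k - Y / x = Y * ((x - k) / (k * x)) := by field_simp
    rw [this]
    have : (x - k) / (k * x) ≤ 2 * δ := by
      rw [div_le_iff₀ (by positivity)]
      have : (k:ℝ) * 1 ≤ k * x := by gcongr
      nlinarith
    nlinarith
  calc _ ≤ |ρ| * (2 * Y * δ) := by gcongr
    _ = _ := by ring

lemma T_ww (h : CHI χ q ρ c) (N : ℕ) (δ Y : ℝ) (I a b : ℤ) (hY : Y = N + 1/2) (hδ : 0 < δ) (hδ1 : δ ≤ 1) (hδN : 2 * (δ * N) ≤ 1/2)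
    (hI : Real.exp (δ * I) = Y) (hab : a ≤ b) :
    |∑ k ∈ Finset.Ioc ⌊Real.exp (δ * (a-1:ℤ))⌋₊ ⌊Real.exp (δ * (b-1:ℤ))⌋₊, aa χ k * Dl χ ρ (Y / k)
      - (ww χ ρ δ I a b 1 + ρ * ∑ i ∈ Finset.Ico a b, Gr χ ρ δ (I - i) * (Real.exp (δ * i) - Real.exp (δ * (i-1:ℤ))))|
      ≤ 2 * |ρ| * Y * δ * AA χ ⌊Real.exp (δ * (b-1:ℤ))⌋₊ := by
  set X : ℤ → ℝ := fun i => Real.exp (δ * i) with hX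
  have hmono : ∀ i j : ℤ, i ≤ j → X i ≤ X j := by
    intro i j hij
    have : (i:ℝ) ≤ j := by exact_mod_cast hij
    apply Real.exp_le_exp.mpr; gcongr
  have hstep : ∀ i : ℤ, X i ≤ X (i-1) * (1 + 2 * δ) := by
    intro i
    have : X i = X (i-1) * Real.exp δ := by
      simp only [hX]; rw [← Real.exp_add]; congr 1; push_cast; ring
    rw [this]
    have := exp_sub_one_le δ hδ.le hδ1
    have : 0 < X (i-1) := Real.exp_pos _
    gcongr
  have hsplit : ∀ g : ℕ → ℝ, ∑ k ∈ Finset.Ioc ⌊X (a-1)⌋₊ ⌊X (b-1)⌋₊, g k = ∑ i ∈ Finset.Ico a b, ∑ k ∈ Finset.Ioc ⌊X (i-1)⌋₊ ⌊X i⌋₊, g k := by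
    intro g
    rw [PP_sub g (Nat.floor_le_floor (hmono _ _ (by omega))), ← tele_int (fun i => PP g ⌊X i⌋₊) a b hab]
    apply Finset.sum_congr rfl
    intro i _
    rw [PP_sub g (Nat.floor_le_floor (hmono _ _ (by omega)))]
  have hGr : ∀ i : ℤ, Gr χ ρ δ (I - i) = Dl χ ρ (Y / X i) := by
    intro i
    unfold Gr
    rw [← hI, ← Real.exp_sub]; congr 2; push_cast; ring
  have hw : ww χ ρ δ I a b 1 + ρ * ∑ i ∈ Finset.Ico a b, Gr χ ρ δ (I - i) * (X i - X (i-1))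
      = ∑ i ∈ Finset.Ico a b, ∑ k ∈ Finset.Ioc ⌊X (i-1)⌋₊ ⌊X i⌋₊, aa χ k * Dl χ ρ (Y / X i) := by
    unfold ww
    rw [Finset.mul_sum, ← Finset.sum_add_distrib]
    apply Finset.sum_congr rfl
    intro i _
    rw [← Finset.sum_mul, AA_sub χ (Nat.floor_le_floor (hmono _ _ (by omega))), hGr]
    have e1 : Gr χ ρ δ i = AA χ ⌊X i⌋₊ - ρ * X i := rfl
    have e2 : Gr χ ρ δ (i-1) = AA χ ⌊X (i-1)⌋₊ - ρ * X (i-1) := rfl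
    rw [e1, e2]; ring
  change |∑ k ∈ Finset.Ioc ⌊X (a-1)⌋₊ ⌊X (b-1)⌋₊, aa χ k * Dl χ ρ (Y / k) - (ww χ ρ δ I a b 1 + ρ * ∑ i ∈ Finset.Ico a b, Gr χ ρ δ (I - i) * (X i - X (i-1)))| ≤ 2 * |ρ| * Y * δ * AA χ ⌊X (b-1)⌋₊
  rw [hw, hsplit, ← Finset.sum_sub_distrib]
  have hY0 : 0 < Y := by rw [hY]; positivity
  calc _ ≤ ∑ i ∈ Finset.Ico a b, ∑ k ∈ Finset.Ioc ⌊X (i-1)⌋₊ ⌊X i⌋₊, aa χ k * (2 * |ρ| * Y * δ) := by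
        refine (Finset.abs_sum_le_sum_abs _ _).trans ?_
        apply Finset.sum_le_sum
        intro i _
        rw [← Finset.sum_sub_distrib]
        refine (Finset.abs_sum_le_sum_abs _ _).trans ?_
        apply Finset.sum_le_sum
        intro k hk
        rw [Finset.mem_Ioc] at hk
        rw [← mul_sub, abs_mul, abs_of_nonneg (h.nonneg k), abs_sub_comm]
        apply mul_le_mul_of_nonneg_left _ (h.nonneg k)
        apply cell ρ χ N k δ (X (i-1)) (X i) Y hY hδ hδN (Nat.lt_of_floor_lt hk.1) _ (by omega) (hstep i)
        exact (Nat.le_floor_iff (Real.exp_pos _).le).mp hk.2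
    _ = 2 * |ρ| * Y * δ * ∑ k ∈ Finset.Ioc ⌊X (a-1)⌋₊ ⌊X (b-1)⌋₊, aa χ k := by
        rw [← hsplit (fun k => aa χ k * (2 * |ρ| * Y * δ)), ← Finset.sum_mul, mul_comm]
    _ ≤ _ := by
        apply mul_le_mul_of_nonneg_left _ (by positivity)
        apply Finset.sum_le_sum_of_subset_of_nonneg
        · intro k hk; rw [Finset.mem_Ioc] at hk; rw [Finset.mem_Icc]; omega
        · intro k _ _; exact h.nonneg k

lemma WW_cell (h : CHI χ q ρ c) (L : ℕ) (Y x' x : ℝ) (hL : Y ≤ L) (hY0 : 0 < Y) (hx' : 1 ≤ x') (hx : x' ≤ x) :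
    0 ≤ WW χ L Y x' - WW χ L Y x - AA χ ⌊Y / x⌋₊ * (x - x') ∧ 
    WW χ L Y x' - WW χ L Y x - AA χ ⌊Y / x⌋₊ * (x - x') ≤ (x - x') * (AA χ ⌊Y / x'⌋₊ - AA χ ⌊Y / x⌋₊) := by
  have hA : ∀ z, 1 ≤ z → AA χ ⌊Y / z⌋₊ = ∑ m ∈ Finset.Icc 1 L, aa χ m * (if z ≤ Y / m then 1 else 0) := by
    intro z hz
    unfold AA
    simp only [mul_ite, mul_one, mul_zero]
    rw [← Finset.sum_filter]
    apply Finset.sum_congr _ (fun _ _ => rfl)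
    ext m
    simp only [Finset.mem_filter, Finset.mem_Icc]
    rw [Nat.le_floor_iff (by positivity)]
    constructor
    · rintro ⟨u, v⟩
      have hm : (1:ℝ) ≤ m := by exact_mod_cast u
      refine ⟨⟨u, ?_⟩, ?_⟩
      · have : (m:ℝ) ≤ L := v.trans ((div_le_self hY0.le hz).trans hL)
        exact_mod_cast this
      · rw [le_div_iff₀ (by linarith)] at v ⊢; linarith
    · rintro ⟨⟨u, _⟩, v⟩
      have hm : (1:ℝ) ≤ m := by exact_mod_cast u
      refine ⟨u, ?_⟩
      rw [le_div_iff₀ (by linarith)] at v ⊢; linarith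
  have hcore : ∀ t : ℝ, 0 ≤ max (t - x') 0 - max (t - x) 0 - (if x ≤ t then 1 else 0) * (x - x') ∧ 
      max (t - x') 0 - max (t - x) 0 - (if x ≤ t then 1 else 0) * (x - x') ≤ (x - x') * ((if x' ≤ t then 1 else 0) - (if x ≤ t then 1 else 0)) := by
    intro t
    rcases le_total x t with h1 | h1
    · rw [max_eq_left (by linarith), max_eq_left (by linarith), if_pos h1, if_pos (by linarith)]
      constructor <;> linarith
    · rcases le_or_gt x' t with h2 | h2
      · rw [max_eq_left (by linarith), max_eq_right (by linarith), if_pos h2]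
        split_ifs <;> constructor <;> linarith
      · rw [max_eq_right (by linarith), max_eq_right (by linarith), if_neg (by linarith), if_neg (by linarith)]
        constructor <;> linarith
  rw [hA x (by linarith), hA x' hx']
  have e1 : WW χ L Y x' - WW χ L Y x - (∑ m ∈ Finset.Icc 1 L, aa χ m * (if x ≤ Y / m then 1 else 0)) * (x - x')
     = ∑ m ∈ Finset.Icc 1 L, aa χ m * (max (Y / m - x') 0 - max (Y / m - x) 0 - (if x ≤ Y / m then 1 else 0) * (x - x')) := by
    unfold WW
    rw [Finset.sum_mul, ← Finset.sum_sub_distrib, ← Finset.sum_sub_distrib]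
    apply Finset.sum_congr rfl; intro m _; ring
  rw [e1]
  constructor
  · apply Finset.sum_nonneg
    intro m _
    exact mul_nonneg (h.nonneg m) (hcore _).1
  · rw [← Finset.sum_sub_distrib, Finset.mul_sum]
    apply Finset.sum_le_sum
    intro m _
    calc _ ≤ aa χ m * ((x - x') * ((if x' ≤ Y / m then 1 else 0) - (if x ≤ Y / m then 1 else 0))) := mul_le_mul_of_nonneg_left (hcore _).2 (h.nonneg m)
      _ = _ := by ring

lemma AA_mono (h : CHI χ q ρ c) {m n : ℕ} (hmn : m ≤ n) : AA χ m ≤ AA χ n := by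
  unfold AA
  apply Finset.sum_le_sum_of_subset_of_nonneg (Finset.Icc_subset_Icc le_rfl hmn)
  intro k _ _; exact h.nonneg k

lemma AA_nonneg (h : CHI χ q ρ c) (n : ℕ) : 0 ≤ AA χ n := Finset.sum_nonneg fun k _ => h.nonneg k

lemma AA_bd (h : CHI χ q ρ c) (Y : ℝ) (hY : 1 ≤ Y) : AA χ ⌊Y⌋₊ ≤ (|ρ| + c) * Y := by
  have h1 := h.land Y (by linarith)
  have h2 : Y ^ ((1:ℝ)/3) ≤ Y := by
    conv_rhs => rw [← Real.rpow_one Y]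
    exact Real.rpow_le_rpow_of_exponent_le hY (by norm_num)
  have h3 : c * Y ^ ((1:ℝ)/3) ≤ c * Y := mul_le_mul_of_nonneg_left h2 h.c_nonneg
  have h4 : ρ * Y ≤ |ρ| * Y := mul_le_mul_of_nonneg_right (le_abs_self ρ) (by linarith)
  have := (abs_le.mp h1).2
  linarith

lemma S_bd (h : CHI χ q ρ c) : ∃ C : ℝ, 0 < C ∧ ∀ (δ Y : ℝ) (I a b : ℤ), 0 < δ → δ ≤ 1 → 1 ≤ Y → δ * Y^2 ≤ 1 → 
    Real.exp (δ * I) = Y → 1 ≤ δ * a → a ≤ b → δ * b ≤ δ * I - 1 → 3 * Real.exp (δ * (b-1:ℤ)) ≤ Y →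
    |∑ i ∈ Finset.Ico a b, Gr χ ρ δ (I - i) * (Real.exp (δ * i) - Real.exp (δ * (i-1:ℤ)))| ≤ C * (Real.exp (δ * (b-1:ℤ)) * (1 + Real.log Y)) := by
  obtain ⟨C, hC, hW⟩ := WB h
  have hc := h.c_nonneg
  refine ⟨C + 2 * (|ρ| + c) + |ρ|, by positivity, ?_⟩
  intro δ Y I a b hδ hδ1 hY1 hδY hI ha hab hb h3
  set X : ℤ → ℝ := fun i => Real.exp (δ * i) with hX
  change |∑ i ∈ Finset.Ico a b, Gr χ ρ δ (I - i) * (X i - X (i-1))| ≤ _ * (X (b-1) * (1 + Real.log Y))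
  have hab' : (a:ℝ) ≤ b := by exact_mod_cast hab
  have hmono : ∀ i j : ℤ, i ≤ j → X i ≤ X j := by
    intro i j hij
    have : (i:ℝ) ≤ j := by exact_mod_cast hij
    apply Real.exp_le_exp.mpr; gcongr
  have hXp : ∀ i, 0 < X i := fun i => Real.exp_pos _
  have hst : ∀ i : ℤ, X i = X (i-1) * Real.exp δ := by
    intro i
    simp only [hX]; rw [← Real.exp_add]; congr 1; push_cast; ring
  have hX1 : ∀ i : ℤ, a - 1 ≤ i → 1 ≤ X i := by
    intro i hi
    apply Real.one_le_exp
    have : (a:ℝ) - 1 ≤ i := by exact_mod_cast hi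
    nlinarith
  have hlogY : Real.log Y = δ * I := by rw [← hI, Real.log_exp]
  have hXY : ∀ i : ℤ, i ≤ b → X i ≤ Y := by
    intro i hi
    have : (i:ℝ) ≤ b := by exact_mod_cast hi
    rw [← hI]
    apply Real.exp_le_exp.mpr; nlinarith
  have hGr : ∀ i : ℤ, Gr χ ρ δ (I - i) = Dl χ ρ (Y / X i) := by
    intro i
    unfold Gr
    rw [← hI, ← Real.exp_sub]; congr 2; push_cast; ring
  set L := ⌈Y⌉₊ with hL
  have hYL : Y ≤ L := Nat.le_ceil Y
  have hWB := hW L Y (X (a-1)) (X (b-1)) hYL (hX1 _ le_rfl) (hmono _ _ (by omega)) h3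
  have hlogs : Real.log (Y / X (a-1)) - Real.log (Y / X (b-1)) = δ * (b - a) := by
    rw [Real.log_div (by linarith) (hXp _).ne', Real.log_div (by linarith) (hXp _).ne']
    simp only [hX]
    rw [Real.log_exp, Real.log_exp]; push_cast; ring
  rw [hlogs] at hWB
  set E : ℤ → ℝ := fun i => WW χ L Y (X (i-1)) - WW χ L Y (X i) - AA χ ⌊Y / X i⌋₊ * (X i - X (i-1)) with hE
  have hcellE : ∀ i ∈ Finset.Ico a b, 0 ≤ E i ∧ E i ≤ 2 * δ * Y * (AA χ ⌊Y / X (i-1)⌋₊ - AA χ ⌊Y / X i⌋₊) := by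
    intro i hi
    rw [Finset.mem_Ico] at hi
    have hh := WW_cell h L Y (X (i-1)) (X i) hYL (by linarith) (hX1 _ (by omega)) (hmono _ _ (by omega))
    refine ⟨hh.1, hh.2.trans ?_⟩
    apply mul_le_mul_of_nonneg_right
    · rw [hst i]
      have := exp_sub_one_le δ hδ.le hδ1
      have h5 := hXY (i-1) (by omega)
      have h6 := hXp (i-1)
      nlinarith
    · rw [sub_nonneg]; apply AA_mono h; apply Nat.floor_le_floor
      have := hXp (i-1)
      have := hmono (i-1) i (by omega)
      gcongr
  have hEs : |∑ i ∈ Finset.Ico a b, E i| ≤ 2 * δ * Y * ((|ρ| + c) * Y) := by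
    rw [abs_of_nonneg (Finset.sum_nonneg fun i hi => (hcellE i hi).1)]
    refine (Finset.sum_le_sum fun i hi => (hcellE i hi).2).trans ?_
    rw [← Finset.mul_sum]
    apply mul_le_mul_of_nonneg_left _ (by positivity)
    have := tele_int (fun i => - AA χ ⌊Y / X i⌋₊) a b hab
    have e : ∑ i ∈ Finset.Ico a b, (AA χ ⌊Y / X (i-1)⌋₊ - AA χ ⌊Y / X i⌋₊) = ∑ i ∈ Finset.Ico a b, (- AA χ ⌊Y / X i⌋₊ - - AA χ ⌊Y / X (i-1)⌋₊) := by
      apply Finset.sum_congr rfl; intro i _; ring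
    rw [e, this]
    have u1 := AA_nonneg h ⌊Y / X (b-1)⌋₊
    have u2 : AA χ ⌊Y / X (a-1)⌋₊ ≤ AA χ ⌊Y⌋₊ := AA_mono h (Nat.floor_le_floor (div_le_self (by linarith) (hX1 _ le_rfl)))
    have u3 := AA_bd h Y hY1
    linarith
  have hmain : ∑ i ∈ Finset.Ico a b, Gr χ ρ δ (I - i) * (X i - X (i-1)) = 
      (WW χ L Y (X (a-1)) - WW χ L Y (X (b-1)) - ρ * Y * (δ * (b - a))) - ∑ i ∈ Finset.Ico a b, E i + ρ * Y * (b - a) * (δ - (1 - Real.exp (-δ))) := by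
    have t := tele_int (fun i => - WW χ L Y (X i)) a b hab
    have e0 : ∀ i ∈ Finset.Ico a b, Gr χ ρ δ (I - i) * (X i - X (i-1)) = (- WW χ L Y (X i) - - WW χ L Y (X (i-1))) - E i - ρ * Y * (1 - Real.exp (-δ)) := by
      intro i _
      rw [hGr]
      simp only [hE]
      unfold Dl
      have : X (i-1) = X i * Real.exp (-δ) := by
        rw [hst i, mul_assoc, ← Real.exp_add]; simp
      have : ρ * (Y / X i) * (X i - X (i-1)) = ρ * Y * (1 - Real.exp (-δ)) := by
        rw [this]; have := (hXp i).ne'; field_simp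
      rw [← this]; ring
    rw [Finset.sum_congr rfl e0, Finset.sum_sub_distrib, Finset.sum_sub_distrib, t, Finset.sum_const, Int.card_Ico, nsmul_eq_mul]
    have : (((b - a).toNat : ℕ) : ℝ) = b - a := by
      have : (((b - a).toNat : ℤ)) = b - a := Int.toNat_of_nonneg (by omega)
      exact_mod_cast this
    rw [this]; ring
  have hexp : |δ - (1 - Real.exp (-δ))| ≤ δ^2 := by
    have := Real.abs_exp_sub_one_sub_id_le (x := -δ) (by rw [abs_neg, abs_of_pos hδ]; exact hδ1)
    rw [neg_sq] at this
    rwa [show δ - (1 - Real.exp (-δ)) = Real.exp (-δ) - 1 - -δ by ring]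
  have hlast : |ρ * Y * (b - a) * (δ - (1 - Real.exp (-δ)))| ≤ |ρ| * 1 := by
    rw [abs_mul, abs_mul, abs_mul, abs_of_pos (show 0 < Y by linarith), abs_of_nonneg (show (0:ℝ) ≤ b - a by linarith)]
    have h1 : δ * (b - a) ≤ Y := by
      have := Real.log_le_self (show 0 ≤ Y by linarith)
      nlinarith
    calc _ ≤ |ρ| * Y * (b - a) * δ^2 := by
            have : (0:ℝ) ≤ b - a := by linarith
            gcongr
      _ = |ρ| * (Y * δ * (δ * (b - a))) := by ring
      _ ≤ |ρ| * (Y * δ * Y) := by gcongr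
      _ ≤ _ := by
          apply mul_le_mul_of_nonneg_left _ (abs_nonneg _)
          calc Y * δ * Y = δ * Y^2 := by ring
            _ ≤ 1 := hδY
  have hlY : 0 ≤ Real.log Y := Real.log_nonneg hY1
  have hB : 1 ≤ X (b-1) * (1 + Real.log Y) := by
    have := hX1 (b-1) (by omega)
    nlinarith
  rw [hmain]
  have hEs' : |∑ i ∈ Finset.Ico a b, E i| ≤ 2 * (|ρ| + c) * 1 := hEs.trans (by
    calc _ = 2 * (|ρ| + c) * (δ * Y^2) := by ring
      _ ≤ _ := by gcongr)
  have n1 := abs_add_le (WW χ L Y (X (a-1)) - WW χ L Y (X (b-1)) - ρ * Y * (δ * (b - a)) - ∑ i ∈ Finset.Ico a b, E i) (ρ * Y * (b - a) * (δ - (1 - Real.exp (-δ))))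
  have n2 := abs_sub (WW χ L Y (X (a-1)) - WW χ L Y (X (b-1)) - ρ * Y * (δ * (b - a))) (∑ i ∈ Finset.Ico a b, E i)
  have n3 : (2 * (|ρ| + c) + |ρ|) * 1 ≤ (2 * (|ρ| + c) + |ρ|) * (X (b-1) * (1 + Real.log Y)) := by gcongr
  linarith

end C1proof

namespace C1proof
variable {χ : ℕ → ℝ} {q : ℕ} {ρ c : ℝ}

lemma T_small (h : CHI χ q ρ c) (r N : ℕ) (hr : r ≤ 2) (hN : 1 ≤ N) : 
    |∑ k ∈ Finset.Ioc 0 r, aa χ k * Dl χ ρ ((N + 1/2) / k)| ≤ 6 * c * Real.sqrt N := by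
  have hc := h.c_nonneg
  have hN1 : (1:ℝ) ≤ N := by exact_mod_cast hN
  have hb : ∀ k : ℕ, 1 ≤ k → |Dl χ ρ ((N + 1/2) / k)| ≤ 2 * c * Real.sqrt N := by
    intro k hk
    have hk' : (1:ℝ) ≤ k := by exact_mod_cast hk
    have hp : 0 < ((N:ℝ) + 1/2) / k := by positivity
    refine (h.land _ hp).trans ?_
    have h1 : (((N:ℝ) + 1/2) / k) ^ ((1:ℝ)/3) ≤ (2 * (N:ℝ)) ^ ((1:ℝ)/3) := by
      apply Real.rpow_le_rpow hp.le _ (by norm_num)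
      exact (div_le_self (by positivity) hk').trans (by linarith)
    have h2 : (2 * (N:ℝ)) ^ ((1:ℝ)/3) ≤ (2 * (N:ℝ)) ^ ((1:ℝ)/2) := Real.rpow_le_rpow_of_exponent_le (by linarith) (by norm_num)
    rw [← Real.sqrt_eq_rpow, Real.sqrt_mul (by norm_num)] at h2
    have h3 : Real.sqrt 2 ≤ 2 := by rw [Real.sqrt_le_left (by norm_num)]; norm_num
    have h4 : Real.sqrt 2 * Real.sqrt N ≤ 2 * Real.sqrt N := by gcongr
    calc _ ≤ c * (2 * Real.sqrt N) := by gcongr; linarith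
      _ = _ := by ring
  have ha1 : aa χ 1 ≤ 1 := by
    unfold aa; simp; exact (abs_le.mp (h.bd 1)).2
  have ha2 : aa χ 2 ≤ 2 := by
    unfold aa
    rw [show Nat.divisors 2 = {1, 2} from Nat.Prime.divisors Nat.prime_two, Finset.sum_pair (by norm_num)]
    linarith [(abs_le.mp (h.bd 1)).2, (abs_le.mp (h.bd 2)).2]
  have hB : 0 ≤ 2 * c * Real.sqrt N := by positivity
  have hm : ∀ k : ℕ, 1 ≤ k → |aa χ k * Dl χ ρ ((N + 1/2) / k)| ≤ aa χ k * (2 * c * Real.sqrt N) := by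
    intro k hk
    rw [abs_mul, abs_of_nonneg (h.nonneg k)]
    exact mul_le_mul_of_nonneg_left (hb k hk) (h.nonneg k)
  refine (Finset.abs_sum_le_sum_abs _ _).trans ?_
  calc _ ≤ ∑ k ∈ Finset.Ioc 0 2, aa χ k * (2 * c * Real.sqrt N) := by
        refine (Finset.sum_le_sum (fun k hk => hm k (Finset.mem_Ioc.mp hk).1)).trans ?_
        apply Finset.sum_le_sum_of_subset_of_nonneg (Finset.Ioc_subset_Ioc le_rfl hr)
        intro k _ _; exact mul_nonneg (h.nonneg k) hB
    _ = aa χ 1 * (2 * c * Real.sqrt N) + aa χ 2 * (2 * c * Real.sqrt N) := by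
        rw [show Finset.Ioc 0 2 = {1, 2} by decide, Finset.sum_pair (by norm_num)]
    _ ≤ 1 * (2 * c * Real.sqrt N) + 2 * (2 * c * Real.sqrt N) := by gcongr
    _ = _ := by ring

set_option maxHeartbeats 1600000 in
lemma T_bd (h : CHI χ q ρ c) : ∃ C : ℝ, 0 < C ∧ ∀ N D : ℕ, 1 ≤ N → D^2 ≤ N → 
    |∑ k ∈ Finset.Ioc 0 D, aa χ k * Dl χ ρ ((N + 1/2) / k)| ≤ C * (Real.sqrt N * (1 + Real.log N)^5) := by
  obtain ⟨Cw, hCw, hw⟩ := ww_one h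
  obtain ⟨Cs, hCs, hs⟩ := S_bd h
  have hc := h.c_nonneg
  refine ⟨6 * c + 2 * |ρ| * (|ρ| + c) * 1 + Cw * (2 * 2^4 * 8) + |ρ| * (Cs * 4), by positivity, ?_⟩
  intro N D hN hDN
  have hN1 : (1:ℝ) ≤ N := by exact_mod_cast hN
  have hlN : 0 ≤ Real.log N := Real.log_nonneg hN1
  have hsq : 1 ≤ Real.sqrt N := by rw [Real.one_le_sqrt]; exact hN1
  have hl5 : 1 ≤ (1 + Real.log N)^5 := one_le_pow₀ (by linarith)
  have hfin : Real.sqrt N ≤ Real.sqrt N * (1 + Real.log N)^5 := le_mul_of_one_le_right (by linarith) hl5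
  rcases Nat.lt_or_ge D 3 with hD | hD
  · refine (T_small h D N (by omega) hN).trans ?_
    have : 0 ≤ 2 * |ρ| * (|ρ| + c) * 1 + Cw * (2 * 2^4 * 8) + |ρ| * (Cs * 4) := by positivity
    have : 0 ≤ Real.sqrt N * (1 + Real.log N)^5 := by positivity
    nlinarith
  have hN9 : 9 ≤ N := by nlinarith
  have hD3 : (3:ℝ) ≤ D := by exact_mod_cast hD
  have hDN' : (D:ℝ)^2 ≤ N := by exact_mod_cast hDN
  have hN9' : (9:ℝ) ≤ N := by exact_mod_cast hN9
  set Y : ℝ := N + 1/2 with hY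
  have hY1 : 1 ≤ Y := by linarith
  set n : ℕ := Nat.log 2 N + 1 with hn
  have h2n : N < 2^n := Nat.lt_pow_succ_log_self (by norm_num) N
  have h2n' : Y < 2^n := by
    have : (N:ℝ) + 1 ≤ 2^n := by exact_mod_cast h2n
    linarith
  have hn4 : 4 ≤ n := by
    by_contra hh
    have : n ≤ 3 := by omega
    have : 2^n ≤ 2^3 := Nat.pow_le_pow_right (by norm_num) this
    omega
  have hnlog : (n:ℝ) ≤ 1 + 2 * Real.log N := by
    have h1 : 2^(Nat.log 2 N) ≤ N := Nat.pow_log_le_self 2 (by omega)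
    have h2 : (2:ℝ)^(Nat.log 2 N) ≤ N := by exact_mod_cast h1
    have h3 := Real.log_le_log (by positivity) h2
    rw [Real.log_pow] at h3
    have h4 := Real.log_two_gt_d9
    have h5 : (0:ℝ) ≤ Nat.log 2 N := by positivity
    rw [hn]; push_cast
    nlinarith
  set J : ℕ := 2 * n + 4 with hJ
  have hlY1 : 1 ≤ Real.log Y := by
    rw [Real.le_log_iff_exp_le (by linarith)]
    linarith [Real.exp_one_lt_d9]
  set L0 := ⌈Real.log Y⌉₊ with hL0
  have hL0a : Real.log Y ≤ L0 := Nat.le_ceil _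
  have hL0b : (L0:ℝ) < Real.log Y + 1 := Nat.ceil_lt_add_one (by linarith)
  have hL0p : (0:ℝ) < L0 := by linarith
  set I : ℤ := 2^J * (L0:ℤ) with hI
  have hIr : (I:ℝ) = 2^J * L0 := by rw [hI]; push_cast; ring
  set δ : ℝ := Real.log Y / I with hδ
  have hIp : (0:ℝ) < I := by rw [hIr]; positivity
  have hδ0 : 0 < δ := by rw [hδ]; apply div_pos (by linarith) hIp
  have hδI : δ * I = Real.log Y := div_mul_cancel₀ _ hIp.ne'
  have hδJ : δ * 2^J = Real.log Y / L0 := by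
    rw [hδ, hIr]; field_simp
  have hJ1 : 1/2 ≤ δ * 2^J := by
    rw [hδJ, le_div_iff₀ hL0p]; linarith
  have hJ2 : δ * 2^J ≤ 1 := by
    rw [hδJ, div_le_iff₀ hL0p]; linarith
  have hexpI : Real.exp (δ * I) = Y := by rw [hδI, Real.exp_log (by linarith)]
  have h2n0 : (1:ℝ) ≤ 2^n := one_le_pow₀ (by norm_num)
  have hJe : (2:ℝ)^J = 16 * (2^n * 2^n) := by
    rw [hJ, pow_add, two_mul, pow_add]; ring
  have h16 : (16:ℝ) ≤ 2^n := by
    calc (16:ℝ) = 2^4 := by norm_num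
      _ ≤ 2^n := pow_le_pow_right₀ (by norm_num) hn4
  rw [hJe] at hJ2
  have hδnn : δ * (2^n * 2^n) ≤ 1/16 := by linarith
  have hδn : δ * 2^n ≤ 1/16 := by
    have : δ * 2^n * 1 ≤ δ * 2^n * 2^n := by gcongr
    linarith [mul_assoc δ ((2:ℝ)^n) ((2:ℝ)^n)]
  have hδs : δ ≤ 1/4096 := by
    have : (16:ℝ) * 16 ≤ 2^n * 2^n := by gcongr
    have : δ * ((16:ℝ) * 16) ≤ δ * (2^n * 2^n) := by gcongr
    linarith
  have hδYY : δ * Y^2 ≤ 1/16 := by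
    have : Y^2 ≤ 2^n * 2^n := by rw [sq]; gcongr
    exact (mul_le_mul_of_nonneg_left this hδ0.le).trans hδnn
  have hδY : δ * Y ≤ 1/16 := by
    have : Y ≤ Y^2 := le_self_pow₀ hY1 (by norm_num)
    exact (mul_le_mul_of_nonneg_left this hδ0.le).trans hδYY
  have hδN : δ * N ≤ 1/16 := (mul_le_mul_of_nonneg_left (by linarith) hδ0.le).trans hδY
  -- choice of the end points
  set a : ℤ := ⌈1/δ⌉ with ha
  have ha1 : 1 ≤ δ * a := by
    have := Int.le_ceil (1/δ)
    rw [div_le_iff₀ hδ0] at this; rw [mul_comm]; exact this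
  have ha2 : δ * ((a-1:ℤ):ℝ) < 1 := by
    have := Int.ceil_lt_add_one (1/δ)
    rw [← sub_lt_iff_lt_add, lt_div_iff₀ hδ0] at this
    push_cast; rw [mul_comm]; exact this
  have hlD : 1 ≤ Real.log D := by
    rw [Real.le_log_iff_exp_le (by linarith)]
    linarith [Real.exp_one_lt_d9]
  set b : ℤ := ⌈Real.log D / δ⌉ + 1 with hb
  have hb1 : Real.log D ≤ δ * ((b-1:ℤ):ℝ) := by
    have := Int.le_ceil (Real.log D / δ)
    rw [div_le_iff₀ hδ0] at this; rw [mul_comm, hb]; simpa using this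
  have hb2 : δ * ((b-1:ℤ):ℝ) < Real.log D + δ := by
    have := Int.ceil_lt_add_one (Real.log D / δ)
    rw [← sub_lt_iff_lt_add, lt_div_iff₀ hδ0] at this
    rw [hb]; push_cast; linarith
  have hab : a ≤ b := by
    have : a ≤ ⌈Real.log D / δ⌉ := by apply Int.ceil_le_ceil; gcongr
    omega
  have hexpb1 : (D:ℝ) ≤ Real.exp (δ * (b-1:ℤ)) := by
    rw [← Real.log_le_iff_le_exp (by linarith)]; exact hb1
  have hexpb2 : Real.exp (δ * (b-1:ℤ)) ≤ D * (1 + 2 * δ) := by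
    calc _ ≤ Real.exp (Real.log D + δ) := Real.exp_le_exp.mpr hb2.le
      _ = D * Real.exp δ := by rw [Real.exp_add, Real.exp_log (by linarith)]
      _ ≤ _ := by gcongr; exact exp_sub_one_le δ hδ0.le (by linarith)
  have hDleN : (D:ℝ) ≤ N := (le_self_pow₀ (by linarith) (by norm_num)).trans hDN'
  have hδD : δ * D ≤ 1/16 := (mul_le_mul_of_nonneg_left hDleN hδ0.le).trans hδN
  have hflb : ⌊Real.exp (δ * (b-1:ℤ))⌋₊ = D := by
    rw [Nat.floor_eq_iff (Real.exp_pos _).le]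
    exact ⟨hexpb1, by linarith [mul_comm δ (D:ℝ)]⟩
  have hfla : ⌊Real.exp (δ * (a-1:ℤ))⌋₊ ≤ 2 := by
    have : Real.exp (δ * (a-1:ℤ)) < 3 := by
      have := Real.exp_lt_exp.mpr ha2
      linarith [Real.exp_one_lt_d9]
    have := (Nat.floor_lt (Real.exp_pos _).le).mpr (show Real.exp (δ * (a-1:ℤ)) < ((3:ℕ):ℝ) by exact_mod_cast this)
    omega
  have h3b : 3 * Real.exp (δ * (b-1:ℤ)) ≤ Y := by
    have : 3 * (D:ℝ) ≤ D^2 := by rw [sq]; gcongr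
    have : 3 * (D:ℝ) ≤ N := this.trans hDN'
    rw [hY]; linarith [mul_comm δ (D:ℝ)]
  have hbI : δ * b ≤ δ * I - 1 := by
    rw [hδI]
    have e1 : δ * b ≤ Real.log D + 2 * δ := by
      push_cast at hb2; linarith
    have e2 : 2 * Real.log D ≤ Real.log Y := by
      rw [← Real.log_rpow (by linarith)]
      apply Real.log_le_log (by positivity)
      rw [Real.rpow_two]; linarith
    have e3 : 1 + 2 * δ ≤ Real.log D := by
      rw [Real.le_log_iff_exp_le (by linarith), Real.exp_add]
      have := exp_sub_one_le (2*δ) (by linarith) (by linarith)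
      have := Real.exp_one_lt_d9
      have := Real.exp_pos 1
      calc Real.exp 1 * Real.exp (2 * δ) ≤ 2.72 * 1.01 := by gcongr <;> linarith
        _ ≤ 3 := by norm_num
        _ ≤ D := hD3
    linarith
  have key := T_ww h N δ Y I a b hY hδ0 (by linarith) (by linarith) hexpI hab
  have kw := hw δ n J I a b hδ0 hJ1 (by rw [hJe]; exact hJ2) hδn (by rw [hexpI]; exact h2n') ha1 hab hbI
  have ks := hs δ Y I a b hδ0 (by linarith) hY1 (by linarith) hexpI ha1 hab hbI h3b
  rw [hexpI] at kw
  rw [hflb] at key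
  set r := ⌊Real.exp (δ * (a-1:ℤ))⌋₊ with hr
  have hsm := T_small h r N hfla hN
  rw [← hY] at hsm
  rw [← Finset.sum_Ioc_consecutive _ (Nat.zero_le r) (show r ≤ D by omega)]
  set T1 := ∑ k ∈ Finset.Ioc 0 r, aa χ k * Dl χ ρ (Y / k)
  set T2 := ∑ k ∈ Finset.Ioc r D, aa χ k * Dl χ ρ (Y / k)
  set W := ww χ ρ δ I a b 1
  set S := ∑ i ∈ Finset.Ico a b, Gr χ ρ δ (I - i) * (Real.exp (δ * i) - Real.exp (δ * (i-1:ℤ)))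
  have hAD : AA χ D ≤ (|ρ| + c) * Y := (AA_mono h (show D ≤ ⌊Y⌋₊ from Nat.le_floor (by linarith))).trans (AA_bd h Y hY1)
  have q1 : 2 * |ρ| * Y * δ * AA χ D ≤ 2 * |ρ| * (|ρ| + c) * 1 * (Real.sqrt N * (1 + Real.log N)^5) := by
    calc _ ≤ 2 * |ρ| * Y * δ * ((|ρ| + c) * Y) := by gcongr
      _ = 2 * |ρ| * (|ρ| + c) * (δ * Y^2) := by ring
      _ ≤ 2 * |ρ| * (|ρ| + c) * 1 * 1 := by rw [mul_one]; gcongr; linarith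
      _ ≤ _ := by gcongr; exact hsq.trans hfin
  have hsY : Real.sqrt Y ≤ 2 * Real.sqrt N := by
    rw [Real.sqrt_le_left (by positivity), mul_pow, Real.sq_sqrt (by linarith)]; linarith
  have q2 : |W| ≤ Cw * (2 * 2^4 * 8) * (Real.sqrt N * (1 + Real.log N)^5) := by
    refine kw.trans ?_
    have u1 : (1 + (n:ℝ)) ≤ 2 * (1 + Real.log N) := by linarith
    have u2 : (1 + (J:ℝ)) ≤ 8 * (1 + Real.log N) := by rw [hJ]; push_cast; linarith
    calc _ ≤ Cw * (2 * Real.sqrt N * (2 * (1 + Real.log N))^4 * (8 * (1 + Real.log N))) := by gcongr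
      _ = _ := by ring
  have q3 : |ρ * S| ≤ |ρ| * (Cs * 4) * (Real.sqrt N * (1 + Real.log N)^5) := by
    rw [abs_mul, mul_assoc |ρ|]
    apply mul_le_mul_of_nonneg_left _ (abs_nonneg _)
    refine ks.trans ?_
    have u1 : Real.exp (δ * (b-1:ℤ)) ≤ 2 * Real.sqrt N := by
      have : (D:ℝ) ≤ Real.sqrt N := Real.le_sqrt_of_sq_le hDN'
      linarith [mul_comm δ (D:ℝ)]
    have u2 : 1 + Real.log Y ≤ 2 * (1 + Real.log N) := by
      have : Real.log Y ≤ Real.log (2 * N) := Real.log_le_log (by linarith) (by linarith)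
      rw [Real.log_mul (by norm_num) (by linarith)] at this
      linarith [Real.log_two_lt_d9]
    have u3 : 1 + Real.log N ≤ (1 + Real.log N)^5 := le_self_pow₀ (by linarith) (by norm_num)
    calc _ ≤ Cs * (2 * Real.sqrt N * (2 * (1 + Real.log N))) := by gcongr
      _ = Cs * 4 * (Real.sqrt N * (1 + Real.log N)) := by ring
      _ ≤ _ := by gcongr
  have q4 : |T1| ≤ 6 * c * (Real.sqrt N * (1 + Real.log N)^5) := hsm.trans (mul_le_mul_of_nonneg_left hfin (by positivity))
  have t1 := abs_add_le T1 T2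
  have t2 : |T2| ≤ |T2 - (W + ρ * S)| + |W + ρ * S| := by
    have := abs_add_le (T2 - (W + ρ * S)) (W + ρ * S); simpa using this
  have t3 := abs_add_le W (ρ * S)
  linarith

end C1proof

namespace C1proof

noncomputable def chi (d : ℤ) (n : ℕ) : ℤ :=
  if d % 4 = 1 then jacobiSym n d.natAbs else if n % 2 = 1 then jacobiSym d n else 0

lemma chi_one (d : ℤ) : chi d 1 = 1 := by
  unfold chi
  split_ifs with h
  · simp [jacobiSym.one_left]
  · simp [jacobiSym.one_right]
  · simp at *

lemma chi_mul (d : ℤ) (m n : ℕ) : chi d (m * n) = chi d m * chi d n := by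
  unfold chi
  by_cases h : d % 4 = 1
  · simp only [if_pos h]; push_cast; exact jacobiSym.mul_left _ _ _
  · simp only [if_neg h]
    by_cases hm : m % 2 = 1
    · by_cases hn : n % 2 = 1
      · have : (m * n) % 2 = 1 := by rw [Nat.mul_mod, hm, hn]
        rw [if_pos hm, if_pos hn, if_pos this]
        exact jacobiSym.mul_right' d (by omega) (by omega)
      · have : (m * n) % 2 ≠ 1 := by rw [Nat.mul_mod, hm, show n % 2 = 0 by omega]; decide
        rw [if_neg hn, if_neg this, mul_zero]
    · have : (m * n) % 2 ≠ 1 := by rw [Nat.mul_mod, show m % 2 = 0 by omega, zero_mul]; decide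
      rw [if_neg hm, if_neg this, zero_mul]

lemma jac_abs (a : ℤ) (b : ℕ) : |jacobiSym a b| ≤ 1 := by
  rcases jacobiSym.trichotomy a b with h | h | h <;> rw [h] <;> norm_num

lemma chi_abs (d : ℤ) (n : ℕ) : |chi d n| ≤ 1 := by
  unfold chi
  split_ifs
  · exact jac_abs _ _
  · exact jac_abs _ _
  · norm_num

lemma chi_per (d : ℤ) (n : ℕ) : chi d (n + 4 * d.natAbs) = chi d n := by
  unfold chi
  split_ifs with h1 h2 h3 h3
  · apply jacobiSym.mod_left'
    push_cast
    rw [show (n:ℤ) + 4 * |d| = n + |d| * 4 by ring]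
    exact Int.add_mul_emod_self_left _ _ _
  · rw [jacobiSym.mod_right d (Nat.odd_iff.mpr h2), jacobiSym.mod_right d (b := n) (Nat.odd_iff.mpr h3), Nat.add_mod_right]
  · omega
  · omega
  · rfl

lemma chi_odd (d : ℤ) (n : ℕ) (hn : n % 2 = 1) : chi d n = jacobiSym d n := by
  unfold chi
  split_ifs with h
  · have ho : Odd n := Nat.odd_iff.mpr hn
    rcases le_total 0 d with hd | hd
    · have e : (d.natAbs : ℤ) = d := Int.natAbs_of_nonneg hd
      have h4 : d.natAbs % 4 = 1 := by omega
      conv_rhs => rw [← e]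
      exact (jacobiSym.quadratic_reciprocity_one_mod_four h4 ho).symm
    · have e : d = -(d.natAbs : ℤ) := by omega
      have h4 : d.natAbs % 4 = 3 := by omega
      conv_rhs => rw [e]
      rw [jacobiSym.neg _ ho]
      rcases Nat.odd_mod_four_iff.mp hn with h1 | h3
      · rw [ZMod.χ₄_nat_one_mod_four h1, one_mul]
        exact jacobiSym.quadratic_reciprocity_one_mod_four h1 (Nat.odd_iff.mpr (by omega))
      · rw [ZMod.χ₄_nat_three_mod_four h3, jacobiSym.quadratic_reciprocity_three_mod_four h3 h4]; ring
  · rfl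

lemma card2 (a b : ZMod 2) : Nat.card {r : ZMod 2 // r^2 - a * r + b = 0} = if a = 0 then 1 else if b = 0 then 2 else 0 := by
  rw [Nat.card_eq_fintype_card, Fintype.card_subtype]
  revert a b
  decide

lemma root_card (t n0 d : ℤ) (hd : d = t^2 - 4 * n0) (p : ℕ) [hp : Fact p.Prime] :
    (Nat.card {r : ZMod p // r^2 - t * r + n0 = 0} : ℤ) = 1 + chi d p := by
  rcases hp.out.eq_two_or_odd with h2 | hodd
  · subst h2
    have ht : ((t:ZMod 2) = 0 ∧ t % 2 = 0) ∨ ((t:ZMod 2) = 1 ∧ t % 2 = 1) := by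
      rcases Int.emod_two_eq_zero_or_one t with h | h
      · left; exact ⟨(ZMod.intCast_zmod_eq_zero_iff_dvd t 2).mpr (Int.dvd_of_emod_eq_zero h), h⟩
      · right; refine ⟨?_, h⟩
        have := (ZMod.intCast_eq_intCast_iff t 1 2).mpr (by simpa [Int.ModEq] using h)
        simpa using this
    have hn : ((n0:ZMod 2) = 0 ∧ n0 % 2 = 0) ∨ ((n0:ZMod 2) = 1 ∧ n0 % 2 = 1) := by
      rcases Int.emod_two_eq_zero_or_one n0 with h | h
      · left; exact ⟨(ZMod.intCast_zmod_eq_zero_iff_dvd n0 2).mpr (Int.dvd_of_emod_eq_zero h), h⟩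
      · right; refine ⟨?_, h⟩
        have := (ZMod.intCast_eq_intCast_iff n0 1 2).mpr (by simpa [Int.ModEq] using h)
        simpa using this
    rcases ht with ⟨ht, ht'⟩ | ⟨ht, ht'⟩
    · have hd4 : d % 4 ≠ 1 := by
        obtain ⟨k, hk⟩ := Int.dvd_of_emod_eq_zero ht'
        rw [hd, hk, show (2*k)^2 - 4 * n0 = 4 * (k^2 - n0) by ring]; omega
      have : chi d 2 = 0 := by unfold chi; rw [if_neg hd4, if_neg (by norm_num)]
      rw [this, ht]
      rw [card2, if_pos rfl]; rfl
    · obtain ⟨k, hk⟩ : ∃ k, t = 2 * k + 1 := ⟨t / 2, by omega⟩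
      obtain ⟨j, hj⟩ : ∃ j, k^2 + k = 2 * j := by
        obtain ⟨j, hj⟩ := (Int.even_mul_succ_self k)
        exact ⟨j, by linarith⟩
      have hd' : d = 1 + 8 * j - 4 * n0 := by rw [hd, hk]; linarith
      have hd4 : d % 4 = 1 := by omega
      have hch : chi d 2 = ZMod.χ₈ d.natAbs := by
        unfold chi; rw [if_pos hd4]; exact jacobiSym.at_two (Nat.odd_iff.mpr (by omega))
      rw [hch, ZMod.χ₈_nat_eq_if_mod_eight, ht]
      rcases hn with ⟨hn, hn'⟩ | ⟨hn, hn'⟩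
      · rw [if_neg (by omega), if_pos (by omega), hn, card2, if_neg one_ne_zero, if_pos rfl]; rfl
      · rw [if_neg (by omega), if_neg (by omega), hn, card2, if_neg one_ne_zero, if_neg one_ne_zero]; rfl
  · have hp2 : p ≠ 2 := by omega
    rw [chi_odd d p hodd, ← jacobiSym.legendreSym.to_jacobiSym, add_comm, ← legendreSym.card_sqrts p hp2 d]
    have h2 : (2:ZMod p) ≠ 0 := by
      intro h
      have : ((2:ℕ):ZMod p) = 0 := by exact_mod_cast h
      rw [ZMod.natCast_eq_zero_iff] at this
      exact hp2 ((Nat.prime_dvd_prime_iff_eq hp.out Nat.prime_two).mp this)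
    have e : {r : ZMod p // r^2 - t * r + n0 = 0} ≃ {x : ZMod p // x^2 = (d : ZMod p)} := 
      { toFun := fun r => ⟨2 * r.1 - t, by
          have := r.2; rw [hd]; push_cast; linear_combination 4 * this⟩
        invFun := fun x => ⟨(x.1 + t) / 2, by
          have hdz : (d : ZMod p) = t^2 - 4 * n0 := by rw [hd]; push_cast; ring
          have := x.2.trans hdz
          field_simp
          linear_combination this⟩
        left_inv := fun r => by ext; simp; field_simp
        right_inv := fun x => by ext; simp; field_simp; ring }
    rw [Nat.card_congr e, Nat.card_eq_fintype_card, Fintype.card_subtype]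
    congr 2
    ext; simp

end C1proof

namespace C1proof

variable {F : Type} [Field F] [NumberField F]

lemma int_basis (hdeg : Module.finrank ℚ F = 2) : ∃ ω : 𝓞 F, (∀ z : 𝓞 F, ∃ a b : ℤ, z = a + b * ω) ∧
    (∀ a b : ℤ, (a : 𝓞 F) + b * ω = 0 → a = 0 ∧ b = 0) := by
  have hr : Module.finrank ℤ (𝓞 F) = 2 := by rw [RingOfIntegers.rank, hdeg]
  let B := Module.finBasisOfFinrankEq ℤ (𝓞 F) hr
  have hB : ∀ z : 𝓞 F, z = (B.repr z 0 : 𝓞 F) * B 0 + (B.repr z 1 : 𝓞 F) * B 1 := by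
    intro z
    have := B.sum_repr z
    rw [Fin.sum_univ_two] at this
    conv_lhs => rw [← this]
    simp [zsmul_eq_mul]
  have hli : ∀ a b : ℤ, (a : 𝓞 F) * B 0 + b * B 1 = 0 → a = 0 ∧ b = 0 := by
    intro a b hab
    have := Fintype.linearIndependent_iff.mp B.linearIndependent ![a, b] (by
      rw [Fin.sum_univ_two]; simpa [zsmul_eq_mul] using hab)
    exact ⟨this 0, this 1⟩
  set x := B.repr 1 0
  set y := B.repr 1 1
  have h1 := hB 1
  have hg : Int.gcd x y = 1 := by
    obtain ⟨x', hx'⟩ := Int.gcd_dvd_left x y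
    obtain ⟨y', hy'⟩ := Int.gcd_dvd_right x y
    set g := Int.gcd x y
    have : (1 : 𝓞 F) = (g : 𝓞 F) * (x' * B 0 + y' * B 1) := by
      conv_lhs => rw [h1]
      change (x : 𝓞 F) * B 0 + (y : 𝓞 F) * B 1 = _
      rw [hx', hy']; push_cast; ring
    have hu : IsUnit (g : 𝓞 F) := IsUnit.of_mul_eq_one _ this.symm
    have := Ideal.absNorm_span_natCast (S := 𝓞 F) g
    rw [Ideal.span_singleton_eq_top.mpr hu, Ideal.absNorm_top, hr] at this
    exact (pow_eq_one_iff.mp this.symm).resolve_right (by norm_num)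
  have hbez := Int.gcd_eq_gcd_ab x y
  rw [hg] at hbez
  set u := Int.gcdA x y
  set v := Int.gcdB x y
  have hbz : (x : 𝓞 F) * u + y * v = 1 := by exact_mod_cast hbez.symm
  have h1' : (1 : 𝓞 F) = (x : 𝓞 F) * B 0 + y * B 1 := h1
  refine ⟨-v * B 0 + u * B 1, ?_, ?_⟩
  · intro z
    refine ⟨B.repr z 0 * u + B.repr z 1 * v, -(B.repr z 0) * y + B.repr z 1 * x, ?_⟩
    conv_lhs => rw [hB z]
    push_cast
    generalize ((B.repr z 0 : ℤ) : 𝓞 F) = s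
    generalize ((B.repr z 1 : ℤ) : 𝓞 F) = t
    linear_combination (-s * B 0 - t * B 1) * hbz + (-(s * u + t * v)) * h1'
  · intro a b hab
    have := hli (a * x - b * v) (a * y + b * u) (by
      push_cast
      linear_combination hab - a * h1')
    obtain ⟨e1, e2⟩ := this
    constructor
    · linear_combination u * e1 + v * e2 + a * hbez
    · linear_combination (-y) * e1 + x * e2 + b * hbez

/-- the set of ideals of norm `n` -/
def Sn (F : Type) [Field F] [NumberField F] (n : ℕ) : Set (Ideal (𝓞 F)) := {I | Ideal.absNorm I = n}

lemma hom_root (ω : 𝓞 F) (t n0 : ℤ) (hω : ω^2 = t * ω - n0) (h1 : ∀ z : 𝓞 F, ∃ a b : ℤ, z = a + b * ω) 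
    (h2 : ∀ a b : ℤ, (a : 𝓞 F) + b * ω = 0 → a = 0 ∧ b = 0) (p : ℕ) [hp : Fact p.Prime] :
    Nat.card (𝓞 F →+* ZMod p) = Nat.card {r : ZMod p // r^2 - t * r + n0 = 0} := by
  choose A B hAB using h1
  have huniq : ∀ (z : 𝓞 F) (a b : ℤ), z = a + b * ω → A z = a ∧ B z = b := by
    intro z a b hz
    have := h2 (A z - a) (B z - b) (by push_cast; linear_combination hz - hAB z)
    omega
  refine Nat.card_congr (Equiv.ofBijective (fun f => ⟨f ω, ?_⟩) ⟨?_, ?_⟩)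
  · have := congrArg f hω
    simp only [map_pow, map_sub, map_mul, map_intCast] at this
    rw [this]; ring
  · intro f g hfg
    have hfg' : f ω = g ω := congrArg Subtype.val hfg
    ext z
    rw [hAB z]; simp [hfg']
  · rintro ⟨r, hr⟩
    let f : 𝓞 F →+* ZMod p := 
      { toFun := fun z => (A z : ZMod p) + B z * r
        map_one' := by
          obtain ⟨e1, e2⟩ := huniq 1 1 0 (by simp)
          rw [e1, e2]; simp
        map_zero' := by
          obtain ⟨e1, e2⟩ := huniq 0 0 0 (by simp)
          rw [e1, e2]; simp
        map_add' := by
          intro z w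
          obtain ⟨e1, e2⟩ := huniq (z + w) (A z + A w) (B z + B w) (by
            push_cast; linear_combination hAB z + hAB w)
          rw [e1, e2]; push_cast; ring
        map_mul' := by
          intro z w
          obtain ⟨e1, e2⟩ := huniq (z * w) (A z * A w - B z * B w * n0) (A z * B w + B z * A w + B z * B w * t) (by
            conv_lhs => rw [hAB z, hAB w]
            push_cast; linear_combination (B z * B w : 𝓞 F) * hω)
          rw [e1, e2]; push_cast; linear_combination (-(B z * B w : ZMod p)) * hr }
    refine ⟨f, ?_⟩
    apply Subtype.ext
    change (A ω : ZMod p) + B ω * r = r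
    obtain ⟨e1, e2⟩ := huniq ω 0 1 (by simp)
    rw [e1, e2]; simp

lemma hom_ideal (p : ℕ) [hp : Fact p.Prime] : Nat.card (𝓞 F →+* ZMod p) = Nat.card (Sn F p) := by
  have hsurj : ∀ f : 𝓞 F →+* ZMod p, Function.Surjective f := by
    intro f x
    obtain ⟨n, rfl⟩ := ZMod.intCast_surjective x
    exact ⟨n, map_intCast f n⟩
  refine Nat.card_congr (Equiv.ofBijective (fun f => ⟨RingHom.ker f, ?_⟩) ⟨?_, ?_⟩)
  · change Ideal.absNorm (RingHom.ker f) = p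
    rw [Ideal.absNorm_apply]
    have e := (RingHom.quotientKerEquivOfSurjective (hsurj f)).toEquiv
    change Nat.card (𝓞 F ⧸ RingHom.ker f) = p
    rw [Nat.card_congr e, Nat.card_zmod]
  · intro f g hfg
    have hk : RingHom.ker f = RingHom.ker g := congrArg Subtype.val hfg
    ext z
    obtain ⟨n, hn⟩ := ZMod.intCast_surjective (f z)
    have : z - (n : 𝓞 F) ∈ RingHom.ker f := by rw [RingHom.mem_ker, map_sub, map_intCast, hn, sub_self]
    rw [hk, RingHom.mem_ker, map_sub, map_intCast, sub_eq_zero] at this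
    rw [this, hn]
  · rintro ⟨P, hP⟩
    have hP' : Nat.card (𝓞 F ⧸ P) = p := hP
    haveI : Finite (𝓞 F ⧸ P) := Nat.finite_of_card_ne_zero (by rw [hP']; exact hp.out.ne_zero)
    haveI := Fintype.ofFinite (𝓞 F ⧸ P)
    have hc : Fintype.card (𝓞 F ⧸ P) = p := by rw [← Nat.card_eq_fintype_card]; exact hP'
    let e := ZMod.ringEquivOfPrime (𝓞 F ⧸ P) hp.out hc
    refine ⟨e.symm.toRingHom.comp (Ideal.Quotient.mk P), ?_⟩
    apply Subtype.ext
    ext z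
    simp [RingHom.mem_ker, Ideal.Quotient.eq_zero_iff_mem]

lemma Sn_card (hdeg : Module.finrank ℚ F = 2) : ∃ d : ℤ, d ≠ 0 ∧ ∀ p : ℕ, p.Prime → (Nat.card (Sn F p) : ℤ) = 1 + chi d p := by
  obtain ⟨ω, h1, h2⟩ := int_basis hdeg
  obtain ⟨m, t, hmt⟩ := h1 (ω^2)
  have hω : ω^2 = (t:ℤ) * ω - ((-m : ℤ) : 𝓞 F) := by rw [hmt]; push_cast; ring
  refine ⟨t^2 - 4 * (-m), ?_, ?_⟩
  · intro h0
    have h0' : (t:𝓞 F)^2 + 4 * m = 0 := by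
      have : ((t^2 - 4 * (-m) : ℤ) : 𝓞 F) = 0 := by rw [h0]; simp
      push_cast at this; linear_combination this
    have : (2 * ω - t)^2 = 0 := by linear_combination 4 * hmt + h0'
    have := pow_eq_zero_iff (two_ne_zero) |>.mp this
    have := h2 (-t) 2 (by push_cast; linear_combination this)
    omega
  · intro p hp
    haveI : Fact p.Prime := ⟨hp⟩
    rw [← hom_ideal, hom_root ω t (-m) hω h1 h2 p]
    exact root_card t (-m) _ rfl p

end C1proof

namespace C1proof

variable {F : Type} [Field F] [NumberField F]

lemma Sn_finite (n : ℕ) : (Sn F n).Finite := Ideal.finite_setOfPred_absNorm_eq n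

lemma ncard_dvd (P : Ideal (𝓞 F)) (k m : ℕ) (hk : Ideal.absNorm P = k) (hk0 : k ≠ 0) :
    {I : Ideal (𝓞 F) | P ∣ I ∧ Ideal.absNorm I = k * m}.ncard = (Sn F m).ncard := by
  have hP : P ≠ 0 := by
    rintro rfl
    apply hk0; rw [← hk]; simp
  have : {I : Ideal (𝓞 F) | P ∣ I ∧ Ideal.absNorm I = k * m} = (fun J => P * J) '' Sn F m := by
    ext I
    constructor
    · rintro ⟨⟨J, rfl⟩, h⟩
      refine ⟨J, ?_, rfl⟩
      rw [map_mul, hk] at h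
      exact Nat.eq_of_mul_eq_mul_left (Nat.pos_of_ne_zero hk0) h
    · rintro ⟨J, hJ, rfl⟩
      refine ⟨Dvd.intro _ rfl, ?_⟩
      have hJ' : Ideal.absNorm J = m := hJ
      simp [hk, hJ']
  rw [this, Set.ncard_image_of_injective]
  intro a b hab
  exact mul_left_cancel₀ hP hab

lemma eq_of_dvd_norm {P I : Ideal (𝓞 F)} (h : P ∣ I) (hn : Ideal.absNorm P = Ideal.absNorm I)
    (h0 : Ideal.absNorm I ≠ 0) : P = I := by
  obtain ⟨J, rfl⟩ := h
  rw [map_mul] at hn h0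
  have : Ideal.absNorm J = 1 := by
    have h1 : Ideal.absNorm P ≠ 0 := left_ne_zero_of_mul h0
    exact (Nat.eq_of_mul_eq_mul_left (Nat.pos_of_ne_zero h1) (by rw [← hn, mul_one])).symm
  rw [Ideal.absNorm_eq_one_iff] at this
  rw [this, Ideal.mul_top]

lemma norm_p (hdeg : Module.finrank ℚ F = 2) (p : ℕ) :
    Ideal.absNorm (Ideal.span {(p : 𝓞 F)}) = p ^ 2 := by
  rw [Ideal.absNorm_span_natCast, RingOfIntegers.rank, hdeg]

noncomputable def cnt (F : Type) [Field F] [NumberField F] (n : ℕ) : ℕ := (Sn F n).ncard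

lemma ncard_p (hdeg : Module.finrank ℚ F = 2) (p n : ℕ) (hp : p.Prime) :
    {I : Ideal (𝓞 F) | Ideal.span {(p : 𝓞 F)} ∣ I ∧ Ideal.absNorm I = p * n}.ncard =
      if p ∣ n then cnt F (n / p) else 0 := by
  split_ifs with h
  · obtain ⟨m, rfl⟩ := h
    rw [Nat.mul_div_cancel_left _ hp.pos, ← mul_assoc, ← sq]
    exact ncard_dvd _ _ _ (norm_p hdeg p) (pow_ne_zero _ hp.ne_zero)
  · rw [Set.ncard_eq_zero ((Sn_finite (p * n)).subset (fun I hI => hI.2))]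
    ext I
    simp only [Set.mem_setOf_eq, Set.mem_empty_iff_false, iff_false, not_and]
    intro hd hI
    apply h
    have := Ideal.absNorm_dvd_absNorm_of_le (Ideal.le_of_dvd hd)
    rw [norm_p hdeg, hI, sq] at this
    exact Nat.dvd_of_mul_dvd_mul_left hp.pos this

lemma exists_max (p n : ℕ) (hp : p.Prime) (I : Ideal (𝓞 F))
    (hI : Ideal.absNorm I = p * n) : ∃ P : Ideal (𝓞 F), P.IsMaximal ∧ P ∣ I ∧
      P ∣ Ideal.span {(p : 𝓞 F)} ∧ Ideal.absNorm P ≠ 1 := by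
  obtain ⟨P, h1, h2, h3⟩ := Ideal.exists_isMaximal_dvd_of_dvd_absNorm' hp I (by rw [hI]; exact Dvd.intro _ rfl)
  refine ⟨P, h1, h3, ?_, ?_⟩
  · rw [Ideal.dvd_span_singleton]
    have : (p : ℤ) ∈ P.under ℤ := by rw [h2]; exact Ideal.mem_span_singleton_self _
    rw [Ideal.under_def, Ideal.mem_comap] at this
    simpa using this
  · rw [Ne, Ideal.absNorm_eq_one_iff]
    exact h1.ne_top

lemma cnt_rec (hdeg : Module.finrank ℚ F = 2) (p n : ℕ) (hp : p.Prime) :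
    (cnt F (p * n) : ℤ) = cnt F p * cnt F n -
      (cnt F p - 1) * (if p ∣ n then (cnt F (n / p) : ℤ) else 0) := by
  have hG := ncard_p hdeg p n hp (F := F)
  have hGc : (if p ∣ n then (cnt F (n / p) : ℤ) else 0) =
    ((if p ∣ n then cnt F (n / p) else 0 : ℕ) : ℤ) := by split_ifs <;> simp
  rw [hGc, ← hG]
  rcases (Sn F p).eq_empty_or_nonempty with he | ⟨P, hP⟩
  · have h0 : cnt F p = 0 := by unfold cnt; rw [he]; simp
    rw [h0]
    have : Sn F (p * n) = {I : Ideal (𝓞 F) | Ideal.span {(p : 𝓞 F)} ∣ I ∧ Ideal.absNorm I = p * n} := by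
      ext I
      refine ⟨fun hI => ⟨?_, hI⟩, fun hI => hI.2⟩
      obtain ⟨P, h1, h2, h3, h4⟩ := exists_max p n hp I hI
      have hd := Ideal.absNorm_dvd_absNorm_of_le (Ideal.le_of_dvd h3)
      rw [norm_p hdeg, Nat.dvd_prime_pow hp] at hd
      obtain ⟨k, hk, hk'⟩ := hd
      have : k = 2 := by
        interval_cases k
        · simp at hk'; exact absurd hk' (by simpa using h4)
        · have : P ∈ Sn F p := by simpa [Sn] using hk'
          rw [he] at this; exact absurd this (by simp)
        · rfl
      subst this
      rw [← eq_of_dvd_norm h3 (by rw [hk', norm_p hdeg]) (by rw [norm_p hdeg]; exact pow_ne_zero _ hp.ne_zero)]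
      exact h2
    unfold cnt
    rw [this]; simp
  · have hPn : Ideal.absNorm P = p := hP
    have hpP : P ∣ Ideal.span {(p : 𝓞 F)} := by
      rw [Ideal.dvd_span_singleton]
      have := Ideal.absNorm_mem P
      rwa [hPn] at this
    obtain ⟨P', hP'⟩ := hpP
    have hPn' : Ideal.absNorm P' = p := by
      have := norm_p hdeg p (F := F)
      rw [hP', map_mul, hPn, sq] at this
      exact Nat.eq_of_mul_eq_mul_left hp.pos this
    have key : ∀ m (I : Ideal (𝓞 F)), Ideal.absNorm I = p * m → P ∣ I ∨ P' ∣ I := by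
      intro m I hI
      obtain ⟨Q, h1, h2, h3, h4⟩ := exists_max p m hp I hI
      have hQ0 : Q ≠ ⊥ := by
        rintro rfl
        have := eq_zero_of_zero_dvd h3
        have h5 := norm_p hdeg p (F := F)
        rw [this] at h5
        simp at h5; exact hp.ne_zero (by simpa using h5.symm)
      have hQ := Ideal.prime_of_isPrime hQ0 h1.isPrime
      have aux : ∀ R : Ideal (𝓞 F), Ideal.absNorm R = p → Q ∣ R → R ∣ I := by
        intro R hR hQR
        have hd := Ideal.absNorm_dvd_absNorm_of_le (Ideal.le_of_dvd hQR)
        rw [hR, Nat.dvd_prime hp] at hd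
        rw [← eq_of_dvd_norm hQR (by rw [hR]; exact hd.resolve_left h4) (by rw [hR]; exact hp.ne_zero)]
        exact h2
      rw [hP'] at h3
      rcases hQ.dvd_or_dvd h3 with h | h
      · exact Or.inl (aux _ hPn h)
      · exact Or.inr (aux _ hPn' h)
    have hSp : Sn F p = {P, P'} := by
      ext I
      simp only [Set.mem_insert_iff, Set.mem_singleton_iff]
      constructor
      · intro hI
        have hI' : Ideal.absNorm I = p := hI
        rcases key 1 I (by rw [hI', mul_one]) with h | h
        · left; exact (eq_of_dvd_norm h (by rw [hI', hPn]) (by rw [hI']; exact hp.ne_zero)).symm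
        · right; exact (eq_of_dvd_norm h (by rw [hI', hPn']) (by rw [hI']; exact hp.ne_zero)).symm
      · rintro (rfl | rfl)
        · exact hPn
        · exact hPn'
    have hA := ncard_dvd P p n hPn hp.ne_zero
    have hB := ncard_dvd P' p n hPn' hp.ne_zero
    have hU : Sn F (p * n) = {I : Ideal (𝓞 F) | P ∣ I ∧ Ideal.absNorm I = p * n} ∪
        {I : Ideal (𝓞 F) | P' ∣ I ∧ Ideal.absNorm I = p * n} := by
      ext I
      constructor
      · intro hI
        rcases key n I hI with h | h
        · left; exact ⟨h, hI⟩
        · right; exact ⟨h, hI⟩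
      · rintro (h | h)
        · exact h.2
        · exact h.2
    by_cases hPP : P = P'
    · subst hPP
      have : cnt F p = 1 := by unfold cnt; rw [hSp]; simp
      rw [this]
      have h2 : cnt F (p * n) = cnt F n := by
        unfold cnt; rw [hU, Set.union_self, hA]
      rw [h2]; simp
    · have : cnt F p = 2 := by unfold cnt; rw [hSp]; exact Set.ncard_pair hPP
      rw [this]
      have hfin : ∀ R : Ideal (𝓞 F), {I : Ideal (𝓞 F) | R ∣ I ∧ Ideal.absNorm I = p * n}.Finite :=
        fun R => (Sn_finite (p * n)).subset (fun I hI => hI.2)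
      have hIE := Set.ncard_union_add_ncard_inter _ _ (hfin P) (hfin P')
      rw [← hU, hA, hB] at hIE
      have hinter : {I : Ideal (𝓞 F) | P ∣ I ∧ Ideal.absNorm I = p * n} ∩
        {I : Ideal (𝓞 F) | P' ∣ I ∧ Ideal.absNorm I = p * n} =
        {I : Ideal (𝓞 F) | Ideal.span {(p : 𝓞 F)} ∣ I ∧ Ideal.absNorm I = p * n} := by
        ext I
        constructor
        · rintro ⟨⟨h1, h2⟩, ⟨h3, _⟩⟩
          refine ⟨?_, h2⟩
          rw [hP']
          have hi : Prime P := by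
            have h1 := Ideal.isPrime_of_irreducible_absNorm (I := P) (by rw [hPn]; exact hp)
            refine Ideal.prime_of_isPrime ?_ h1
            rintro rfl
            simp at hPn; exact hp.ne_zero hPn.symm
          have hi' : Prime P' := by
            have h1 := Ideal.isPrime_of_irreducible_absNorm (I := P') (by rw [hPn']; exact hp)
            refine Ideal.prime_of_isPrime ?_ h1
            rintro rfl
            simp at hPn'; exact hp.ne_zero hPn'.symm
          obtain ⟨J, rfl⟩ := h1
          rcases hi'.dvd_or_dvd h3 with h | h
          · exact absurd (eq_of_dvd_norm h (by rw [hPn, hPn']) (by rw [hPn]; exact hp.ne_zero)).symm hPP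
          · exact mul_dvd_mul_left _ h
        · rintro ⟨h1, h2⟩
          rw [hP'] at h1
          exact ⟨⟨dvd_of_mul_right_dvd h1, h2⟩, ⟨dvd_of_mul_left_dvd h1, h2⟩⟩
      rw [hinter] at hIE
      have : (cnt F (p * n) : ℤ) = (Sn F (p*n)).ncard := rfl
      rw [this]
      have : (cnt F n : ℤ) = (Sn F n).ncard := rfl
      rw [this]
      push_cast
      omega

end C1proof

namespace C1proof

variable {F : Type} [Field F] [NumberField F]

lemma aa_rec (χ : ℕ → ℝ) (hm : ∀ m n, χ (m * n) = χ m * χ n) (p n : ℕ) (hp : p.Prime) (hn : n ≠ 0) :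
    aa χ (p * n) = (1 + χ p) * aa χ n - χ p * (if p ∣ n then aa χ (n / p) else 0) := by
  have hU : (p * n).divisors = n.divisors ∪ n.divisors.image (fun d => p * d) := by
    ext d
    simp only [Nat.mem_divisors, Finset.mem_union, Finset.mem_image]
    constructor
    · rintro ⟨h1, h2⟩
      by_cases hpd : p ∣ d
      · obtain ⟨e, rfl⟩ := hpd
        right
        exact ⟨e, ⟨Nat.dvd_of_mul_dvd_mul_left hp.pos h1, hn⟩, rfl⟩
      · left
        exact ⟨(Nat.Coprime.dvd_of_dvd_mul_left ((Nat.Prime.coprime_iff_not_dvd hp).mpr hpd).symm h1), hn⟩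
    · rintro (⟨h1, h2⟩ | ⟨e, ⟨h1, h2⟩, rfl⟩)
      · exact ⟨dvd_mul_of_dvd_right h1 _, mul_ne_zero hp.ne_zero hn⟩
      · exact ⟨Nat.mul_dvd_mul_left _ h1, mul_ne_zero hp.ne_zero hn⟩
  have hinj : Function.Injective (fun d : ℕ => p * d) := fun a b hab => Nat.eq_of_mul_eq_mul_left hp.pos hab
  have him : ∀ m, ∑ d ∈ m.divisors.image (fun d => p * d), χ d = χ p * aa χ m := by
    intro m
    rw [Finset.sum_image (fun a _ b _ h => hinj h)]
    unfold aa
    rw [Finset.mul_sum]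
    exact Finset.sum_congr rfl fun d _ => hm p d
  have hI : ∑ d ∈ n.divisors ∩ n.divisors.image (fun d => p * d), χ d =
      χ p * (if p ∣ n then aa χ (n / p) else 0) := by
    split_ifs with h
    · obtain ⟨m, rfl⟩ := h
      have hm0 : m ≠ 0 := right_ne_zero_of_mul hn
      rw [Nat.mul_div_cancel_left _ hp.pos, ← him]
      congr 1
      ext d
      simp only [Finset.mem_inter, Nat.mem_divisors, Finset.mem_image]
      constructor
      · rintro ⟨⟨h1, h2⟩, e, h3, rfl⟩
        exact ⟨e, ⟨Nat.dvd_of_mul_dvd_mul_left hp.pos h1, hm0⟩, rfl⟩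
      · rintro ⟨e, ⟨h1, h2⟩, rfl⟩
        exact ⟨⟨Nat.mul_dvd_mul_left _ h1, hn⟩, e, ⟨dvd_mul_of_dvd_right h1 _, hn⟩, rfl⟩
    · rw [mul_zero]
      apply Finset.sum_eq_zero
      intro d hd
      exfalso
      simp only [Finset.mem_inter, Nat.mem_divisors, Finset.mem_image] at hd
      obtain ⟨⟨h1, _⟩, e, _, rfl⟩ := hd
      exact h (dvd_of_mul_right_dvd h1)
  have := Finset.sum_union_inter (s₁ := n.divisors) (s₂ := n.divisors.image (fun d => p * d)) (f := χ)
  rw [← hU, hI, him] at this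
  unfold aa at *
  linarith

lemma cnt_eq_aa (hdeg : Module.finrank ℚ F = 2) : ∃ d : ℤ, d ≠ 0 ∧ ∀ n : ℕ, n ≠ 0 →
    (cnt F n : ℝ) = aa (fun k => (chi d k : ℝ)) n := by
  obtain ⟨d, hd, h⟩ := Sn_card (F := F) hdeg
  refine ⟨d, hd, ?_⟩
  have hp1 : ∀ p : ℕ, p.Prime → (cnt F p : ℤ) = 1 + chi d p := by
    intro p hp
    rw [← h p hp]; rfl
  intro n
  induction n using Nat.strong_induction_on with
  | _ n ih =>
    intro hn
    by_cases h1 : n = 1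
    · subst h1
      have : cnt F 1 = 1 := by
        unfold cnt
        rw [Set.ncard_eq_one]
        refine ⟨⊤, ?_⟩
        ext I
        simp [Sn]
      rw [this]
      unfold aa
      simp [chi_one]
    · obtain ⟨p, hp, m, rfl⟩ := Nat.exists_prime_and_dvd h1
      have hm0 : m ≠ 0 := right_ne_zero_of_mul hn
      rw [aa_rec _ (fun m n => by push_cast [chi_mul]; rfl) p m hp hm0]
      have hlt : m < p * m := by
        have := hp.two_le
        have := Nat.pos_of_ne_zero hm0
        nlinarith
      rw [← ih m hlt hm0]
      have hc := cnt_rec hdeg p m hp (F := F)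
      rw [hp1 p hp] at hc
      have hc' : (cnt F (p * m) : ℝ) = (1 + chi d p) * cnt F m - (1 + chi d p - 1) *
        ((if p ∣ m then (cnt F (m / p) : ℤ) else 0 : ℤ) : ℝ) := by exact_mod_cast hc
      rw [hc']
      split_ifs with hpm
      · rw [← ih (m / p) (lt_of_le_of_lt (Nat.div_le_self _ _) hlt)
          (by
            obtain ⟨e, rfl⟩ := hpm
            rw [Nat.mul_div_cancel_left _ hp.pos]; exact right_ne_zero_of_mul hm0)]
        push_cast; ring
      · push_cast; ring

end C1proof

namespace C1proof

variable {F : Type} [Field F] [NumberField F]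

lemma sum_Icc_range (f : ℕ → ℝ) (n : ℕ) : ∑ l ∈ Finset.Icc 1 n, f l = ∑ i ∈ Finset.range n, f (i + 1) := by
  induction n with
  | zero => simp
  | succ n ih => rw [Finset.sum_Icc_succ_top (by omega), Finset.sum_range_succ, ih]

lemma zero_mean (χ : ℕ → ℝ) (q : ℕ) (hq : 1 ≤ q) (hb : ∀ n, |χ n| ≤ 1) (hp : ∀ n, χ (n + q) = χ n)
    (K : ℝ) (hK : ∀ n : ℕ, 1 ≤ n → |AA χ n| ≤ K * n) : ∑ a ∈ Finset.range q, χ a = 0 := by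
  set s := ∑ a ∈ Finset.range q, χ a with hs
  have hq0 : (0:ℝ) < q := by exact_mod_cast hq
  set ψ : ℕ → ℝ := fun l => χ l - s / q with hψ
  have hψp : ∀ n, ψ (n + q) = ψ n := fun n => by simp [hψ, hp]
  have hψ0 : ∑ a ∈ Finset.range q, ψ a = 0 := by
    simp only [hψ, Finset.sum_sub_distrib, Finset.sum_const, Finset.card_range, nsmul_eq_mul, ← hs]
    field_simp; ring
  have hψ1 : ∑ a ∈ Finset.range q, ψ (a + 1) = 0 := by
    have h1 := Finset.sum_range_succ ψ q
    have h2 := Finset.sum_range_succ' ψ q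
    have := hψp 0
    rw [zero_add] at this
    rw [h1, this, hψ0] at h2
    linarith
  have hper : Function.Periodic (fun n => ∑ i ∈ Finset.range n, ψ (i + 1)) q := by
    intro n
    simp only
    rw [add_comm n q, Finset.sum_range_add, hψ1, zero_add]
    refine Finset.sum_congr rfl fun x _ => ?_
    rw [show q + x + 1 = (x + 1) + q by ring, hψp]
  obtain ⟨b, hbb⟩ : ∃ b, ∀ n, ‖∑ i ∈ Finset.range n, ψ (i + 1)‖ ≤ b := by
    refine ⟨∑ m ∈ Finset.range q, ‖∑ i ∈ Finset.range m, ψ (i + 1)‖, fun n => ?_⟩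
    have := hper.map_mod_nat n
    beta_reduce at this
    rw [← this]
    exact Finset.single_le_sum (f := fun m => ‖∑ i ∈ Finset.range m, ψ (i + 1)‖) (fun _ _ => norm_nonneg _)
      (Finset.mem_range.mpr (Nat.mod_lt _ hq))
  have hc := Antitone.cauchySeq_series_mul_of_tendsto_zero_of_bounded (f := fun n : ℕ => 1 / ((n:ℝ) + 1))
    (z := fun i => ψ (i + 1)) (b := b)
    (fun m n hmn => one_div_le_one_div_of_le (by positivity) (by have : (m:ℝ) ≤ n := (by exact_mod_cast hmn); linarith))
    tendsto_one_div_add_atTop_nhds_zero_nat hbb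
  obtain ⟨B, hB⟩ := hc.norm_bddAbove
  have hB' : ∀ n, |∑ i ∈ Finset.range n, 1 / ((i:ℝ) + 1) * ψ (i + 1)| ≤ B := by
    intro n
    have := hB (Set.mem_range_self n)
    simpa [smul_eq_mul] using this
  by_contra hne
  have hpos : 0 < |s / q| := abs_pos.mpr (div_ne_zero hne hq0.ne')
  have hbound : ∀ n : ℕ, 1 ≤ n → |s / q| * ∑ i ∈ Finset.range n, 1 / ((i:ℝ) + 1) ≤ B + K + 1 := by
    intro n hn
    have hn0 : (0:ℝ) < n := by exact_mod_cast hn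
    have h1 : ∑ i ∈ Finset.range n, 1 / ((i:ℝ) + 1) * ψ (i + 1) =
      ∑ i ∈ Finset.range n, 1 / ((i:ℝ) + 1) * χ (i + 1) - s / q * ∑ i ∈ Finset.range n, 1 / ((i:ℝ) + 1) := by
      simp only [hψ]
      rw [Finset.mul_sum, ← Finset.sum_sub_distrib]
      exact Finset.sum_congr rfl fun i _ => by ring
    have h2 : |AA χ n - n * ∑ i ∈ Finset.range n, 1 / ((i:ℝ) + 1) * χ (i + 1)| ≤ n := by
      rw [AA_eq, sum_Icc_range, Finset.mul_sum, ← Finset.sum_sub_distrib]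
      calc _ ≤ ∑ i ∈ Finset.range n, (1:ℝ) := by
            refine (Finset.abs_sum_le_sum_abs _ _).trans (Finset.sum_le_sum fun i _ => ?_)
            have e1 : (0:ℝ) < (i:ℝ) + 1 := by positivity
            have a1 : ((n / (i + 1) : ℕ) : ℝ) ≤ (n:ℝ) / ((i:ℝ) + 1) := by
              have := Nat.cast_div_le (α := ℝ) (m := n) (n := i + 1); push_cast at this; exact this
            have a2 : (n:ℝ) / ((i:ℝ) + 1) ≤ ((n / (i + 1) : ℕ) : ℝ) + 1 := by
              rw [div_le_iff₀ e1]
              have := Nat.lt_div_mul_add (a := n) (b := i + 1) (by omega)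
              have : (n:ℝ) < ((n / (i+1) : ℕ):ℝ) * (i + 1) + (i + 1) := by exact_mod_cast this
              nlinarith
            rw [show χ (i+1) * ((n / (i + 1) : ℕ) : ℝ) - n * (1 / ((i:ℝ) + 1) * χ (i + 1)) =
              χ (i + 1) * (((n / (i + 1) : ℕ) : ℝ) - n / ((i:ℝ) + 1)) by ring, abs_mul]
            have : |((n / (i + 1) : ℕ) : ℝ) - n / ((i:ℝ) + 1)| ≤ 1 := by rw [abs_le]; constructor <;> linarith
            nlinarith [hb (i+1), abs_nonneg (χ (i+1)), abs_nonneg (((n / (i + 1) : ℕ) : ℝ) - n / ((i:ℝ) + 1))]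
        _ = n := by simp
    have h3 := hK n hn
    have h4 : |∑ i ∈ Finset.range n, 1 / ((i:ℝ) + 1) * χ (i + 1)| ≤ K + 1 := by
      set S := ∑ i ∈ Finset.range n, 1 / ((i:ℝ) + 1) * χ (i + 1)
      have : (n:ℝ) * |S| ≤ n * (K + 1) := by
        rw [show (n:ℝ) * |S| = |n * S| by rw [abs_mul, abs_of_pos hn0]]
        have := abs_sub_abs_le_abs_sub (n * S) (AA χ n)
        rw [abs_sub_comm] at h2
        linarith
      exact le_of_mul_le_mul_left this hn0
    have h5 := hB' n
    rw [h1, abs_sub_comm] at h5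
    have h6 := abs_sub_abs_le_abs_sub (s / q * ∑ i ∈ Finset.range n, 1 / ((i:ℝ) + 1)) (∑ i ∈ Finset.range n, 1 / ((i:ℝ) + 1) * χ (i + 1))
    have h7 : |s / q * ∑ i ∈ Finset.range n, 1 / ((i:ℝ) + 1)| = |s / q| * ∑ i ∈ Finset.range n, 1 / ((i:ℝ) + 1) := by
      rw [abs_mul, abs_of_nonneg (a := ∑ i ∈ Finset.range n, 1 / ((i:ℝ) + 1)) (Finset.sum_nonneg fun i _ => by positivity)]
    linarith
  have ht := (Real.tendsto_sum_range_one_div_nat_succ_atTop).const_mul_atTop hpos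
  obtain ⟨n, hn, hn1⟩ := ((ht.eventually_gt_atTop (B + K + 1)).and (Filter.eventually_ge_atTop 1)).exists
  exact absurd (hbound n hn1) (not_le.mpr hn)

noncomputable def IN (F : Type) [Field F] [NumberField F] (n : ℕ) : Finset (Ideal (𝓞 F)) :=
  (Ideal.finite_setOfPred_absNorm_le₀ (S := 𝓞 F) n).toFinset

lemma mem_IN {n : ℕ} {I : Ideal (𝓞 F)} : I ∈ IN F n ↔ 1 ≤ Ideal.absNorm I ∧ Ideal.absNorm I ≤ n := by
  rw [Nat.one_le_iff_ne_zero, Ne, Ideal.absNorm_eq_zero_iff]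
  simp [IN, and_comm]

lemma mem_IN' {n : ℕ} {I : Ideal (𝓞 F)} : I ∈ IN F n ↔ I ≠ 0 ∧ Ideal.absNorm I ≤ n := by
  rw [mem_IN, Nat.one_le_iff_ne_zero, Ne, Ideal.absNorm_eq_zero_iff]; rfl

lemma sum_IN (n : ℕ) (f : ℕ → ℝ) : ∑ I ∈ IN F n, f (Ideal.absNorm I) =
    ∑ k ∈ Finset.Icc 1 n, (cnt F k : ℝ) * f k := by
  rw [← Finset.sum_fiberwise_of_maps_to (t := Finset.Icc 1 n) (g := fun I => Ideal.absNorm I)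
    (fun I hI => Finset.mem_Icc.mpr (mem_IN.mp hI))]
  refine Finset.sum_congr rfl fun k hk => ?_
  have : ∀ I ∈ (IN F n).filter (fun I => Ideal.absNorm I = k), f (Ideal.absNorm I) = f k := by
    intro I hI; rw [(Finset.mem_filter.mp hI).2]
  rw [Finset.sum_congr rfl this, Finset.sum_const, nsmul_eq_mul]
  congr 2
  unfold cnt
  rw [← Set.ncard_coe_finset]
  congr 1
  ext I
  rw [Finset.mem_Icc] at hk
  simp only [Finset.coe_filter, mem_IN, Sn, Set.mem_ofPred_eq]
  constructor
  · rintro ⟨_, h⟩; exact h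
  · intro h; exact ⟨by rw [h]; exact hk, h⟩

lemma card_IN (x : ℝ) (hx : 0 ≤ x) : Nat.card {I : Ideal (𝓞 F) // I ≠ 0 ∧ (Ideal.absNorm I : ℝ) ≤ x} =
    (IN F ⌊x⌋₊).card := by
  rw [← Nat.card_eq_finsetCard]
  apply Nat.card_congr
  refine Equiv.subtypeEquivRight fun I => ?_
  rw [mem_IN', Nat.le_floor_iff hx]

end C1proof

namespace C1proof

variable {F : Type} [Field F] [NumberField F]

lemma AA_card (χ : ℕ → ℝ) (h : ∀ n : ℕ, n ≠ 0 → (cnt F n : ℝ) = aa χ n) (n : ℕ) :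
    AA χ n = (IN F n).card := by
  have := sum_IN (F := F) n (fun _ => 1)
  simp only [Finset.sum_const, nsmul_eq_mul, mul_one] at this
  rw [this]
  unfold AA
  exact Finset.sum_congr rfl fun k hk => (h k (by rw [Finset.mem_Icc] at hk; omega)).symm

lemma build (hdeg : Module.finrank ℚ F = 2) (ρ : ℝ)
    (hρ : ∃ c : ℝ, ∀ x : ℝ, 1 ≤ x →
      |(Nat.card {I : Ideal (𝓞 F) // I ≠ 0 ∧ (Ideal.absNorm I : ℝ) ≤ x} : ℝ) - ρ * x|
        ≤ c * x ^ ((1 : ℝ) / 3)) :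
    ∃ (χ : ℕ → ℝ) (q : ℕ) (c : ℝ), CHI χ q ρ c ∧ ∀ n : ℕ, n ≠ 0 → (cnt F n : ℝ) = aa χ n := by
  obtain ⟨d, hd, h⟩ := cnt_eq_aa (F := F) hdeg
  obtain ⟨c, hc⟩ := hρ
  set χ : ℕ → ℝ := fun k => (chi d k : ℝ) with hχ
  have hq : 1 ≤ 4 * d.natAbs := by have := Int.natAbs_pos.mpr hd; omega
  have hb : ∀ n, |χ n| ≤ 1 := fun n => by
    have := chi_abs d n
    have : ((|chi d n| : ℤ) : ℝ) ≤ 1 := by exact_mod_cast this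
    simpa [hχ] using this
  have hper : ∀ n, χ (n + 4 * d.natAbs) = χ n := fun n => by
    simp only [hχ]; rw [chi_per]
  have hland : ∀ x : ℝ, 0 < x → |AA χ ⌊x⌋₊ - ρ * x| ≤ (max c 0 + |ρ|) * x ^ ((1:ℝ)/3) := by
    intro x hx
    have hx3 : 0 ≤ x ^ ((1:ℝ)/3) := by positivity
    rcases lt_or_ge x 1 with h1 | h1
    · rw [Nat.floor_eq_zero.mpr h1]
      have : AA χ 0 = 0 := by simp [AA]
      rw [this, zero_sub, abs_neg, abs_mul, abs_of_pos hx]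
      have h2 : x ≤ x ^ ((1:ℝ)/3) := by
        have := Real.rpow_le_rpow_of_exponent_ge hx h1.le (show (1:ℝ)/3 ≤ 1 by norm_num)
        rwa [Real.rpow_one] at this
      have := le_max_right c 0
      nlinarith [abs_nonneg ρ]
    · rw [AA_card χ h, ← card_IN x hx.le]
      refine (hc x h1).trans ?_
      have := le_max_left c 0
      nlinarith [abs_nonneg ρ]
  refine ⟨χ, 4 * d.natAbs, max c 0 + |ρ|, ⟨hq, hb, hper, ?_, ?_, ?_, hland⟩, h⟩
  · refine zero_mean χ _ hq hb hper ((max c 0 + |ρ|) + |ρ|) ?_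
    intro n hn
    have hn1 : (1:ℝ) ≤ n := by exact_mod_cast hn
    have := hland n (by linarith)
    rw [Nat.floor_natCast] at this
    have h2 : (n:ℝ) ^ ((1:ℝ)/3) ≤ n := by
      have := Real.rpow_le_rpow_of_exponent_le hn1 (show (1:ℝ)/3 ≤ 1 by norm_num)
      rwa [Real.rpow_one] at this
    have h3 := abs_sub_abs_le_abs_sub (AA χ n) (ρ * n)
    rw [abs_mul ρ, abs_of_nonneg (show (0:ℝ) ≤ n by linarith)] at h3
    have h4 : 0 ≤ max c 0 + |ρ| := add_nonneg (le_max_right _ _) (abs_nonneg _)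
    nlinarith
  · intro n
    rcases Nat.eq_zero_or_pos n with rfl | hn
    · simp [aa]
    · rw [← h n hn.ne']; positivity
  · exact add_nonneg (le_max_right _ _) (abs_nonneg _)

lemma IN_lower (hdeg : Module.finrank ℚ F = 2) (M : ℕ) : M ≤ (IN F (M ^ 2)).card := by
  have : (Finset.Icc 1 M).card ≤ (IN F (M ^ 2)).card := by
    refine Finset.card_le_card_of_injOn (fun k => Ideal.span {(k : 𝓞 F)}) ?_ ?_
    · intro k hk
      have hk := Finset.mem_Icc.mp hk
      rw [Finset.mem_coe, mem_IN, norm_p hdeg]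
      exact ⟨Nat.one_le_pow _ _ hk.1, Nat.pow_le_pow_left hk.2 2⟩
    · intro a _ b _ hab
      have := congrArg Ideal.absNorm hab
      simp only [norm_p hdeg] at this
      exact Nat.pow_left_injective (by norm_num : 2 ≠ 0) this
  simpa using this

lemma rho_pos (hdeg : Module.finrank ℚ F = 2) (ρ : ℝ) (χ : ℕ → ℝ) (q : ℕ) (c : ℝ) (hC : CHI χ q ρ c)
    (h : ∀ n : ℕ, n ≠ 0 → (cnt F n : ℝ) = aa χ n) : 0 < ρ := by
  by_contra hneg
  push Not at hneg
  obtain ⟨k, hk⟩ := exists_nat_gt (max c 1)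
  have hk1 : (1:ℝ) < k := lt_of_le_of_lt (le_max_right _ _) hk
  have hkc : c < k := lt_of_le_of_lt (le_max_left _ _) hk
  have hk0 : (0:ℝ) ≤ k := by linarith
  have h1 := hC.land (k ^ 6) (by positivity)
  have h2 : ⌊((k:ℝ) ^ 6)⌋₊ = (k ^ 3) ^ 2 := by
    rw [show (k:ℝ) ^ 6 = (((k ^ 3) ^ 2 : ℕ) : ℝ) by push_cast; ring, Nat.floor_natCast]
  have h3 : ((k:ℝ) ^ 6) ^ ((1:ℝ)/3) = k ^ 2 := by
    rw [show (k:ℝ) ^ 6 = ((k:ℝ)^2) ^ (3:ℕ) by ring, show ((1:ℝ)/3) = ((3:ℕ):ℝ)⁻¹ by norm_num,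
      Real.pow_rpow_inv_natCast (by positivity) (by norm_num)]
  rw [h2, h3, AA_card χ h] at h1
  have h4 : ((k:ℝ)^3) ≤ (IN F ((k ^ 3) ^ 2)).card := by exact_mod_cast IN_lower hdeg (k^3)
  have h5 := (abs_le.mp h1).2
  have h6 : ρ * (k:ℝ)^6 ≤ 0 := mul_nonpos_of_nonpos_of_nonneg hneg (by positivity)
  have h7 : (k:ℝ)^3 ≤ c * k^2 := by linarith
  have h8 : (0:ℝ) < k^2 := by positivity
  nlinarith

end C1proof

namespace C1proof

variable {F : Type} [Field F] [NumberField F]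

lemma mu_abs (e : Ideal (𝓞 F)) : |(idealMu e : ℝ)| ≤ 1 := by
  unfold idealMu
  split_ifs
  · push_cast; rw [abs_pow]; simp
  · simp

lemma mu_one : idealMu (1 : Ideal (𝓞 F)) = 1 := by
  unfold idealMu
  rw [if_pos squarefree_one, UniqueFactorizationMonoid.factors_one]; simp

lemma mu_prime_mul (P e : Ideal (𝓞 F)) (hP : Prime P) (h0 : e ≠ 0) (h : ¬ P ∣ e) : idealMu (P * e) = - idealMu e := by
  unfold idealMu
  have hrel : IsRelPrime P e := hP.irreducible.isRelPrime_iff_not_dvd.mpr h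
  have hsq : Squarefree (P * e) ↔ Squarefree e := by
    rw [squarefree_mul_iff]
    exact ⟨fun h => h.2.2, fun h => ⟨hrel, hP.irreducible.squarefree, h⟩⟩
  by_cases hs : Squarefree e
  · rw [if_pos (hsq.mpr hs), if_pos hs]
    simp only [UniqueFactorizationMonoid.factors_eq_normalizedFactors]
    rw [UniqueFactorizationMonoid.normalizedFactors_mul hP.ne_zero h0,
      UniqueFactorizationMonoid.normalizedFactors_irreducible hP.irreducible]
    simp [pow_add]
  · rw [if_neg (fun h => hs (hsq.mp h)), if_neg hs]; simp

lemma mu_prime_sq (P e : Ideal (𝓞 F)) (hP : Prime P) (h : P ∣ e) : idealMu (P * e) = 0 := by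
  unfold idealMu
  rw [if_neg]
  intro hs
  obtain ⟨f, rfl⟩ := h
  have := hs P (by rw [← mul_assoc]; exact Dvd.intro _ rfl)
  exact hP.not_isUnit this

lemma norm_ne {I : Ideal (𝓞 F)} : Ideal.absNorm I ≠ 0 ↔ I ≠ 0 := by
  rw [Ne, Ideal.absNorm_eq_zero_iff]; rfl

noncomputable def Dv (m : Ideal (𝓞 F)) : Finset (Ideal (𝓞 F)) := (IN F (Ideal.absNorm m)).filter (fun e => e ∣ m)

lemma mem_Dv {m e : Ideal (𝓞 F)} (hm : m ≠ 0) : e ∈ Dv m ↔ e ∣ m := by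
  unfold Dv
  rw [Finset.mem_filter, mem_IN']
  refine ⟨fun h => h.2, fun h => ⟨⟨ne_zero_of_dvd_ne_zero hm h, ?_⟩, h⟩⟩
  exact Nat.le_of_dvd (Nat.pos_of_ne_zero (norm_ne.mpr hm)) (Ideal.absNorm_dvd_absNorm_of_le (Ideal.le_of_dvd h))

lemma mobius (m : Ideal (𝓞 F)) (hm : m ≠ 0) : ∑ e ∈ Dv m, idealMu e = if m = 1 then 1 else 0 := by
  split_ifs with h1
  · subst h1
    have : Dv (1 : Ideal (𝓞 F)) = {1} := by
      ext e
      rw [mem_Dv hm, Finset.mem_singleton, ← isUnit_iff_dvd_one, isUnit_iff_eq_one]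
    rw [this, Finset.sum_singleton, mu_one]
  · obtain ⟨P, hPi, hPm⟩ := WfDvdMonoid.exists_irreducible_factor (a := m) (by rwa [isUnit_iff_eq_one]) hm
    have hP : Prime P := hPi.prime
    rw [← Finset.sum_filter_add_sum_filter_not (Dv m) (fun e => P ∣ e)]
    have : ∑ e ∈ (Dv m).filter (fun e => P ∣ e), idealMu e = ∑ e ∈ ((Dv m).filter (fun e => ¬ P ∣ e)).image (fun e => P * e), idealMu e := by
      symm
      apply Finset.sum_subset
      · intro e he
        rw [Finset.mem_image] at he
        obtain ⟨f, hf, rfl⟩ := he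
        rw [Finset.mem_filter, mem_Dv hm] at hf ⊢
        refine ⟨?_, Dvd.intro _ rfl⟩
        obtain ⟨⟨g, rfl⟩, h2⟩ := hf
        rw [mul_comm]
        exact mul_dvd_mul_left _ ((hP.dvd_or_dvd hPm).resolve_left h2)
      · intro e he hn
        rw [Finset.mem_filter, mem_Dv hm] at he
        obtain ⟨h2, f, rfl⟩ := he
        apply mu_prime_sq _ _ hP
        by_contra h3
        apply hn
        rw [Finset.mem_image]
        refine ⟨f, ?_, rfl⟩
        rw [Finset.mem_filter, mem_Dv hm]
        exact ⟨dvd_of_mul_left_dvd h2, h3⟩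
    rw [this, Finset.sum_image (fun a _ b _ h => mul_left_cancel₀ hP.ne_zero h), ← Finset.sum_add_distrib]
    apply Finset.sum_eq_zero
    intro e he
    rw [Finset.mem_filter, mem_Dv hm] at he
    rw [mu_prime_mul P e hP (ne_zero_of_dvd_ne_zero hm he.1) he.2]
    ring

noncomputable def PRs (F : Type) [Field F] [NumberField F] (x : ℕ) : Finset (Ideal (𝓞 F) × Ideal (𝓞 F)) :=
  ((IN F x) ×ˢ (IN F x)).filter (fun p => Ideal.absNorm p.1 * Ideal.absNorm p.2 ≤ x)

lemma mem_PRs {x : ℕ} {p : Ideal (𝓞 F) × Ideal (𝓞 F)} : p ∈ PRs F x ↔ p.1 * p.2 ∈ IN F x := by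
  unfold PRs
  rw [Finset.mem_filter, Finset.mem_product, mem_IN', mem_IN', mem_IN', map_mul, mul_ne_zero_iff]
  constructor
  · rintro ⟨⟨h1, h2⟩, h3⟩
    exact ⟨⟨h1.1, h2.1⟩, h3⟩
  · rintro ⟨⟨h1, h2⟩, h3⟩
    have a1 := Nat.pos_of_ne_zero (norm_ne.mpr h1)
    have a2 := Nat.pos_of_ne_zero (norm_ne.mpr h2)
    exact ⟨⟨⟨h1, (Nat.le_mul_of_pos_right _ a2).trans h3⟩, ⟨h2, (Nat.le_mul_of_pos_left _ a1).trans h3⟩⟩, h3⟩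

lemma sum_PRs_mul (x : ℕ) (f : Ideal (𝓞 F) × Ideal (𝓞 F) → ℝ) :
    ∑ p ∈ PRs F x, f p = ∑ m ∈ IN F x, ∑ p ∈ (PRs F x).filter (fun p => p.1 * p.2 = m), f p :=
  (Finset.sum_fiberwise_of_maps_to (fun _ hp => mem_PRs.mp hp) f).symm

lemma sum_PRs_e (x : ℕ) (f : Ideal (𝓞 F) × Ideal (𝓞 F) → ℝ) :
    ∑ p ∈ PRs F x, f p = ∑ e ∈ IN F x, ∑ d ∈ IN F (x / Ideal.absNorm e), f (d, e) := by
  rw [Finset.sum_sigma', ]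
  refine Finset.sum_bij' (fun p _ => ⟨p.2, p.1⟩) (fun s _ => (s.2, s.1)) ?_ ?_ ?_ ?_ ?_
  · intro p hp
    have hp' := hp
    unfold PRs at hp
    rw [Finset.mem_filter, Finset.mem_product] at hp
    rw [Finset.mem_sigma]
    refine ⟨hp.1.2, ?_⟩
    rw [mem_IN]
    exact ⟨(mem_IN.mp hp.1.1).1, (Nat.le_div_iff_mul_le (mem_IN.mp hp.1.2).1).mpr hp.2⟩
  · rintro ⟨e, d⟩ hs
    rw [Finset.mem_sigma] at hs
    simp only at hs ⊢
    have he := mem_IN.mp hs.1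
    have hd := mem_IN.mp hs.2
    rw [mem_PRs, mem_IN, map_mul]
    exact ⟨Nat.mul_pos hd.1 he.1, (Nat.le_div_iff_mul_le he.1).mp hd.2⟩
  · intros; rfl
  · intros; rfl
  · intros; rfl

lemma ram_eq (x : ℕ) (m n : Ideal (𝓞 F)) (hm : m ∈ IN F x) : (ramanujanSum m n : ℝ) =
    ∑ p ∈ (PRs F x).filter (fun p => p.1 * p.2 = m), if p.1 ∣ n then (Ideal.absNorm p.1 : ℝ) * idealMu p.2 else 0 := by
  unfold ramanujanSum
  have : {p : Ideal (𝓞 F) × Ideal (𝓞 F) | p.1 * p.2 = m ∧ p.1 ∣ n} =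
    ↑(((PRs F x).filter (fun p => p.1 * p.2 = m)).filter (fun p => p.1 ∣ n)) := by
    ext p
    rw [Finset.mem_coe, Finset.mem_filter, Finset.mem_filter, mem_PRs]
    constructor
    · rintro ⟨h1, h2⟩; exact ⟨⟨by rw [h1]; exact hm, h1⟩, h2⟩
    · rintro ⟨⟨_, h1⟩, h2⟩; exact ⟨h1, h2⟩
  rw [this, finsum_mem_coe_finset, Finset.sum_filter]
  push_cast
  rfl

lemma card_dvd (y : ℕ) (d : Ideal (𝓞 F)) (hd : d ≠ 0) :
    ((IN F y).filter (fun n => d ∣ n)).card = (IN F (y / Ideal.absNorm d)).card := by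
  symm
  have hN := Nat.pos_of_ne_zero (norm_ne.mpr hd)
  refine Finset.card_bij (fun e _ => d * e) ?_ ?_ ?_
  · intro e he
    rw [mem_IN, Nat.le_div_iff_mul_le hN] at he
    rw [Finset.mem_filter, mem_IN, map_mul]
    exact ⟨⟨Nat.mul_pos hN he.1, by rw [mul_comm]; exact he.2⟩, Dvd.intro _ rfl⟩
  · intro a _ b _ h
    exact mul_left_cancel₀ hd h
  · intro n hn
    rw [Finset.mem_filter, mem_IN] at hn
    obtain ⟨⟨h1, h2⟩, e, rfl⟩ := hn
    refine ⟨e, ?_, rfl⟩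
    rw [map_mul] at h1 h2
    rw [mem_IN, Nat.le_div_iff_mul_le hN]
    exact ⟨Nat.pos_of_mul_pos_left h1, by rw [mul_comm]; exact h2⟩

lemma C1_eq (X Y : ℝ) (hX : 0 ≤ X) (hY : 0 ≤ Y) : (C1 F X Y : ℝ) =
    ∑ e ∈ IN F ⌊X⌋₊, (idealMu e : ℝ) * ∑ d ∈ IN F (⌊X⌋₊ / Ideal.absNorm e),
      (Ideal.absNorm d : ℝ) * (IN F (⌊Y⌋₊ / Ideal.absNorm d)).card := by
  have hs : ∀ Z : ℝ, 0 ≤ Z → {n : Ideal (𝓞 F) | n ≠ 0 ∧ (Ideal.absNorm n : ℝ) ≤ Z} = ↑(IN F ⌊Z⌋₊) := by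
    intro Z hZ
    ext n
    rw [Finset.mem_coe, mem_IN', Nat.le_floor_iff hZ]; rfl
  unfold C1
  rw [hs Y hY, hs X hX, finsum_mem_coe_finset]
  simp only [finsum_mem_coe_finset]
  push_cast
  have h1 : ∀ n ∈ IN F ⌊Y⌋₊, ∑ m ∈ IN F ⌊X⌋₊, (ramanujanSum m n : ℝ) =
      ∑ p ∈ PRs F ⌊X⌋₊, if p.1 ∣ n then (Ideal.absNorm p.1 : ℝ) * idealMu p.2 else 0 := by
    intro n _
    rw [sum_PRs_mul]
    exact Finset.sum_congr rfl fun m hm => ram_eq _ m n hm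
  rw [Finset.sum_congr rfl h1, Finset.sum_comm]
  have h2 : ∀ p ∈ PRs F ⌊X⌋₊, (∑ n ∈ IN F ⌊Y⌋₊, if p.1 ∣ n then (Ideal.absNorm p.1 : ℝ) * idealMu p.2 else 0) =
    (idealMu p.2 : ℝ) * ((Ideal.absNorm p.1 : ℝ) * (IN F (⌊Y⌋₊ / Ideal.absNorm p.1)).card) := by
    intro p hp
    have hp0 : p.1 ≠ 0 := by
      have := (mem_IN'.mp (mem_PRs.mp hp)).1
      exact left_ne_zero_of_mul this
    rw [← Finset.sum_filter, Finset.sum_const, nsmul_eq_mul, card_dvd _ _ hp0]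
    ring
  rw [Finset.sum_congr rfl h2, sum_PRs_e]
  exact Finset.sum_congr rfl fun e _ => by rw [Finset.mul_sum]

lemma main_term (x : ℕ) (hx : 1 ≤ x) :
    ∑ e ∈ IN F x, (idealMu e : ℝ) * (IN F (x / Ideal.absNorm e)).card = 1 := by
  have h1 : ∑ e ∈ IN F x, (idealMu e : ℝ) * (IN F (x / Ideal.absNorm e)).card = ∑ p ∈ PRs F x, (idealMu p.2 : ℝ) := by
    rw [sum_PRs_e]
    refine Finset.sum_congr rfl fun e _ => ?_
    simp only [Finset.sum_const, nsmul_eq_mul]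
    exact mul_comm _ _
  rw [h1, sum_PRs_mul]
  have h2 : ∀ m ∈ IN F x, ∑ p ∈ (PRs F x).filter (fun p => p.1 * p.2 = m), (idealMu p.2 : ℝ) = if m = 1 then 1 else 0 := by
    intro m hm
    have hm0 : m ≠ 0 := (mem_IN'.mp hm).1
    have : ((∑ e ∈ Dv m, idealMu e : ℤ) : ℝ) = if m = 1 then 1 else 0 := by
      rw [mobius m hm0]; split_ifs <;> simp
    rw [← this]
    push_cast
    refine Finset.sum_bij (fun p _ => p.2) ?_ ?_ ?_ ?_
    · intro p hp
      rw [Finset.mem_filter] at hp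
      rw [mem_Dv hm0, ← hp.2]; exact Dvd.intro_left _ rfl
    · intro a ha b hb hab
      rw [Finset.mem_filter] at ha hb
      have h0 : a.2 ≠ 0 := by
        rw [← ha.2] at hm0; exact right_ne_zero_of_mul hm0
      have : a.1 * a.2 = b.1 * a.2 := by rw [ha.2, hab, hb.2]
      exact Prod.ext (mul_right_cancel₀ h0 this) hab
    · intro e he
      rw [mem_Dv hm0] at he
      obtain ⟨d, hd⟩ := he
      refine ⟨(d, e), ?_, rfl⟩
      rw [Finset.mem_filter, mem_PRs]
      have : d * e = m := by rw [hd, mul_comm]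
      exact ⟨by rw [this]; exact hm, this⟩
    · intros; rfl
  rw [Finset.sum_congr rfl h2, Finset.sum_ite_eq' , if_pos]
  rw [mem_IN]
  simp [hx]

end C1proof

namespace C1proof

variable {F : Type} [Field F] [NumberField F]

lemma abel_k (b : ℕ → ℝ) (D : ℕ) : ∑ k ∈ Finset.Ioc 0 D, (k:ℝ) * b k =
    D * ∑ k ∈ Finset.Ioc 0 D, b k - ∑ j ∈ Finset.range D, ∑ k ∈ Finset.Ioc 0 j, b k := by
  induction D with
  | zero => simp
  | succ D ih =>
    rw [Finset.sum_Ioc_succ_top (Nat.zero_le _), Finset.sum_Ioc_succ_top (Nat.zero_le _), Finset.sum_range_succ, ih]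
    push_cast; ring

lemma abel_bd (b : ℕ → ℝ) (D : ℕ) (B : ℝ) (hB : ∀ j ≤ D, |∑ k ∈ Finset.Ioc 0 j, b k| ≤ B) :
    |∑ k ∈ Finset.Ioc 0 D, (k:ℝ) * b k| ≤ 2 * D * B := by
  rw [abel_k]
  have h1 : |∑ j ∈ Finset.range D, ∑ k ∈ Finset.Ioc 0 j, b k| ≤ D * B := by
    refine (Finset.abs_sum_le_sum_abs _ _).trans ?_
    refine (Finset.sum_le_sum fun j hj => hB j (Finset.mem_range.mp hj).le).trans ?_
    simp
  have h2 : |(D:ℝ) * ∑ k ∈ Finset.Ioc 0 D, b k| ≤ D * B := by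
    rw [abs_mul, abs_of_nonneg (Nat.cast_nonneg D)]
    exact mul_le_mul_of_nonneg_left (hB D le_rfl) (Nat.cast_nonneg D)
  have := abs_sub ((D:ℝ) * ∑ k ∈ Finset.Ioc 0 D, b k) (∑ j ∈ Finset.range D, ∑ k ∈ Finset.Ioc 0 j, b k)
  linarith

lemma abel_inv (χ : ℕ → ℝ) (n : ℕ) : ∑ k ∈ Finset.Icc 1 n, aa χ k * (1 / (k:ℝ)) =
    AA χ n / (n + 1) + ∑ k ∈ Finset.Icc 1 n, AA χ k / ((k:ℝ) * (k + 1)) := by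
  induction n with
  | zero => simp [AA]
  | succ n ih =>
    rw [Finset.sum_Icc_succ_top (by omega), Finset.sum_Icc_succ_top (by omega), ih]
    have : AA χ (n + 1) = AA χ n + aa χ (n + 1) := by
      unfold AA; rw [Finset.sum_Icc_succ_top (by omega)]
    rw [this]
    push_cast
    field_simp
    ring

lemma sum_inv (χ : ℕ → ℝ) (q : ℕ) (ρ c : ℝ) (h : CHI χ q ρ c) (n : ℕ) (hn : 1 ≤ n) :
    ∑ k ∈ Finset.Icc 1 n, aa χ k * (1 / (k:ℝ)) ≤ 2 * (|ρ| + c) * (1 + Real.log n) := by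
  have hK : 0 ≤ |ρ| + c := add_nonneg (abs_nonneg _) h.c_nonneg
  have hA : ∀ k : ℕ, 1 ≤ k → AA χ k ≤ (|ρ| + c) * k := by
    intro k hk
    have := AA_bd h k (by exact_mod_cast hk)
    rwa [Nat.floor_natCast] at this
  rw [abel_inv]
  have h1 : AA χ n / (n + 1) ≤ |ρ| + c := by
    rw [div_le_iff₀ (by positivity)]
    have := hA n hn
    nlinarith
  have h2 : ∑ k ∈ Finset.Icc 1 n, AA χ k / ((k:ℝ) * (k + 1)) ≤ (|ρ| + c) * (1 + Real.log n) := by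
    refine le_trans ?_ (mul_le_mul_of_nonneg_left (harm_le n n le_rfl) hK)
    rw [Finset.mul_sum]
    refine Finset.sum_le_sum fun k hk => ?_
    have hk1 := (Finset.mem_Icc.mp hk).1
    have hk0 : (0:ℝ) < k := by exact_mod_cast hk1
    rw [mul_one_div, div_le_div_iff₀ (by positivity) hk0]
    have := hA k hk1
    have e := mul_le_mul_of_nonneg_right this hk0.le
    have : 0 ≤ (|ρ| + c) * k * k * k := by positivity
    nlinarith
  have h3 : 0 ≤ Real.log n := Real.log_natCast_nonneg n
  nlinarith

lemma error (χ : ℕ → ℝ) (q : ℕ) (ρ c : ℝ) (h : CHI χ q ρ c)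
    (hc : ∀ n : ℕ, n ≠ 0 → (cnt F n : ℝ) = aa χ n) :
    ∃ K : ℝ, 0 < K ∧ ∀ X Y : ℝ, 1 ≤ X → X ^ 2 ≤ Y →
      |(C1 F X Y : ℝ) - ρ * Y| ≤ K * (X * √Y * (1 + Real.log Y) ^ 6) + |ρ| := by
  obtain ⟨C, hC, hT⟩ := T_bd h
  have hK0 : 0 ≤ |ρ| + c := add_nonneg (abs_nonneg _) h.c_nonneg
  refine ⟨4 * C * (|ρ| + c) + 1, by positivity, ?_⟩
  intro X Y hX hXY
  have hY1 : 1 ≤ Y := by nlinarith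
  have hX0 : 0 ≤ X := by linarith
  have hY0 : 0 ≤ Y := by linarith
  rw [C1_eq X Y hX0 hY0]
  set x := ⌊X⌋₊ with hx
  set y := ⌊Y⌋₊ with hy
  have hxX : (x:ℝ) ≤ X := Nat.floor_le hX0
  have hyY : (y:ℝ) ≤ Y := Nat.floor_le hY0
  have hyY' : Y < y + 1 := Nat.lt_floor_add_one Y
  have hx1 : 1 ≤ x := Nat.le_floor (by simpa using hX)
  have hy1 : 1 ≤ y := Nat.le_floor (by simpa using hY1)
  have hxy : x ^ 2 ≤ y := by
    apply Nat.le_floor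
    push_cast
    nlinarith
  set B := C * (√(y:ℝ) * (1 + Real.log y) ^ 5) with hB
  have hly : 0 ≤ Real.log y := Real.log_natCast_nonneg y
  have hB0 : 0 ≤ B := by positivity
  have hfl : ∀ k : ℕ, 1 ≤ k → ⌊((y:ℝ) + 1/2) / k⌋₊ = y / k := by
    intro k hk
    have : ⌊((y:ℝ) + 1/2)⌋₊ = y := by
      rw [Nat.floor_eq_iff (by positivity)]
      constructor <;> linarith
    rw [Nat.floor_div_natCast, this]
  have inner : ∀ D : ℕ, ∑ d ∈ IN F D, (Ideal.absNorm d : ℝ) * (IN F (y / Ideal.absNorm d)).card =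
      ∑ k ∈ Finset.Ioc 0 D, (k:ℝ) * (aa χ k * Dl χ ρ (((y:ℝ) + 1/2) / k)) + ρ * (y + 1/2) * (IN F D).card := by
    intro D
    rw [sum_IN D (fun k => (k:ℝ) * ((IN F (y / k)).card : ℝ)), ← AA_card χ hc D]
    unfold AA
    rw [Finset.mul_sum, show Finset.Ioc 0 D = Finset.Icc 1 D from rfl, ← Finset.sum_add_distrib]
    refine Finset.sum_congr rfl fun k hk => ?_
    have hk1 := (Finset.mem_Icc.mp hk).1
    have hk0 : (k:ℝ) ≠ 0 := by positivity
    rw [← AA_card χ hc, hc k (by omega)]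
    unfold Dl
    rw [hfl k hk1]
    field_simp
    ring
  have hsplit : ∑ e ∈ IN F x, (idealMu e : ℝ) * ∑ d ∈ IN F (x / Ideal.absNorm e),
      (Ideal.absNorm d : ℝ) * (IN F (y / Ideal.absNorm d)).card =
      ∑ e ∈ IN F x, (idealMu e : ℝ) * ∑ k ∈ Finset.Ioc 0 (x / Ideal.absNorm e), (k:ℝ) * (aa χ k * Dl χ ρ (((y:ℝ) + 1/2) / k))
        + ρ * (y + 1/2) := by
    have hm := main_term (F := F) x hx1
    calc _ = ∑ e ∈ IN F x, ((idealMu e : ℝ) * ∑ k ∈ Finset.Ioc 0 (x / Ideal.absNorm e), (k:ℝ) * (aa χ k * Dl χ ρ (((y:ℝ) + 1/2) / k))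
          + ρ * (y + 1/2) * ((idealMu e : ℝ) * (IN F (x / Ideal.absNorm e)).card)) := by
            refine Finset.sum_congr rfl fun e _ => ?_
            rw [inner]; ring
      _ = _ := by
            rw [Finset.sum_add_distrib, ← Finset.mul_sum, hm, mul_one]
  rw [hsplit]
  have hE : |∑ e ∈ IN F x, (idealMu e : ℝ) * ∑ k ∈ Finset.Ioc 0 (x / Ideal.absNorm e), (k:ℝ) * (aa χ k * Dl χ ρ (((y:ℝ) + 1/2) / k))|
      ≤ 2 * x * B * (2 * (|ρ| + c) * (1 + Real.log x)) := by
    calc _ ≤ ∑ e ∈ IN F x, 2 * x * B * (1 / (Ideal.absNorm e : ℝ)) := by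
          refine (Finset.abs_sum_le_sum_abs _ _).trans (Finset.sum_le_sum fun e _ => ?_)
          rw [abs_mul]
          have h1 := mu_abs e
          have h2 : |∑ k ∈ Finset.Ioc 0 (x / Ideal.absNorm e), (k:ℝ) * (aa χ k * Dl χ ρ (((y:ℝ) + 1/2) / k))| ≤
              2 * (x / Ideal.absNorm e : ℕ) * B := by
            apply abel_bd
            intro j hj
            refine hT y j hy1 (le_trans ?_ hxy)
            exact Nat.pow_le_pow_left (hj.trans (Nat.div_le_self _ _)) 2
          have h3 : ((x / Ideal.absNorm e : ℕ) : ℝ) ≤ x * (1 / (Ideal.absNorm e : ℝ)) := by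
            rw [mul_one_div]; exact Nat.cast_div_le
          calc _ ≤ 1 * (2 * (x / Ideal.absNorm e : ℕ) * B) := mul_le_mul h1 h2 (abs_nonneg _) zero_le_one
            _ ≤ 2 * x * B * (1 / (Ideal.absNorm e : ℝ)) := by nlinarith
      _ = 2 * x * B * ∑ k ∈ Finset.Icc 1 x, aa χ k * (1 / (k:ℝ)) := by
          rw [← Finset.mul_sum, sum_IN x (fun k => 1 / (k:ℝ))]
          congr 1
          exact Finset.sum_congr rfl fun k hk => by rw [hc k (by rw [Finset.mem_Icc] at hk; omega)]
      _ ≤ _ := mul_le_mul_of_nonneg_left (sum_inv χ q ρ c h x hx1) (by positivity)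
  have hlY : Real.log y ≤ Real.log Y := Real.log_le_log (by exact_mod_cast hy1) hyY
  have hxyl : Real.log x ≤ Real.log y := by
    apply Real.log_le_log (by exact_mod_cast hx1)
    have : x ≤ y := by nlinarith
    exact_mod_cast this
  have hsq : √(y:ℝ) ≤ √Y := Real.sqrt_le_sqrt hyY
  have hlx : 0 ≤ Real.log x := Real.log_natCast_nonneg x
  have hlY0 : 0 ≤ Real.log Y := hly.trans hlY
  have hE2 : 2 * x * B * (2 * (|ρ| + c) * (1 + Real.log x)) ≤ (4 * C * (|ρ| + c) + 1) * (X * √Y * (1 + Real.log Y) ^ 6) := by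
    calc 2 * x * B * (2 * (|ρ| + c) * (1 + Real.log x)) = (4 * C * (|ρ| + c)) * ((x * √(y:ℝ)) * ((1 + Real.log y) ^ 5 * (1 + Real.log x))) := by
          rw [hB]; ring
      _ ≤ (4 * C * (|ρ| + c)) * ((X * √Y) * ((1 + Real.log Y) ^ 5 * (1 + Real.log Y))) := by
          gcongr
          nlinarith
      _ ≤ (4 * C * (|ρ| + c) + 1) * (X * √Y * (1 + Real.log Y) ^ 6) := by
          have : 0 ≤ Real.log Y := hly.trans hlY
          have : 0 ≤ X * √Y * (1 + Real.log Y) ^ 6 := by positivity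
          nlinarith
  have hE3 : |ρ * (y + 1/2) - ρ * Y| ≤ |ρ| := by
    rw [← mul_sub, abs_mul]
    have : |(y:ℝ) + 1/2 - Y| ≤ 1 := by rw [abs_le]; constructor <;> linarith
    nlinarith [abs_nonneg ρ]
  set S := ∑ e ∈ IN F x, (idealMu e : ℝ) * ∑ k ∈ Finset.Ioc 0 (x / Ideal.absNorm e), (k:ℝ) * (aa χ k * Dl χ ρ (((y:ℝ) + 1/2) / k))
  have : |S + ρ * (y + 1/2) - ρ * Y| ≤ |S| + |ρ * (y + 1/2) - ρ * Y| := by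
    rw [add_sub_assoc]; exact abs_add_le _ _
  linarith

lemma growth (δ : ℝ) (hδ : 0 < δ) : ∃ X₀ : ℝ, 3 ≤ X₀ ∧ ∀ X Y : ℝ, X₀ ≤ X →
    X ^ 2 * Real.log X ^ 14 ≤ Y → X * √Y * (1 + Real.log Y) ^ 6 ≤ δ * Y := by
  have h1 : ∀ᶠ Y : ℝ in Filter.atTop, (1 + Real.log Y) ^ 6 ≤ δ * √(√Y) := by
    have hlo : (fun Y : ℝ => 1 + Real.log Y) =o[Filter.atTop] (fun Y : ℝ => Y ^ ((1:ℝ)/24)) := by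
      refine Asymptotics.IsLittleO.add ?_ (isLittleO_log_rpow_atTop (by norm_num))
      rw [Asymptotics.isLittleO_const_left]
      right
      exact tendsto_norm_atTop_atTop.comp (tendsto_rpow_atTop (by norm_num))
    have h6 := hlo.pow (n := 6) (by norm_num)
    have := h6.def hδ
    filter_upwards [this, Filter.eventually_ge_atTop 1] with Y hY hY1
    have hY0 : (0:ℝ) ≤ Y := by linarith
    rw [Real.norm_eq_abs, Real.norm_eq_abs] at hY
    refine (le_abs_self _).trans (hY.trans (le_of_eq ?_))
    congr 1
    rw [abs_of_nonneg (by positivity), ← Real.rpow_natCast, ← Real.rpow_mul hY0, Real.sqrt_eq_rpow, Real.sqrt_eq_rpow, ← Real.rpow_mul hY0]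
    norm_num
  obtain ⟨Y₁, hY₁⟩ := Filter.eventually_atTop.mp h1
  have h2 : ∀ᶠ X : ℝ in Filter.atTop, max 1 (5 ^ 6 / δ) ≤ Real.log X := Real.tendsto_log_atTop.eventually_ge_atTop _
  obtain ⟨X₁, hX₁⟩ := Filter.eventually_atTop.mp h2
  refine ⟨max 3 (max X₁ Y₁), le_max_left _ _, ?_⟩
  intro X Y hX hXY
  have hX3 : 3 ≤ X := (le_max_left _ _).trans hX
  have hXX : X₁ ≤ X := (le_max_left _ _).trans ((le_max_right _ _).trans hX)
  have hXY1 : Y₁ ≤ X := (le_max_right _ _).trans ((le_max_right _ _).trans hX)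
  have hl := hX₁ X hXX
  have hl1 : 1 ≤ Real.log X := (le_max_left _ _).trans hl
  have hl2 : 5 ^ 6 / δ ≤ Real.log X := (le_max_right _ _).trans hl
  have hX2Y : X ^ 2 ≤ Y := by
    have : 1 ≤ Real.log X ^ 14 := one_le_pow₀ hl1
    nlinarith [sq_nonneg X]
  have hYX : X ≤ Y := by nlinarith
  have hY0 : 0 < Y := by linarith
  have hlY : 0 ≤ Real.log Y := Real.log_nonneg (by linarith)
  have hs : √Y * √Y = Y := Real.mul_self_sqrt hY0.le
  have hs0 : 0 < √Y := Real.sqrt_pos.mpr hY0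
  have key : X * (1 + Real.log Y) ^ 6 ≤ δ * √Y := by
    rcases le_or_gt (X ^ 4) Y with h4 | h4
    · have hb := hY₁ Y (hXY1.trans hYX)
      have hXq : X ≤ √(√Y) := by
        apply Real.le_sqrt_of_sq_le
        apply Real.le_sqrt_of_sq_le
        calc (X ^ 2) ^ 2 = X ^ 4 := by ring
          _ ≤ Y := h4
      calc X * (1 + Real.log Y) ^ 6 ≤ √(√Y) * (δ * √(√Y)) := mul_le_mul hXq hb (by positivity) (by positivity)
        _ = δ * (√(√Y) * √(√Y)) := by ring
        _ = δ * √Y := by rw [Real.mul_self_sqrt hs0.le]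
    · have hlog : Real.log Y ≤ 4 * Real.log X := by
        have := Real.log_le_log hY0 h4.le
        rw [Real.log_pow] at this
        exact_mod_cast this
      have hsY : X * Real.log X ^ 7 ≤ √Y := by
        apply Real.le_sqrt_of_sq_le
        calc (X * Real.log X ^ 7) ^ 2 = X ^ 2 * Real.log X ^ 14 := by ring
          _ ≤ Y := hXY
      have h5 : 5 ^ 6 ≤ δ * Real.log X := by
        rw [div_le_iff₀ hδ] at hl2; linarith
      calc X * (1 + Real.log Y) ^ 6 ≤ X * (5 * Real.log X) ^ 6 := by
            gcongr; linarith
        _ = X * Real.log X ^ 6 * 5 ^ 6 := by ring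
        _ ≤ X * Real.log X ^ 6 * (δ * Real.log X) := by gcongr
        _ = δ * (X * Real.log X ^ 7) := by ring
        _ ≤ δ * √Y := by gcongr
  calc X * √Y * (1 + Real.log Y) ^ 6 = √Y * (X * (1 + Real.log Y) ^ 6) := by ring
    _ ≤ √Y * (δ * √Y) := by gcongr
    _ = δ * Y := by rw [mul_left_comm, hs]

end C1proof

theorem C1_asymptotic_equiv (F : Type) [Field F] [NumberField F]
    (hdeg : Module.finrank ℚ F = 2) (ρ : ℝ)
    (hρ : ∃ c : ℝ, ∀ x : ℝ, 1 ≤ x →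
      |(Nat.card {I : Ideal (𝓞 F) // I ≠ 0 ∧ (Ideal.absNorm I : ℝ) ≤ x} : ℝ) - ρ * x|
        ≤ c * x ^ ((1 : ℝ) / 3))
    (lam : ℝ → ℝ) (hlam_mono : Monotone lam)
    (hlam_top : Filter.Tendsto lam Filter.atTop Filter.atTop)
    (hlam_o : lam =o[Filter.atTop] Real.log) :
    ∀ ε : ℝ, 0 < ε → ∃ X₀ : ℝ, 3 ≤ X₀ ∧ ∀ X Y : ℝ, X₀ ≤ X →
      X ^ 2 * Real.log X ^ 14 * lam X ≤ Y →
      |(C1 F X Y : ℝ) - ρ * Y| ≤ ε * (|ρ| * Y) := by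
  obtain ⟨χ, q, c, hC, hcnt⟩ := C1proof.build hdeg ρ hρ
  have hρ0 := C1proof.rho_pos hdeg ρ χ q c hC hcnt
  obtain ⟨K, hK, hE⟩ := C1proof.error χ q ρ c hC hcnt
  intro ε hε
  obtain ⟨X₁, hX₁, hg⟩ := C1proof.growth (ε * ρ / (2 * K)) (by positivity)
  obtain ⟨X₂, hX₂⟩ := Filter.eventually_atTop.mp (hlam_top.eventually_ge_atTop 1)
  obtain ⟨X₃, hX₃⟩ := Filter.eventually_atTop.mp (Real.tendsto_log_atTop.eventually_ge_atTop 1)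
  refine ⟨max X₁ (max (max X₂ X₃) (2 / ε)), hX₁.trans (le_max_left _ _), ?_⟩
  intro X Y hX hXY
  have h1 : X₁ ≤ X := (le_max_left _ _).trans hX
  have h2 : X₂ ≤ X := (le_max_left _ _).trans ((le_max_left _ _).trans ((le_max_right _ _).trans hX))
  have h3 : X₃ ≤ X := (le_max_right _ _).trans ((le_max_left _ _).trans ((le_max_right _ _).trans hX))
  have h4 : 2 / ε ≤ X := (le_max_right _ _).trans ((le_max_right _ _).trans hX)
  have hl := hX₂ X h2
  have hlog := hX₃ X h3
  have hX3 : 3 ≤ X := hX₁.trans h1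
  have hlog14 : 1 ≤ Real.log X ^ 14 := one_le_pow₀ hlog
  have hA : X ^ 2 * Real.log X ^ 14 ≤ Y := by
    refine le_trans ?_ hXY
    have : 0 ≤ X ^ 2 * Real.log X ^ 14 := by positivity
    nlinarith
  have hB : X ^ 2 ≤ Y := by nlinarith [sq_nonneg X]
  have hXYle : X ≤ Y := by nlinarith
  have hgr := hg X Y h1 hA
  have her := hE X Y (by linarith) hB
  have e1 : K * (X * √Y * (1 + Real.log Y) ^ 6) ≤ ε * ρ / 2 * Y := by
    calc K * (X * √Y * (1 + Real.log Y) ^ 6) ≤ K * (ε * ρ / (2 * K) * Y) := by gcongr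
      _ = ε * ρ / 2 * Y := by field_simp
  have e2 : |ρ| ≤ ε * ρ / 2 * Y := by
    rw [abs_of_pos hρ0]
    have : 2 ≤ Y * ε := by
      rw [div_le_iff₀ hε] at h4
      nlinarith
    nlinarith
  rw [abs_of_pos hρ0] at e2 ⊢
  rw [abs_of_pos hρ0] at her
  linarith
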